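/- Let W be a vector space over ℂ and let S be a pseudo-local subset of ℰ(W). Then W is a faithful pseudo-local quasi module for the nonlocal vertex algebra ⟨S⟩ generated by S, with Y_W(α(x), x₀) = α(x₀) for α(x) ∈ ⟨S⟩. Furthermore, if S is pseudo Γ-local for some subgroup Γ of ℂˣ, then W is a pseudo Γ-local quasi module for ⟨S⟩. -/

import Mathlib

noncomputable section

open Classical

namespace NVA

/-! ### The space ℰ(W) = Hom(W, W((x))), coefficient-indexed by modes:
`a w n` is the mode `a_n` applied to `w`, where `a(x)w = ∑ (a_n w) x^{-n-1}`.
Lower truncation of `a(x)w` in powers of `x` means `a_n w = 0` for `n` large. -/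

variable (W : Type*) [AddCommGroup W] [Module ℂ W]

/-- `ℰ(W) = Hom(W, W((x)))` as a submodule of `Hom(W, W[[x^{±1}]])`. -/
def EWsub : Submodule ℂ (W →ₗ[ℂ] (ℤ → W)) where
  carrier := {a | ∀ w : W, ∃ N : ℤ, ∀ n : ℤ, N ≤ n → a w n = 0}
  add_mem' := by
    intro a b ha hb w
    obtain ⟨N, hN⟩ := ha w
    obtain ⟨M, hM⟩ := hb w
    refine ⟨max N M, fun n hn => ?_⟩
    simp only [LinearMap.add_apply, Pi.add_apply,
      hN n (le_trans (le_max_left _ _) hn), hM n (le_trans (le_max_right _ _) hn), add_zero]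
  zero_mem' := by intro w; exact ⟨0, fun n _ => rfl⟩
  smul_mem' := by
    intro c a ha w
    obtain ⟨N, hN⟩ := ha w
    exact ⟨N, fun n hn => by
      simp only [LinearMap.smul_apply, Pi.smul_apply, hN n hn, smul_zero]⟩

/-- The type `ℰ(W)`. -/
abbrev EW := ↥(EWsub W)

variable {W}

/-- The mode function of an element of `ℰ(W)`. -/
def mf (a : EW W) : W → ℤ → W := fun w n => (a : W →ₗ[ℂ] (ℤ → W)) w n

/-- The identity operator `1_W`, as an element of `ℰ(W)`. -/
def oneE : EW W :=
  ⟨{ toFun := fun w n => if n = -1 then w else 0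
     map_add' := by
       intro w w'; funext n; by_cases h : n = -1 <;> simp [h]
     map_smul' := by
       intro c w; funext n; by_cases h : n = -1 <;> simp [h] },
   fun w => ⟨0, fun n hn => if_neg (by omega)⟩⟩

/-- The generalized binomial coefficient `C(m, j)` for `m ∈ ℤ`, as a complex number. -/
def binom (m : ℤ) (j : ℕ) : ℂ :=
  (∏ i ∈ Finset.range j, ((m : ℂ) - (i : ℂ))) / (j.factorial : ℂ)

/-- The coefficient of `x₁^m x₂^t` in `a(x₁) b(x₂) w`. -/
def Fab (a b : EW W) (w : W) (m t : ℤ) : W := mf a (mf b w (-t - 1)) (-m - 1)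

/-- Multiplication of a two-variable family by a polynomial `p(x₁,x₂)`. -/
def mulPoly (p : MvPolynomial (Fin 2) ℂ) (F : ℤ → ℤ → W) : ℤ → ℤ → W :=
  fun m t => ∑ d ∈ p.support, MvPolynomial.coeff d p • F (m - d 0) (t - d 1)

/-- A two-variable family lies in `W((x₁,x₂))` (jointly lower truncated). -/
def IsLaurent2 (F : ℤ → ℤ → W) : Prop :=
  ∃ N : ℤ, ∀ m t : ℤ, (m < N ∨ t < N) → F m t = 0

/-- Quasi compatibility of an ordered pair `(a(x), b(x))` in `ℰ(W)`:
`p(x₁,x₂) a(x₁) b(x₂) ∈ Hom(W, W((x₁,x₂)))` for some nonzero polynomial `p`. -/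
def QCPair (a b : EW W) : Prop :=
  ∃ p : MvPolynomial (Fin 2) ℂ, p ≠ 0 ∧ ∀ w, IsLaurent2 (mulPoly p (Fab a b w))

/-! ### Sequences -/

/-- The coefficient of `x₁^{k 1} ⋯ x_r^{k r}` in `ψ₁(x₁) ⋯ ψ_r(x_r) w`. -/
def seqCoeff : {r : ℕ} → (Fin r → EW W) → W → (Fin r → ℤ) → W
  | 0, _, w, _ => w
  | _ + 1, ψ, w, k => mf (ψ 0) (seqCoeff (Fin.tail ψ) w (Fin.tail k)) (-(k 0) - 1)

/-- The polynomial `∏_{1 ≤ i < j ≤ r} p(x_i, x_j)`. -/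
def pairPoly (p : MvPolynomial (Fin 2) ℂ) (r : ℕ) : MvPolynomial (Fin r) ℂ :=
  ∏ ij ∈ Finset.univ.filter (fun ij : Fin r × Fin r => ij.1 < ij.2),
    MvPolynomial.rename ![ij.1, ij.2] p

/-- Multiplication of an `r`-variable family by a polynomial in `r` variables. -/
def mulPolyN {r : ℕ} (P : MvPolynomial (Fin r) ℂ) (F : (Fin r → ℤ) → W) :
    (Fin r → ℤ) → W :=
  fun k => ∑ d ∈ P.support, MvPolynomial.coeff d P • F (fun i => k i - d i)

/-- An `r`-variable family lies in `W((x₁,…,x_r))`. -/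
def IsLaurentN {r : ℕ} (F : (Fin r → ℤ) → W) : Prop :=
  ∃ N : ℤ, ∀ k : Fin r → ℤ, (∃ i, k i < N) → F k = 0

/-- Quasi compatibility of an ordered sequence in `ℰ(W)`. -/
def QCSeq {r : ℕ} (ψ : Fin r → EW W) : Prop :=
  ∃ p : MvPolynomial (Fin 2) ℂ, p ≠ 0 ∧
    ∀ w, IsLaurentN (mulPolyN (pairPoly p r) (seqCoeff ψ w))

/-- Quasi compatibility of a subset of `ℰ(W)`. -/
def QCSet (S : Set (EW W)) : Prop :=
  ∀ (r : ℕ) (ψ : Fin r → EW W), (∀ i, ψ i ∈ S) → QCSeq ψ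

/-! ### The vertex operation `Y_ℰ^{(α)}` -/

/-- `ℂ((x))`. -/
abbrev LC : Type := LaurentSeries ℂ

/-- An iterated Laurent series field, e.g. `ℂ((x))((x₀))` (outer variable the second one). -/
abbrev K2 : Type := HahnSeries ℤ LC

/-- The outer variable of `K2`. -/
def xOuter : K2 := HahnSeries.single 1 1

/-- The inner variable of `K2`. -/
def xInner : K2 := HahnSeries.single 0 (HahnSeries.single 1 1)

/-- `α` times the inner variable of `K2`. -/
def xInnerC (c : ℂ) : K2 := HahnSeries.single 0 (HahnSeries.single 1 c)

/-- The polynomial `p(x₀ + α x, x)` as an element of `ℂ((x))((x₀))`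
(outer variable `x₀`). -/
def qK (p : MvPolynomial (Fin 2) ℂ) (α : ℂ) : K2 :=
  MvPolynomial.aeval ![xOuter + xInnerC α, xInner] p

/-- The expansion `ι_{x,x₀} (p(x₀ + α x, x)^{-1}) ∈ ℂ((x))((x₀))`. -/
def qInv (p : MvPolynomial (Fin 2) ℂ) (α : ℂ) : K2 := (qK p α)⁻¹

/-- The coefficient of `x₀^j x^t` in `(p(x₁,x) a(x₁) b(x) w)|_{x₁ = αx + x₀}`,
expanding via `(αx+x₀)^m = ∑_{j≥0} C(m,j) α^{m-j} x^{m-j} x₀^j`. -/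
def substYE (α : ℂ) (p : MvPolynomial (Fin 2) ℂ) (a b : EW W) (w : W)
    (j : ℕ) (t : ℤ) : W :=
  ∑ᶠ m : ℤ, (binom m j * α ^ (m - (j : ℤ))) • mulPoly p (Fab a b w) m (t - m + j)

/-- The coefficient of `x₀^J x^T` in
`ι_{x,x₀}(p(x₀+αx,x)^{-1}) ⬝ (p(x₁,x)a(x₁)b(x)w)|_{x₁ = αx+x₀}`. -/
def fullYE (α : ℂ) (p : MvPolynomial (Fin 2) ℂ) (a b : EW W) (w : W)
    (J T : ℤ) : W :=
  ∑ᶠ s : ℤ × ℤ, (((qInv p α).coeff s.1).coeff s.2) •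
    (if 0 ≤ J - s.1 then substYE α p a b w (J - s.1).toNat (T - s.2) else 0)

/-- The raw mode family of `Y_ℰ^{(α)}(a(x), x₀) b(x)`; `rawYE α a b n w m` is the mode
`m` of the element `a(x)_{(α,n)} b(x)` applied to `w`.  (Defined using a choice of
polynomial from quasi compatibility; by the general theory the value does not depend
on the choice.) -/
def rawYE (α : ℂ) (a b : EW W) (n : ℤ) (w : W) (m : ℤ) : W :=
  if h : QCPair a b then fullYE α h.choose a b w (-n - 1) (-m - 1) else 0

/-- `a(x)_{(α,n)} b(x)`, as an element of `ℰ(W)` whenever the raw family is realized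
by one (which is the case for any quasi compatible pair). -/
def YEa (α : ℂˣ) (a b : EW W) (n : ℤ) : EW W :=
  if h : ∃ c : EW W, ∀ w m, mf c w m = rawYE (α : ℂ) a b n w m then h.choose else 0

/-- `a(x)_n b(x) = a(x)_{(1,n)} b(x)`. -/
def YE (a b : EW W) (n : ℤ) : EW W := YEa 1 a b n

end NVA

namespace NVA

variable {W : Type*} [AddCommGroup W] [Module ℂ W]

/-- Submodules of `ℰ(W)` are `ℂ`-vector spaces (registered explicitly to assist
instance resolution). -/
noncomputable instance (V : Submodule ℂ (EW W)) : AddCommGroup ↥V :=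
  @Submodule.addCommGroup ℂ (EW W) _ inferInstance inferInstance V

noncomputable instance (V : Submodule ℂ (EW W)) : Module ℂ ↥V :=
  @Submodule.module ℂ (EW W) _ inferInstance inferInstance V

/-! ### Derivative and scaling operators on ℰ(W) -/

/-- `D = d/dx` on `ℰ(W)`: `(Da)_m = -m • a_{m-1}`. -/
def Dop (a : EW W) : EW W :=
  ⟨{ toFun := fun w m => (-m : ℂ) • mf a w (m - 1)
     map_add' := by intro w w'; funext m; simp [mf, map_add]
     map_smul' := by
       intro c w; funext m
       simp only [mf, map_smul, Pi.smul_apply, RingHom.id_apply]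
       exact smul_comm _ _ _ },
   by
     intro w
     obtain ⟨N, hN⟩ := a.2 w
     exact ⟨N + 1, fun m hm => by
       have : (a : W →ₗ[ℂ] (ℤ → W)) w (m - 1) = 0 := hN _ (by omega)
       simp [mf, this]⟩⟩

/-- `R_α : a(x) ↦ a(αx)`, on modes `(R_α a)_m = α^{-m-1} a_m`. -/
def RaE (α : ℂˣ) (a : EW W) : EW W :=
  ⟨{ toFun := fun w m => ((α : ℂ) ^ (-m - 1 : ℤ)) • mf a w m
     map_add' := by intro w w'; funext m; simp [mf, map_add]
     map_smul' := by
       intro c w; funext m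
       simp only [mf, map_smul, Pi.smul_apply, RingHom.id_apply]
       exact smul_comm _ _ _ },
   by
     intro w
     obtain ⟨N, hN⟩ := a.2 w
     exact ⟨N, fun m hm => by simp [mf, hN m hm]⟩⟩

/-! ### Nonlocal vertex algebras, modules and quasi modules -/

/-- The coefficient of `x₀^a x₂^b` in `Y₁(u, x₀+x₂) (Y₂(v,x₂) w)`, where
`(x₀+x₂)^m` is expanded in nonnegative powers of `x₂`. -/
def prodCE {V : Type*} (Yo Yi : V → W → ℤ → W) (u v : V) (w : W) (a b : ℤ) : W :=
  ∑ᶠ m : ℤ, if a ≤ m then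
    binom m (m - a).toNat • Yo u (Yi v w (-(b - (m - a)) - 1)) (-m - 1) else 0

/-- The coefficient of `x₀^a x₂^b` in `Y₂(Y₁(u,x₀)v, x₂) w`. -/
def assocCE {V : Type*} (Y1 : V → V → ℤ → V) (Y2 : V → W → ℤ → W)
    (u v : V) (w : W) (a b : ℤ) : W :=
  Y2 (Y1 u v (-a - 1)) w (-b - 1)

/-- Multiplication of a two-variable family (in `x₀, x₂`) by `f(x₀+x₂, x₂)` for a
polynomial `f`, expanding `(x₀+x₂)^d` in nonnegative powers of `x₂`. -/
def mulSubPoly (f : MvPolynomial (Fin 2) ℂ) (A : ℤ → ℤ → W) (a b : ℤ) : W :=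
  ∑ d ∈ f.support, ∑ i ∈ Finset.range (d 0 + 1),
    (MvPolynomial.coeff d f * ((d 0).choose i : ℂ)) •
      A (a - ((d 0 : ℤ) - i)) (b - i - (d 1 : ℤ))

/-- A nonlocal vertex algebra structure on a ℂ-vector space `V`:
a linear map `Y : V → ℰ(V) = Hom(V, V((x)))` and a vacuum vector `1` such that
`Y(1,x)v = v`, `Y(v,x)1 ∈ V[[x]]` with constant term `v`, and weak associativity
holds. -/
structure NLVA (V : Type*) [AddCommGroup V] [Module ℂ V] where
  Y : V →ₗ[ℂ] EW V
  one : V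
  vac : ∀ (v : V) (n : ℤ), mf (Y one) v n = if n = -1 then v else 0
  creation0 : ∀ (v : V) (n : ℤ), 0 ≤ n → mf (Y v) one n = 0
  creation1 : ∀ v : V, mf (Y v) one (-1) = v
  wassoc : ∀ u v w : V, ∃ l : ℕ, ∀ a b : ℤ,
    mulSubPoly (MvPolynomial.X 0 ^ l)
      (prodCE (fun x => mf (Y x)) (fun x => mf (Y x)) u v w) a b =
    mulSubPoly (MvPolynomial.X 0 ^ l)
      (assocCE (fun x y n => mf (Y x) y n) (fun x => mf (Y x)) u v w) a b

/-- The mode maps of a nonlocal vertex algebra: `Yf A u v n = u_n v`. -/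
def Yf {V : Type*} [AddCommGroup V] [Module ℂ V] (A : NLVA V) : V → V → ℤ → V :=
  fun u v n => mf (A.Y u) v n

/-- Mode maps of a linear map `V → ℰ(W)`. -/
def YWf {V : Type*} [AddCommGroup V] [Module ℂ V] (YW : V →ₗ[ℂ] EW W) :
    V → W → ℤ → W := fun v w n => mf (YW v) w n

/-- `(W, Y_W)` is a quasi module for the nonlocal vertex algebra `A` on `V`. -/
def IsQuasiModule {V : Type*} [AddCommGroup V] [Module ℂ V] (A : NLVA V)
    (YW : V →ₗ[ℂ] EW W) : Prop :=
  (∀ (w : W) (n : ℤ), mf (YW A.one) w n = if n = -1 then w else 0) ∧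
  ∀ (u v : V) (w : W), ∃ f : MvPolynomial (Fin 2) ℂ, f ≠ 0 ∧ ∀ a b : ℤ,
    mulSubPoly f (prodCE (YWf YW) (YWf YW) u v w) a b =
    mulSubPoly f (assocCE (Yf A) (YWf YW) u v w) a b

/-- `(W, Y_W)` is a module for the nonlocal vertex algebra `A` on `V`. -/
def IsModule {V : Type*} [AddCommGroup V] [Module ℂ V] (A : NLVA V)
    (YW : V →ₗ[ℂ] EW W) : Prop :=
  (∀ (w : W) (n : ℤ), mf (YW A.one) w n = if n = -1 then w else 0) ∧
  ∀ (u v : V) (w : W), ∃ l : ℕ, ∀ a b : ℤ,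
    mulSubPoly (MvPolynomial.X 0 ^ l) (prodCE (YWf YW) (YWf YW) u v w) a b =
    mulSubPoly (MvPolynomial.X 0 ^ l) (assocCE (Yf A) (YWf YW) u v w) a b

end NVA

namespace NVA

variable {W : Type*} [AddCommGroup W] [Module ℂ W]
variable {V : Type*} [AddCommGroup V] [Module ℂ V]

/-! ### Pseudo-locality -/

/-- A power series `∑ f n x^n` as a Laurent series. -/
def psN (f : ℕ → ℂ) : LC := HahnSeries.ofPowerSeries ℤ ℂ (PowerSeries.mk f)

/-- `ι_{x₂,x₁}` of a formal power series `F(x₁,x₂) ∈ ℂ[[x₁,x₂]]`, given by its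
coefficient function, as an element of `ℂ((x₂))((x₁))` (outer variable `x₁`). -/
def psEmbed (F : ℕ → ℕ → ℂ) : K2 :=
  HahnSeries.ofPowerSeries ℤ LC (PowerSeries.mk (fun m => psN (F m)))

/-- The coefficient function of a polynomial in two variables. -/
def polyCoeffFun (g : MvPolynomial (Fin 2) ℂ) : ℕ → ℕ → ℂ :=
  fun m t => MvPolynomial.coeff (Finsupp.single 0 m + Finsupp.single 1 t) g

/-- `ι_{x₂,x₁}` of a polynomial in two variables. -/
def polyEmbed (g : MvPolynomial (Fin 2) ℂ) : K2 := psEmbed (polyCoeffFun g)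

/-- The coefficient function of an element of `ℂ((x₂))((x₁))`:
`k2Fun x m t` is the coefficient of `x₁^m x₂^t`. -/
def k2Fun (x : K2) : ℤ → ℤ → ℂ := fun m t => (x.coeff m).coeff t

/-- Multiplication of a two-variable family by a scalar-valued two-variable series. -/
def smulFam (c : ℤ → ℤ → ℂ) (G : ℤ → ℤ → W) : ℤ → ℤ → W :=
  fun m t => ∑ᶠ s : ℤ × ℤ, c s.1 s.2 • G (m - s.1) (t - s.2)

/-- Multiplication of a two-variable family by a Laurent polynomial
`p ∈ ℂ[x₁^{±1}, x₂^{±1}]` (recorded by its finitely supported coefficients). -/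
def mulLPoly (p : (ℤ × ℤ) →₀ ℂ) (G : ℤ → ℤ → W) : ℤ → ℤ → W :=
  fun m t => ∑ d ∈ p.support, p d • G (m - d.1) (t - d.2)

/-- A subset `S ⊆ ℰ(W)` is pseudo-local. -/
def PseudoLocal (S : Set (EW W)) : Prop :=
  ∀ a ∈ S, ∀ b ∈ S, ∃ p : (ℤ × ℤ) →₀ ℂ, p ≠ 0 ∧
    ∃ (r : ℕ) (F : Fin r → (ℕ → ℕ → ℂ)) (g : Fin r → MvPolynomial (Fin 2) ℂ)
      (u v : Fin r → EW W),
      (∀ i, g i ≠ 0) ∧ (∀ i, u i ∈ S) ∧ (∀ i, v i ∈ S) ∧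
      ∀ (w : W) (m t : ℤ),
        mulLPoly p (Fab a b w) m t =
          ∑ i, smulFam (k2Fun (psEmbed (F i) * (polyEmbed (g i))⁻¹))
            (fun m' t' => Fab (u i) (v i) w t' m') m t

/-- The coefficient of `x₁^m x₂^t` in `ι_{x₂,x₁} f(x₂ - x₁)`, for `f(x) ∈ ℂ((x))`. -/
def expandSub (f : LC) : ℤ → ℤ → ℂ :=
  fun m t => if 0 ≤ m then
    ((-1 : ℂ) ^ m.toNat * binom (t + m) m.toNat) * f.coeff (t + m) else 0

/-- A subset `S ⊆ ℰ(W)` is `𝒮`-local. -/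
def SLocal (S : Set (EW W)) : Prop :=
  ∀ a ∈ S, ∀ b ∈ S, ∃ (k : ℕ) (r : ℕ) (f : Fin r → LC) (u v : Fin r → EW W),
    (∀ i, u i ∈ S) ∧ (∀ i, v i ∈ S) ∧
    ∀ (w : W) (m t : ℤ),
      mulPoly ((MvPolynomial.X 0 - MvPolynomial.X 1) ^ k) (Fab a b w) m t =
        ∑ i, mulPoly ((MvPolynomial.X 0 - MvPolynomial.X 1) ^ k)
          (smulFam (expandSub (f i)) (fun m' t' => Fab (u i) (v i) w t' m')) m t

/-- `U` is the nonlocal vertex algebra `⟨S⟩` generated by `S`: the smallest closed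
quasi compatible subspace of `ℰ(W)` containing `S ∪ {1_W}`. -/
def IsGenVA (S : Set (EW W)) (U : Submodule ℂ (EW W)) : Prop :=
  QCSet (U : Set (EW W)) ∧ (∀ a ∈ U, ∀ b ∈ U, ∀ n : ℤ, YE a b n ∈ U) ∧
  oneE ∈ U ∧ S ⊆ U ∧
  ∀ U' : Submodule ℂ (EW W),
    (QCSet (U' : Set (EW W)) ∧ (∀ a ∈ U', ∀ b ∈ U', ∀ n : ℤ, YE a b n ∈ U') ∧
      oneE ∈ U' ∧ S ⊆ (U' : Set (EW W))) → U ≤ U'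

/-! ### 𝒮-locality for maps and weak quantum vertex algebras -/

/-- The `𝒮`-locality identity
`(x₁-x₂)^k Y(u,x₁)Y(v,x₂) = ∑ᵢ (x₁-x₂)^k ι_{x₂,x₁}(fᵢ(x₂-x₁)) Y(vᵢ,x₂)Y(uᵢ,x₁)`
at the level of coefficient families, for mode maps `Ym`. -/
def sLocPair {V : Type*} (Ym : V → W → ℤ → W) (k : ℕ) (u v : V) {r : ℕ}
    (f : Fin r → LC) (vi ui : Fin r → V) : Prop :=
  ∀ (w : W) (m t : ℤ),
    mulPoly ((MvPolynomial.X 0 - MvPolynomial.X 1) ^ k)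
      (fun m' t' => Ym u (Ym v w (-t' - 1)) (-m' - 1)) m t =
    ∑ i, mulPoly ((MvPolynomial.X 0 - MvPolynomial.X 1) ^ k)
      (smulFam (expandSub (f i))
        (fun m' t' => Ym (vi i) (Ym (ui i) w (-m' - 1)) (-t' - 1))) m t

/-- A weak quantum vertex algebra: a nonlocal vertex algebra whose vertex operators
form an `𝒮`-local subspace of `ℰ(V)`. -/
def IsWeakQVA (A : NLVA V) : Prop :=
  ∀ u v : V, ∃ (k : ℕ) (r : ℕ) (f : Fin r → LC) (vi ui : Fin r → V),
    sLocPair (Yf A) k u v f vi ui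

end NVA

namespace NVA

variable {W : Type*} [AddCommGroup W] [Module ℂ W]

/-- The polynomial `∏ (x - α)` over a list of elements `α ∈ ℂˣ`; this describes the
elements of `ℂ_Γ[x]` (up to irrelevant nonzero scalars). -/
def gammaPoly (αs : List ℂˣ) : Polynomial ℂ :=
  (αs.map (fun α => Polynomial.X - Polynomial.C (α : ℂ))).prod

/-- Multiplication of a two-variable family by `p(x₁/x₂)` for a one-variable
polynomial `p`. -/
def mulRatPoly (p : Polynomial ℂ) (G : ℤ → ℤ → W) : ℤ → ℤ → W :=
  fun m t => ∑ d ∈ p.support, p.coeff d • G (m - d) (t + d)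

/-- `ι_{x₂,x₁}(p(x₁/x₂))` as an element of `ℂ((x₂))((x₁))` (outer variable `x₁`). -/
def iotaRatPoly (p : Polynomial ℂ) : K2 := Polynomial.aeval (xOuter * xInner⁻¹) p

/-- `ι_{x₂,x₁}` of an element `F(x₁,x₂) / (x₁^{e₁} x₂^{e₂} ∏ᵢ (x₁ - γᵢ x₂))` of
`ℂ_Γ(x₁,x₂) = ℂ[[x₁,x₂]][x₁⁻¹, x₂⁻¹, (x₁-γx₂)⁻¹ : γ ∈ Γ]`. -/
def iotaGammaPsi (F : ℕ → ℕ → ℂ) (e1 e2 : ℕ) (γs : List ℂˣ) : K2 :=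
  psEmbed F * (xOuter ^ e1 * xInner ^ e2 *
    (γs.map (fun γ => xOuter - xInnerC (γ : ℂ))).prod)⁻¹

/-- A subset `S ⊆ ℰ(W)` is pseudo `Γ`-local, for a subgroup `Γ ≤ ℂˣ`. -/
def PseudoGammaLocal (Γ : Subgroup ℂˣ) (S : Set (EW W)) : Prop :=
  ∀ a ∈ S, ∀ b ∈ S, ∃ αs : List ℂˣ, (∀ α ∈ αs, α ∈ Γ) ∧
    ∃ (r : ℕ) (F : Fin r → (ℕ → ℕ → ℂ)) (e1 e2 : Fin r → ℕ) (γs : Fin r → List ℂˣ)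
      (u v : Fin r → EW W),
      (∀ i, ∀ γ ∈ γs i, γ ∈ Γ) ∧ (∀ i, u i ∈ S) ∧ (∀ i, v i ∈ S) ∧
      ∀ (w : W) (m t : ℤ),
        mulRatPoly (gammaPoly αs) (Fab a b w) m t =
          ∑ i, smulFam
            (k2Fun (iotaRatPoly (gammaPoly αs) *
              iotaGammaPsi (F i) (e1 i) (e2 i) (γs i)))
            (fun m' t' => Fab (u i) (v i) w t' m') m t

section

set_option linter.unusedSectionVars false

variable {G H V V' : Type*} [AddCommGroup G] [AddCommGroup H] [AddCommGroup V] [Module ℂ V]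
  [AddCommGroup V'] [Module ℂ V']
variable {I J : Type}

/-! ### The action of Laurent polynomials on formal families -/

/-- The action of the group algebra of `G` on `V`-valued families indexed by `G`, the element
`single g 1` acting by translation by `g`. -/
def act : AddMonoidAlgebra ℂ G →ₐ[ℂ] Module.End ℂ (G → V) :=
  AddMonoidAlgebra.lift ℂ (Module.End ℂ (G → V)) G
    { toFun := fun g =>
        { toFun := fun F h => F (h - g.toAdd)
          map_add' := fun _ _ => rfl
          map_smul' := fun _ _ => rfl }
      map_one' := by ext; simp
      map_mul' := by
        intro a b; ext F h
        simp [sub_sub] }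

/-- The translation by `g`, as an element of the group algebra. -/
abbrev tr (g : G) : AddMonoidAlgebra ℂ G := AddMonoidAlgebra.single g 1

theorem act_single (g : G) (c : ℂ) (F : G → V) (h : G) :
    act (AddMonoidAlgebra.single g c) F h = c • F (h - g) := by
  simp [act, AddMonoidAlgebra.lift_single]

theorem act_tr (g : G) (F : G → V) (h : G) : act (tr g) F h = F (h - g) := by
  rw [act_single, one_smul]

theorem act_mul (f g : AddMonoidAlgebra ℂ G) (F : G → V) : act (f * g) F = act f (act g F) := by
  rw [map_mul]; rfl

theorem act_comm (f g : AddMonoidAlgebra ℂ G) (F : G → V) :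
    act f (act g F) = act g (act f F) := by
  rw [← act_mul, mul_comm, act_mul]

theorem act_one (F : G → V) : act (1 : AddMonoidAlgebra ℂ G) F = F := by
  rw [map_one]; rfl

theorem act_add (f g : AddMonoidAlgebra ℂ G) (F : G → V) :
    act (f + g) F = act f F + act g F := by
  rw [map_add]; rfl

theorem act_apply (f : AddMonoidAlgebra ℂ G) (F : G → V) (h : G) :
    act f F h = ∑ d ∈ f.coeff.support, f.coeff d • F (h - d) := by
  rw [act, AddMonoidAlgebra.lift_apply, Finsupp.sum]
  simp only [LinearMap.sum_apply, Finset.sum_apply]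
  rfl

/-- Semilinearity of a substitution operator: it suffices to check the generators. -/
theorem semilin {n : ℕ} (L : (G → V) → (H → V')) (D : (G → V) → Prop)
    (X : Fin n → AddMonoidAlgebra ℂ G) (Y : Fin n → AddMonoidAlgebra ℂ H)
    (hadd : ∀ F F', D F → D F' → L (F + F') = L F + L F')
    (hsmul : ∀ (c : ℂ) F, D F → L (c • F) = c • L F)
    (Dadd : ∀ F F', D F → D F' → D (F + F'))
    (Dsmul : ∀ (c : ℂ) F, D F → D (c • F))
    (DX : ∀ i F, D F → D (act (X i) F))
    (hX : ∀ i F, D F → L (act (X i) F) = act (Y i) (L F))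
    (p : MvPolynomial (Fin n) ℂ) :
    ∀ F, D F → D (act (MvPolynomial.aeval X p) F) ∧
      L (act (MvPolynomial.aeval X p) F) = act (MvPolynomial.aeval Y p) (L F) := by
  induction p using MvPolynomial.induction_on with
  | C a =>
    intro F hF
    simp only [MvPolynomial.algHom_C, AlgHom.commutes, Module.algebraMap_end_apply]
    exact ⟨Dsmul _ _ hF, hsmul _ _ hF⟩
  | add p q hp hq =>
    intro F hF
    obtain ⟨h1, h2⟩ := hp F hF
    obtain ⟨h3, h4⟩ := hq F hF
    simp only [map_add, LinearMap.add_apply]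
    exact ⟨Dadd _ _ h1 h3, by rw [hadd _ _ h1 h3, h2, h4]⟩
  | mul_X p i hp =>
    intro F hF
    simp only [map_mul, MvPolynomial.aeval_X, Module.End.mul_apply]
    obtain ⟨h1, h2⟩ := hp _ (DX i F hF)
    exact ⟨h1, by rw [h2, hX i F hF]⟩

theorem act_map (φ : V →ₗ[ℂ] V') (f : AddMonoidAlgebra ℂ G) (F : G → V) :
    act f (fun g => φ (F g)) = fun g => φ (act f F g) := by
  funext g
  simp only [act_apply, map_sum, map_smul]

theorem act_comp_equiv {n : ℕ} (e : G ≃+ H) (x : Fin n → H) (p : MvPolynomial (Fin n) ℂ)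
    (F : H → V) :
    (fun g => act (MvPolynomial.aeval (fun i => tr (x i)) p) F (e g)) =
      act (MvPolynomial.aeval (fun i => tr (e.symm (x i))) p) (fun g => F (e g)) :=
  (semilin (fun F g => F (e g)) (fun _ => True) (fun i => tr (x i))
    (fun i => tr (e.symm (x i))) (fun _ _ _ _ => rfl) (fun _ _ _ => rfl) (fun _ _ _ _ => trivial)
    (fun _ _ _ => trivial) (fun _ _ _ => trivial)
    (fun i F _ => by funext g; simp [act_tr]) p F trivial).2

/-- Cancellation of a Laurent polynomial acting on a family whose support has minimal elements,
relative to a set `B` which is stable under the relevant translations. -/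
theorem act_cancel {L : Type*} [AddCommGroup L] [LinearOrder L] [IsOrderedAddMonoid L]
    (l : G →+ L) (hl : Function.Injective l) (f : AddMonoidAlgebra ℂ G) (d₀ : G)
    (hd₀ : f.coeff d₀ ≠ 0) (hmin : ∀ d, f.coeff d ≠ 0 → l d₀ ≤ l d) (B : Set G)
    (hB : ∀ g ∈ B, ∀ d, f.coeff d ≠ 0 → g - (d - d₀) ∈ B) (Y : G → V)
    (hY : (∃ g ∈ B, Y g ≠ 0) → ∃ g ∈ B, Y g ≠ 0 ∧ ∀ g' ∈ B, Y g' ≠ 0 → l g ≤ l g')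
    (h0 : ∀ g ∈ B, act f Y (g + d₀) = 0) : ∀ g ∈ B, Y g = 0 := by
  by_contra! hne
  obtain ⟨g, hg, hgY, hgm⟩ := hY hne
  have h := h0 g hg
  rw [act_apply, Finset.sum_eq_single d₀] at h
  · rw [add_sub_cancel_right] at h
    exact (smul_ne_zero hd₀ hgY) h
  · intro d hd hdne
    have hd' : f.coeff d ≠ 0 := by simpa using hd
    have hlt : l d₀ < l d := lt_of_le_of_ne (hmin d hd') (fun h => hdne (hl h.symm))
    by_contra hc
    have hY' : Y (g + d₀ - d) ≠ 0 := fun h => hc (by rw [h, smul_zero])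
    have e : g + d₀ - d = g - (d - d₀) := by abel
    rw [e] at hY'
    have := hgm _ (hB g hg d hd') hY'
    rw [map_sub, map_sub] at this
    have h3 : l d - l d₀ ≤ 0 := by simpa using this
    exact absurd (sub_nonpos.mp h3) (not_le.mpr hlt)
  · intro h; exact absurd (by simpa using h) hd₀

theorem tr_mul (g h : G) : tr g * tr h = tr (g + h) := by
  simp [tr, AddMonoidAlgebra.single_mul_single]

theorem tr_pow (g : G) (n : ℕ) : tr g ^ n = tr (n • g) := by
  simp [tr, AddMonoidAlgebra.single_pow]

theorem prod_tr {n : ℕ} (x : Fin n → G) (s : Finset (Fin n)) :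
    ∏ i ∈ s, tr (x i) = tr (∑ i ∈ s, x i) := by
  induction s using Finset.induction_on with
  | empty => simp [tr, AddMonoidAlgebra.one_def]
  | insert a s ha ih => rw [Finset.prod_insert ha, Finset.sum_insert ha, ih, tr_mul]

theorem act_aeval_apply {n : ℕ} (x : Fin n → G) (p : MvPolynomial (Fin n) ℂ) (F : G → V) (g : G) :
    act (MvPolynomial.aeval (fun i => tr (x i)) p) F g =
      ∑ d ∈ p.support, MvPolynomial.coeff d p • F (g - ∑ i, d i • x i) := by
  rw [MvPolynomial.aeval_def, MvPolynomial.eval₂_eq', map_sum, LinearMap.sum_apply,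
    Finset.sum_apply]
  refine Finset.sum_congr rfl fun d _ => ?_
  simp only [tr_pow]
  rw [prod_tr, act_mul, AlgHom.commutes, Module.algebraMap_end_apply, Pi.smul_apply, act_tr]

theorem coeff_eq_act (f : AddMonoidAlgebra ℂ G) (g : G) :
    f.coeff g = act f (fun h : G => if h = 0 then (1 : ℂ) else 0) g := by
  rw [act_apply, Finset.sum_eq_single g]
  · simp
  · intro d _ hd
    rw [if_neg (sub_ne_zero.mpr hd.symm), smul_zero]
  · intro h
    rw [Finsupp.notMem_support_iff.mp h, zero_smul]

theorem exists_act_ne {f : AddMonoidAlgebra ℂ G} (hf : f ≠ 0) : ∃ d, f.coeff d ≠ 0 := by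
  by_contra! h
  exact hf (by ext d; simpa using h d)

/-- The polynomial `p(x₁, x)` as an element of the group algebra of `ℤ × ℤ`. -/
abbrev pe (p : MvPolynomial (Fin 2) ℂ) : AddMonoidAlgebra ℂ (ℤ × ℤ) :=
  MvPolynomial.aeval ![tr (1, 0), tr (0, 1)] p

/-- The polynomial `p(x₀ + x, x)` as an element of the group algebra of `ℤ × ℤ`. -/
abbrev qe (p : MvPolynomial (Fin 2) ℂ) : AddMonoidAlgebra ℂ (ℤ × ℤ) :=
  MvPolynomial.aeval ![tr (1, 0) + tr (0, 1), tr (0, 1)] p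

theorem vec2_tr (x y : G) : ![tr x, tr y] = fun i : Fin 2 => tr (![x, y] i) := by
  funext i; fin_cases i <;> rfl

theorem vec3_tr (x y z : G) : ![tr x, tr y, tr z] = fun i : Fin 3 => tr (![x, y, z] i) := by
  funext i; fin_cases i <;> rfl

theorem act_pe_apply (p : MvPolynomial (Fin 2) ℂ) (F : ℤ × ℤ → V) (g : ℤ × ℤ) :
    act (pe p) F g = ∑ d ∈ p.support, MvPolynomial.coeff d p • F (g.1 - d 0, g.2 - d 1) := by
  rw [pe, vec2_tr, act_aeval_apply]
  refine Finset.sum_congr rfl fun d _ => ?_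
  congr 2
  ext <;> simp

theorem mulPoly_eq (p : MvPolynomial (Fin 2) ℂ) (F : ℤ → ℤ → V) (m t : ℤ) :
    mulPoly p F m t = act (pe p) (fun g => F g.1 g.2) (m, t) := by
  rw [act_pe_apply]; rfl

theorem pe_ne_zero {p : MvPolynomial (Fin 2) ℂ} (hp : p ≠ 0) : pe p ≠ 0 := by
  obtain ⟨d, hd⟩ := MvPolynomial.ne_zero_iff.mp hp
  intro h
  have h1 := coeff_eq_act (pe p) ((d 0 : ℤ), (d 1 : ℤ))
  rw [act_pe_apply, h, Finset.sum_eq_single d] at h1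
  · simp only [sub_self, Prod.mk_zero_zero, if_true, smul_eq_mul, mul_one] at h1
    exact hd h1.symm
  · intro d' _ hne
    rw [if_neg, smul_zero]
    intro h2
    apply hne
    simp only [Prod.mk_eq_zero, sub_eq_zero] at h2
    ext i; fin_cases i
    · exact_mod_cast h2.1.symm
    · exact_mod_cast h2.2.symm
  · intro h2; simp at h2; exact absurd h2 hd

/-- `p(x₀ + x, x)` as a polynomial. -/
def shear (p : MvPolynomial (Fin 2) ℂ) : MvPolynomial (Fin 2) ℂ :=
  MvPolynomial.aeval ![MvPolynomial.X 0 + MvPolynomial.X 1, MvPolynomial.X 1] p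

theorem shear_ne_zero {p : MvPolynomial (Fin 2) ℂ} (hp : p ≠ 0) : shear p ≠ 0 := by
  intro h
  apply hp
  have h2 : MvPolynomial.aeval (R := ℂ)
      ![MvPolynomial.X 0 - MvPolynomial.X 1, (MvPolynomial.X 1 : MvPolynomial (Fin 2) ℂ)]
      (shear p) = p := by
    rw [shear, ← AlgHom.comp_apply]
    conv_rhs => rw [← AlgHom.id_apply (R := ℂ) p]
    congr 1
    apply MvPolynomial.algHom_ext
    intro i; fin_cases i <;> simp
  rw [← h2, h, map_zero]

theorem qe_eq (p : MvPolynomial (Fin 2) ℂ) : qe p = pe (shear p) := by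
  rw [qe, pe, shear, ← AlgHom.comp_apply]
  congr 1
  apply MvPolynomial.algHom_ext
  intro i; fin_cases i <;> simp

theorem qe_ne_zero {p : MvPolynomial (Fin 2) ℂ} (hp : p ≠ 0) : qe p ≠ 0 := by
  rw [qe_eq]; exact pe_ne_zero (shear_ne_zero hp)

theorem mulSubPoly_eq (f : MvPolynomial (Fin 2) ℂ) (A : ℤ → ℤ → V) (a b : ℤ) :
    mulSubPoly f A a b = act (qe f) (fun g => A g.1 g.2) (a, b) := by
  rw [qe, MvPolynomial.aeval_def, MvPolynomial.eval₂_eq', map_sum, LinearMap.sum_apply,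
    Finset.sum_apply, mulSubPoly]
  refine Finset.sum_congr rfl fun d _ => ?_
  rw [act_mul, AlgHom.commutes, Module.algebraMap_end_apply, Pi.smul_apply]
  simp only [Fin.prod_univ_two, Matrix.cons_val_zero, Matrix.cons_val_one]
  rw [add_comm (tr ((1 : ℤ), (0 : ℤ))), add_pow, Finset.sum_mul, map_sum, LinearMap.sum_apply,
    Finset.sum_apply, Finset.smul_sum]
  refine Finset.sum_congr rfl fun i hi => ?_
  have hi' : i ≤ d 0 := by simpa [Nat.lt_succ_iff] using hi
  rw [tr_pow, tr_pow, tr_pow, tr_mul,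
    show ((d 0).choose i : AddMonoidAlgebra ℂ (ℤ × ℤ)) =
      algebraMap ℂ _ ((d 0).choose i : ℂ) by simp, mul_right_comm, tr_mul, mul_comm (tr _),
    act_mul, AlgHom.commutes, Module.algebraMap_end_apply, Pi.smul_apply, act_tr, smul_smul]
  congr 2
  · simp [hi']
  · simp; ring

/-- A family which is lower truncated in the first variable, and whose coefficients are lower
truncated in the second one. -/
def Nested2 (Y : ℤ × ℤ → V) : Prop :=
  (∃ N : ℤ, ∀ j < N, ∀ t, Y (j, t) = 0) ∧ ∀ j, ∃ N : ℤ, ∀ t < N, Y (j, t) = 0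

/-- The additive map to the lexicographic product. -/
def lex2 : ℤ × ℤ →+ ℤ ×ₗ ℤ where
  toFun := toLex
  map_zero' := rfl
  map_add' _ _ := rfl

theorem exists_int_min {P : ℤ → Prop} (N : ℤ) (hN : ∀ j < N, ¬ P j) (h : ∃ j, P j) :
    ∃ j, P j ∧ ∀ j', P j' → j ≤ j' := by
  obtain ⟨j, h1, h2⟩ := Int.exists_least_of_bdd (P := P)
    ⟨N, fun z hz => not_lt.mp fun h => hN z h hz⟩ h
  exact ⟨j, h1, h2⟩

theorem exists_min_coeff {L : Type*} [LinearOrder L] (l : G → L)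
    {f : AddMonoidAlgebra ℂ G} (hf : f ≠ 0) :
    ∃ d₀, f.coeff d₀ ≠ 0 ∧ ∀ d, f.coeff d ≠ 0 → l d₀ ≤ l d := by
  obtain ⟨d, hd⟩ := exists_act_ne hf
  obtain ⟨d₀, h1, h2⟩ := Finset.exists_min_image f.coeff.support l ⟨d, by simpa using hd⟩
  exact ⟨d₀, by simpa using h1, fun d hd => h2 d (by simpa using hd)⟩

theorem Nested2.eq_zero {Y : ℤ × ℤ → V} (hY : Nested2 Y) {f : AddMonoidAlgebra ℂ (ℤ × ℤ)}
    (hf : f ≠ 0) (h : act f Y = 0) : Y = 0 := by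
  obtain ⟨d₀, h1, h2⟩ := exists_min_coeff lex2 hf
  have := act_cancel lex2 (fun _ _ h => h) f d₀ h1 h2 Set.univ (fun _ _ _ _ => trivial) Y
    (by
      rintro ⟨⟨j, t⟩, -, hne⟩
      obtain ⟨N, hN⟩ := hY.1
      obtain ⟨j₀, ⟨t₁, ht₁⟩, hj₀⟩ := exists_int_min (P := fun j => ∃ t, Y (j, t) ≠ 0) N
        (fun j hj ⟨t, ht⟩ => ht (hN j hj t)) ⟨j, t, hne⟩
      obtain ⟨M, hM⟩ := hY.2 j₀
      obtain ⟨t₀, ht₀, ht₀'⟩ := exists_int_min (P := fun t => Y (j₀, t) ≠ 0) M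
        (fun t ht h => h (hM t ht)) ⟨t₁, ht₁⟩
      refine ⟨(j₀, t₀), trivial, ht₀, ?_⟩
      rintro ⟨j', t'⟩ - hne'
      refine (Prod.Lex.toLex_le_toLex).mpr ?_
      rcases lt_or_eq_of_le (hj₀ j' ⟨t', hne'⟩) with hlt | heq
      · exact Or.inl hlt
      · refine Or.inr ⟨heq, ?_⟩
        subst heq
        exact ht₀' t' hne')
    (fun g _ => by rw [h]; rfl)
  funext g
  exact this g trivial

theorem Nested2.smul {Y : ℤ × ℤ → V} (c : ℂ) (hY : Nested2 Y) : Nested2 (c • Y) := by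
  refine ⟨?_, fun j => ?_⟩
  · obtain ⟨N, hN⟩ := hY.1
    exact ⟨N, fun j hj t => by simp [hN j hj t]⟩
  · obtain ⟨N, hN⟩ := hY.2 j
    exact ⟨N, fun t ht => by simp [hN t ht]⟩

theorem Nested2.add {Y Z : ℤ × ℤ → V} (hY : Nested2 Y) (hZ : Nested2 Z) : Nested2 (Y + Z) := by
  refine ⟨?_, fun j => ?_⟩
  · obtain ⟨N, hN⟩ := hY.1
    obtain ⟨M, hM⟩ := hZ.1
    exact ⟨min N M, fun j hj t => by simp [hN j (by omega) t, hM j (by omega) t]⟩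
  · obtain ⟨N, hN⟩ := hY.2 j
    obtain ⟨M, hM⟩ := hZ.2 j
    exact ⟨min N M, fun t ht => by simp [hN t (by omega), hM t (by omega)]⟩

theorem Nested2.zero : Nested2 (0 : ℤ × ℤ → V) :=
  ⟨⟨0, fun _ _ _ => rfl⟩, fun _ => ⟨0, fun _ _ => rfl⟩⟩

theorem Nested2.sum {ι : Type*} (s : Finset ι) {Y : ι → ℤ × ℤ → V}
    (h : ∀ i ∈ s, Nested2 (Y i)) : Nested2 (∑ i ∈ s, Y i) := by
  induction s using Finset.induction_on with
  | empty => simpa using Nested2.zero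
  | insert a s ha ih =>
    rw [Finset.sum_insert ha]
    exact (h a (by simp)).add (ih fun i hi => h i (by simp [hi]))

theorem Nested2.tr {Y : ℤ × ℤ → V} (d : ℤ × ℤ) (hY : Nested2 Y) :
    Nested2 (fun g => Y (g - d)) := by
  refine ⟨?_, fun j => ?_⟩
  · obtain ⟨N, hN⟩ := hY.1
    exact ⟨N + d.1, fun j hj t => hN _ (by simp; omega) _⟩
  · obtain ⟨N, hN⟩ := hY.2 (j - d.1)
    exact ⟨N + d.2, fun t ht => hN _ (by simp; omega)⟩

theorem act_eq_sum (f : AddMonoidAlgebra ℂ G) (F : G → V) :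
    act f F = ∑ d ∈ f.coeff.support, f.coeff d • fun g => F (g - d) := by
  funext g
  rw [act_apply, Finset.sum_apply]
  rfl

theorem Nested2.act {Y : ℤ × ℤ → V} (f : AddMonoidAlgebra ℂ (ℤ × ℤ)) (hY : Nested2 Y) :
    Nested2 (act f Y) := by
  rw [act_eq_sum]
  exact Nested2.sum _ fun d _ => (hY.tr d).smul _

theorem Nested2.neg {Y : ℤ × ℤ → V} (hY : Nested2 Y) : Nested2 (-Y) := by
  rw [← neg_one_smul ℂ]; exact hY.smul _

theorem Nested2.eq_of_act {Y Z : ℤ × ℤ → V} (hY : Nested2 Y) (hZ : Nested2 Z)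
    {f : AddMonoidAlgebra ℂ (ℤ × ℤ)} (hf : f ≠ 0) (h : NVA.act f Y = NVA.act f Z) : Y = Z := by
  rw [← sub_eq_zero, sub_eq_add_neg]
  refine (hY.add hZ.neg).eq_zero hf ?_
  rw [map_add, map_neg, h, add_neg_cancel]

theorem Nested2.map {Y : ℤ × ℤ → V} (φ : V →ₗ[ℂ] V') (hY : Nested2 Y) :
    Nested2 (fun g => φ (Y g)) := by
  refine ⟨?_, fun j => ?_⟩
  · obtain ⟨N, hN⟩ := hY.1
    exact ⟨N, fun j hj t => by simp [hN j hj t]⟩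
  · obtain ⟨N, hN⟩ := hY.2 j
    exact ⟨N, fun t ht => by simp [hN t ht]⟩

section

/-! ### Substitutions -/

theorem binom_eq (m : ℤ) (j : ℕ) : binom m j = Ring.choose (m : ℂ) j := by
  rw [Ring.choose_eq_smul, binom, ← Polynomial.aeval_eq_smeval, Polynomial.aeval_def,
    Polynomial.eval₂_eq_eval_map, descPochhammer_map, descPochhammer_eval_eq_prod_range,
    div_eq_inv_mul, smul_eq_mul]

theorem binom_succ (m : ℤ) (j : ℕ) : binom (m + 1) (j + 1) = binom m j + binom m (j + 1) := by
  simp only [binom_eq, Int.cast_add, Int.cast_one]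
  exact Ring.choose_succ_succ _ _

theorem binom_zero (m : ℤ) : binom m 0 = 1 := by simp [binom]

theorem binom_nat (n j : ℕ) : binom (n : ℤ) j = (n.choose j : ℂ) := by
  rw [binom_eq]
  exact_mod_cast Ring.choose_natCast (R := ℂ) n j

theorem binom_add (a b : ℤ) (n : ℕ) :
    binom (a + b) n = ∑ ij ∈ Finset.HasAntidiagonal.antidiagonal n, binom a ij.1 * binom b ij.2 := by
  simp only [binom_eq, Int.cast_add]
  exact Ring.add_choose_eq n (Commute.all _ _)

theorem binom_mul_choose (a : ℤ) (i q : ℕ) :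
    binom a (i + q) * ((i + q).choose i : ℂ) = binom a i * binom (a - i) q := by
  simp only [binom_eq, Int.cast_sub, Int.cast_natCast]
  have := Ring.choose_smul_choose (a : ℂ) (n := i + q) (k := i) (by omega)
  rw [add_tsub_cancel_left, nsmul_eq_mul] at this
  rw [← this, mul_comm]

/-- The substitution operator with kernel `κ`: `κ m a` is the coefficient of
`x₀^a x^(m-a)` in the expansion of the `m`-th power of the first variable. -/
def sub (κ : ℤ → ℤ → ℂ) (F : ℤ × ℤ → V) : ℤ × ℤ → V :=
  fun g => ∑ᶠ m : ℤ, κ m g.1 • F (m, g.1 + g.2 - m)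

/-- The domain of the substitution operator. -/
def SD (κ : ℤ → ℤ → ℂ) (F : ℤ × ℤ → V) : Prop :=
  ∀ a s : ℤ, {m | κ m a ≠ 0 ∧ F (m, s - m) ≠ 0}.Finite

/-- The kernel satisfies the Pascal recursion. -/
def IsPascal (κ : ℤ → ℤ → ℂ) : Prop := ∀ m a, κ (m + 1) a = κ m (a - 1) + κ m a

/-- The expansion of `(x + x₀)^m` in nonnegative powers of `x₀`. -/
def κin (m a : ℤ) : ℂ := if 0 ≤ a then binom m a.toNat else 0

/-- The expansion of `(x₀ + x)^m` in nonnegative powers of `x`. -/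
def κout (m a : ℤ) : ℂ := if a ≤ m then binom m (m - a).toNat else 0

theorem κin_pascal : IsPascal κin := by
  intro m a
  unfold κin
  rcases lt_trichotomy a 0 with h | h | h
  · simp [show ¬ 0 ≤ a by omega, show ¬ 1 ≤ a by omega]
  · subst h; simp [binom_zero]
  · obtain ⟨n, rfl⟩ : ∃ n : ℕ, a = n + 1 := ⟨(a - 1).toNat, by omega⟩
    simp only [add_sub_cancel_right]
    rw [if_pos (by omega), if_pos (by omega), if_pos (by omega)]
    exact binom_succ _ _

theorem κout_pascal : IsPascal κout := by
  intro m a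
  unfold κout
  rcases lt_trichotomy (m + 1 - a) 0 with h | h | h
  · rw [if_neg (by omega), if_neg (by omega), if_neg (by omega), add_zero]
  · obtain rfl : a = m + 1 := by omega
    simp [binom_zero]
  · obtain ⟨n, rfl⟩ : ∃ n : ℕ, m = a + n := ⟨(m - a).toNat, by omega⟩
    rw [if_pos (by omega), if_pos (by omega), if_pos (by omega),
      show (a + n + 1 - a).toNat = n + 1 by omega, show (a + n - (a - 1)).toNat = n + 1 by omega,
      show (a + n - a).toNat = n by omega, binom_succ, add_comm]

theorem κin_eq_κout {m a : ℤ} (hm : 0 ≤ m) : κin m a = κout m a := by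
  lift m to ℕ using hm
  unfold κin κout
  by_cases h1 : 0 ≤ a
  · lift a to ℕ using h1
    by_cases h2 : (a : ℤ) ≤ m
    · rw [if_pos (by omega), if_pos h2, binom_nat, binom_nat,
        show ((m : ℤ) - a).toNat = m - a by omega, Nat.choose_symm (by omega)]
      simp
    · rw [if_pos (by omega), if_neg h2, binom_nat, Nat.choose_eq_zero_of_lt (by omega)]
      simp
  · rw [if_neg h1, if_pos (by omega), binom_nat, Nat.choose_eq_zero_of_lt (by omega)]
    simp

variable {κ : ℤ → ℤ → ℂ} {F F' : ℤ × ℤ → V}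

theorem SD.fin (h : SD κ F) (a s : ℤ) :
    (Function.support fun m => κ m a • F (m, s - m)).Finite :=
  (h a s).subset fun m hm => by
    rw [Function.mem_support] at hm
    exact ⟨left_ne_zero_of_smul hm, right_ne_zero_of_smul hm⟩

theorem sub_add (h : SD κ F) (h' : SD κ F') : sub κ (F + F') = sub κ F + sub κ F' := by
  funext g
  simp only [sub, Pi.add_apply, smul_add]
  exact finsum_add_distrib (h.fin _ _) (h'.fin _ _)

theorem sub_smul (c : ℂ) : sub κ (c • F) = c • sub κ F := by
  funext g
  simp only [sub, Pi.smul_apply, smul_finsum]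
  exact finsum_congr fun m => smul_comm _ _ _

theorem SD.add (h : SD κ F) (h' : SD κ F') : SD κ (F + F') := fun a s =>
  ((h a s).union (h' a s)).subset fun m ⟨h1, h2⟩ => by
    by_cases h3 : F (m, s - m) = 0
    · right; refine ⟨h1, fun h4 => h2 (by simp [h3, h4])⟩
    · exact Or.inl ⟨h1, h3⟩

theorem SD.smul (c : ℂ) (h : SD κ F) : SD κ (c • F) := fun a s =>
  (h a s).subset fun m ⟨h1, h2⟩ => ⟨h1, fun h3 => h2 (by simp [h3])⟩

theorem SD.tr_right (h : SD κ F) : SD κ (act (tr ((0 : ℤ), (1 : ℤ))) F) := fun a s =>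
  (h a (s - 1)).subset fun m ⟨h1, h2⟩ => ⟨h1, fun h3 => h2 (by
    rw [act_tr, ← h3]; congr 1; ext <;> simp; ring)⟩

theorem SD.tr_left (hκ : IsPascal κ) (h : SD κ F) : SD κ (act (tr ((1 : ℤ), (0 : ℤ))) F) :=
  fun a s => by
    refine (((h (a - 1) (s - 1)).union (h a (s - 1))).image (· + 1)).subset ?_
    rintro m ⟨h1, h2⟩
    refine ⟨m - 1, ?_, by simp⟩
    have h3 : F (m - 1, s - 1 - (m - 1)) ≠ 0 := fun h3 => h2 (by
      rw [act_tr, ← h3]; congr 1; ext <;> simp)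
    have h4 := hκ (m - 1) a
    rw [sub_add_cancel] at h4
    by_cases h5 : κ (m - 1) a = 0
    · exact Or.inl ⟨fun h6 => h1 (by rw [h4, h5, h6, add_zero]), h3⟩
    · exact Or.inr ⟨h5, h3⟩

theorem sub_tr_right : sub κ (act (tr ((0 : ℤ), (1 : ℤ))) F) = act (tr (0, 1)) (sub κ F) := by
  funext g
  rw [act_tr]
  simp only [sub, act_tr]
  refine finsum_congr fun m => ?_
  simp
  congr 3
  ring

theorem sub_tr_left (hκ : IsPascal κ) (h : SD κ F) :
    sub κ (act (tr ((1 : ℤ), (0 : ℤ))) F) = act (tr (1, 0) + tr (0, 1)) (sub κ F) := by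
  funext ⟨a, b⟩
  rw [act_add, Pi.add_apply, act_tr, act_tr]
  simp only [sub, act_tr, Prod.mk_sub_mk, sub_zero]
  have e1 : a - 1 + b = a + b - 1 := by ring
  have e2 : a + (b - 1) = a + b - 1 := by ring
  rw [e1, e2, ← finsum_add_distrib (h.fin _ _) (h.fin _ _),
    ← finsum_comp_equiv (Equiv.addRight (1 : ℤ))]
  refine finsum_congr fun m => ?_
  simp only [Equiv.coe_addRight, add_sub_cancel_right, hκ m a, ← add_smul]
  congr 3
  ring

/-- Substitution intertwines multiplication by `p(x₁, x)` and by `p(x₀ + x, x)`. -/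
theorem sub_act (hκ : IsPascal κ) (p : MvPolynomial (Fin 2) ℂ) (h : SD κ F) :
    SD κ (act (pe p) F) ∧ sub κ (act (pe p) F) = act (qe p) (sub κ F) :=
  semilin (sub κ) (SD κ) _ _ (fun _ _ => sub_add) (fun c _ _ => sub_smul c)
    (fun _ _ => SD.add) (fun c _ => SD.smul c)
    (fun i F hF => by
      fin_cases i
      · exact hF.tr_left hκ
      · exact hF.tr_right)
    (fun i F hF => by
      fin_cases i
      · exact sub_tr_left hκ hF
      · exact sub_tr_right) p F h

theorem sub_map (φ : V →ₗ[ℂ] V') (h : SD κ F) :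
    sub κ (fun g => φ (F g)) = fun g => φ (sub κ F g) := by
  funext g
  simp only [sub]
  have := φ.toAddMonoidHom.map_finsum (h.fin g.1 (g.1 + g.2))
  rw [LinearMap.toAddMonoidHom_coe] at this
  rw [this]
  simp only [map_smul]

theorem SD.map (φ : V →ₗ[ℂ] V') (h : SD κ F) : SD κ (fun g => φ (F g)) := fun a s =>
  (h a s).subset fun m ⟨h1, h2⟩ => ⟨h1, fun h3 => h2 (by simp [h3])⟩

/-- A family in `V((x₁, x))`. -/
def Laurent (F : ℤ × ℤ → V) : Prop := ∃ N : ℤ, ∀ m t : ℤ, m < N ∨ t < N → F (m, t) = 0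

theorem Laurent.SD (h : Laurent F) : SD κ F := fun a s => by
  obtain ⟨N, hN⟩ := h
  refine (Set.finite_Icc N (s - N)).subset fun m ⟨_, h2⟩ => ?_
  by_contra h3
  exact h2 (hN _ _ (by rw [Set.mem_Icc] at h3; omega))

theorem Laurent.sub_nested (h : Laurent F) : Nested2 (sub κin F) := by
  obtain ⟨N, hN⟩ := h
  refine ⟨⟨0, fun j hj t => ?_⟩, fun j => ⟨2 * N - j, fun t ht => ?_⟩⟩
  · exact finsum_eq_zero_of_forall_eq_zero fun m => by simp [κin, hj]
  · refine finsum_eq_zero_of_forall_eq_zero fun m => ?_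
    rw [hN _ _ (by simp; omega), smul_zero]

/-- On nonnegative powers of the first variable both expansions agree. -/
theorem sub_in_eq_out (h : ∀ m < 0, ∀ t, F (m, t) = 0) : sub κin F = sub κout F := by
  funext g
  refine finsum_congr fun m => ?_
  by_cases hm : 0 ≤ m
  · rw [κin_eq_κout hm]
  · rw [h m (by omega), smul_zero, smul_zero]

end

/-! ### Multiplication by iterated Laurent series -/

/-- Multiplication of a family by a scalar-valued family. -/
def sf (c : ℤ × ℤ → ℂ) (F : ℤ × ℤ → V) : ℤ × ℤ → V :=
  fun g => ∑ᶠ s : ℤ × ℤ, c s • F (g - s)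

theorem smulFam_eq (c : ℤ → ℤ → ℂ) (F : ℤ → ℤ → V) (m t : ℤ) :
    smulFam c F m t = sf (fun g => c g.1 g.2) (fun g => F g.1 g.2) (m, t) := rfl

/-- The coefficients of an iterated Laurent series, indexed by pairs. -/
def kf (x : K2) : ℤ × ℤ → ℂ := fun g => k2Fun x g.1 g.2

theorem Nested2.fin {c : ℤ × ℤ → ℂ} (hc : Nested2 c) {F : ℤ × ℤ → V} (hF : Nested2 F)
    (g : ℤ × ℤ) : {s | c s ≠ 0 ∧ F (g - s) ≠ 0}.Finite := by
  obtain ⟨⟨N, hN⟩, hc2⟩ := hc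
  obtain ⟨⟨M, hM⟩, hF2⟩ := hF
  choose A hA using hc2
  choose B hB using hF2
  refine ((Set.finite_Icc N (g.1 - M)).biUnion
    (t := fun j => (fun t => (j, t)) '' Set.Icc (A j) (g.2 - B (g.1 - j))) (fun j _ =>
      (Set.finite_Icc _ _).image _)).subset ?_
  rintro ⟨j, t⟩ ⟨h1, h2⟩
  simp only [Set.mem_iUnion, Set.mem_image, Set.mem_Icc, exists_prop]
  refine ⟨j, ⟨?_, ?_⟩, t, ⟨?_, ?_⟩, rfl⟩
  · by_contra h; exact h1 (hN _ (not_le.mp h) _)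
  · by_contra h; exact h2 (hM _ (by simp; omega) _)
  · by_contra h; exact h1 (hA _ _ (not_le.mp h))
  · by_contra h; exact h2 (hB _ _ (by simp; omega))

theorem Nested2.fin_support {c : ℤ × ℤ → ℂ} (hc : Nested2 c) {F : ℤ × ℤ → V} (hF : Nested2 F)
    (g : ℤ × ℤ) : (Function.support fun s => c s • F (g - s)).Finite :=
  (hc.fin hF g).subset fun s hs => by
    rw [Function.mem_support] at hs
    exact ⟨left_ne_zero_of_smul hs, right_ne_zero_of_smul hs⟩

theorem sf_tr (c : ℤ × ℤ → ℂ) (F : ℤ × ℤ → V) (d g : ℤ × ℤ) :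
    sf (fun s => c (s - d)) F g = sf c F (g - d) := by
  simp only [sf]
  rw [← finsum_comp_equiv (Equiv.addRight d)]
  refine finsum_congr fun s => ?_
  simp only [Equiv.coe_addRight, add_sub_cancel_right]
  congr 2
  abel

theorem sf_add {c c' : ℤ × ℤ → ℂ} (hc : Nested2 c) (hc' : Nested2 c') {F : ℤ × ℤ → V}
    (hF : Nested2 F) : sf (c + c') F = sf c F + sf c' F := by
  funext g
  simp only [sf, Pi.add_apply, add_smul]
  exact finsum_add_distrib (hc.fin_support hF g) (hc'.fin_support hF g)

theorem sf_smul (r : ℂ) (c : ℤ × ℤ → ℂ) (F : ℤ × ℤ → V) : sf (r • c) F = r • sf c F := by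
  funext g
  simp only [sf, Pi.smul_apply, smul_finsum, smul_eq_mul, mul_smul]

theorem sf_sum {ι : Type*} (s : Finset ι) {c : ι → ℤ × ℤ → ℂ} (hc : ∀ i ∈ s, Nested2 (c i))
    {F : ℤ × ℤ → V} (hF : Nested2 F) : sf (∑ i ∈ s, c i) F = ∑ i ∈ s, sf (c i) F := by
  induction s using Finset.induction_on with
  | empty => funext g; simp [sf]
  | insert a s ha ih =>
    rw [Finset.sum_insert ha, Finset.sum_insert ha, sf_add (hc a (by simp))
      (Nested2.sum _ fun i hi => hc i (by simp [hi])) hF, ih fun i hi => hc i (by simp [hi])]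

theorem sf_act (f : AddMonoidAlgebra ℂ (ℤ × ℤ)) {c : ℤ × ℤ → ℂ} (hc : Nested2 c)
    {F : ℤ × ℤ → V} (hF : Nested2 F) : sf (act f c) F = act f (sf c F) := by
  rw [act_eq_sum, act_eq_sum, sf_sum _ (fun d _ => (hc.tr d).smul _) hF]
  refine Finset.sum_congr rfl fun d _ => ?_
  rw [sf_smul]
  congr 1
  funext g
  exact sf_tr _ _ _ _

theorem sf_nested {c : ℤ × ℤ → ℂ} (hc : Nested2 c) {F : ℤ × ℤ → V} (hF : Nested2 F) :
    Nested2 (sf c F) := by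
  obtain ⟨⟨N, hN⟩, hc2⟩ := hc
  obtain ⟨⟨M, hM⟩, hF2⟩ := hF
  choose A hA using hc2
  choose B hB using hF2
  refine ⟨⟨N + M, fun j hj t => ?_⟩, fun j => ?_⟩
  · refine finsum_eq_zero_of_forall_eq_zero fun s => ?_
    by_cases h : s.1 < N
    · rw [show s = (s.1, s.2) from rfl, hN _ h, zero_smul]
    · rw [show (j, t) - s = (j - s.1, t - s.2) from rfl, hM _ (by omega), smul_zero]
  · obtain ⟨C, hC⟩ := ((Set.finite_Icc N (j - M)).image fun i => A i + B (j - i)).bddBelow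
    refine ⟨C, fun t ht => finsum_eq_zero_of_forall_eq_zero fun s => ?_⟩
    rw [show (j, t) - s = (j - s.1, t - s.2) from rfl, show s = (s.1, s.2) from rfl]
    by_cases h1 : s.1 < N
    · rw [hN _ h1, zero_smul]
    by_cases h2 : j - s.1 < M
    · rw [hM _ h2, smul_zero]
    have := hC ⟨s.1, ⟨not_lt.mp h1, by omega⟩, rfl⟩
    dsimp only at this
    by_cases h3 : s.2 < A s.1
    · rw [hA _ _ h3, zero_smul]
    · rw [hB _ _ (by dsimp only; omega), smul_zero]

theorem hahn_bdd {R : Type*} [Zero R] (x : HahnSeries ℤ R) : ∃ N : ℤ, ∀ j < N, x.coeff j = 0 := by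
  by_cases h : x = 0
  · exact ⟨0, fun j _ => by simp [h]⟩
  · exact ⟨x.order, fun j hj => HahnSeries.coeff_eq_zero_of_lt_order hj⟩

theorem kf_nested (x : K2) : Nested2 (kf x) := by
  refine ⟨?_, fun j => ?_⟩
  · obtain ⟨N, hN⟩ := hahn_bdd x
    exact ⟨N, fun j hj t => by simp [kf, k2Fun, hN j hj]⟩
  · obtain ⟨N, hN⟩ := hahn_bdd (x.coeff j)
    exact ⟨N, fun t ht => by simp [kf, k2Fun, hN t ht]⟩

theorem kf_injective : Function.Injective kf := by
  intro x y h
  ext j t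
  exact congrFun h (j, t)

theorem kf_add (x y : K2) : kf (x + y) = kf x + kf y := by
  funext g; simp [kf, k2Fun]

theorem kf_xOuter_mul (x : K2) : kf (xOuter * x) = act (tr (1, 0)) (kf x) := by
  funext ⟨j, t⟩
  rw [act_tr]
  have := HahnSeries.coeff_single_mul_add (r := (1 : LC)) (x := x) (a := j - 1) (b := 1)
  rw [sub_add_cancel, one_mul] at this
  simp [kf, k2Fun, xOuter, this]

theorem kf_inner_mul (c : ℂ) (x : K2) : kf (xInnerC c * x) = c • act (tr (0, 1)) (kf x) := by
  funext ⟨j, t⟩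
  rw [Pi.smul_apply, act_tr]
  have := HahnSeries.coeff_single_mul_add (r := (HahnSeries.single 1 c : LC)) (x := x) (a := j)
    (b := 0)
  rw [add_zero] at this
  have h2 := HahnSeries.coeff_single_mul_add (r := c) (x := x.coeff j) (a := t - 1) (b := 1)
  rw [sub_add_cancel] at h2
  simp [kf, k2Fun, xInnerC, h2]

theorem xInner_eq : xInner = xInnerC 1 := rfl

theorem kf_xInner_mul (x : K2) : kf (xInner * x) = act (tr (0, 1)) (kf x) := by
  rw [xInner_eq, kf_inner_mul, one_smul]

theorem k2_add_mul (x y z : K2) : (x + y) * z = x * z + y * z :=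
  @Distrib.right_distrib K2
    (@NonUnitalNonAssocSemiring.toDistrib K2
      Semiring.toNonAssocSemiring.toNonUnitalNonAssocSemiring) x y z

theorem k2_mul_assoc (x y z : K2) : x * y * z = x * (y * z) := @Semigroup.mul_assoc K2 _ x y z

theorem k2_mul_comm (x y : K2) : x * y = y * x := @CommMagma.mul_comm K2 _ x y

theorem k2_one_mul (x : K2) : 1 * x = x := @MulOneClass.one_mul K2 _ x

theorem k2_mul_one (x : K2) : x * 1 = x := by rw [k2_mul_comm, k2_one_mul]

theorem k2_zero_mul (x : K2) : 0 * x = 0 := @MulZeroClass.zero_mul K2 _ x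

theorem k2_mul_inv {x : K2} (h : x ≠ 0) : x * x⁻¹ = 1 := @Field.mul_inv_cancel K2 _ x h

theorem k2_aeval_C {n : ℕ} (X : Fin n → K2) (c : ℂ) :
    MvPolynomial.aeval X (MvPolynomial.C c : MvPolynomial (Fin n) ℂ) =
      HahnSeries.C (HahnSeries.C c : LC) := by
  have h1 : algebraMap ℂ LC c = HahnSeries.C c := by
    rw [HahnSeries.algebraMap_apply']
    exact HahnSeries.ofPowerSeries_C c
  have h2 : algebraMap ℂ (PowerSeries LC) c = PowerSeries.C (algebraMap ℂ LC c) :=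
    PowerSeries.algebraMap_apply
  have h3 : HahnSeries.ofPowerSeries ℤ LC (PowerSeries.C (algebraMap ℂ LC c)) =
    HahnSeries.C (algebraMap ℂ LC c) := HahnSeries.ofPowerSeries_C  _
  rw [MvPolynomial.aeval_C, ← h1, ← h3, ← h2]
  rfl

theorem kf_aeval_C_mul {n : ℕ} (X : Fin n → K2) (c : ℂ) (x : K2) :
    kf (MvPolynomial.aeval X (MvPolynomial.C c : MvPolynomial (Fin n) ℂ) * x) = c • kf x := by
  rw [k2_aeval_C]
  funext ⟨j, t⟩
  have h1 := HahnSeries.coeff_single_mul_add (r := (HahnSeries.C c : LC)) (x := x) (a := j)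
    (b := 0)
  have h2 := HahnSeries.coeff_single_mul_add (r := c) (x := x.coeff j) (a := t) (b := 0)
  rw [add_zero] at h1 h2
  rw [Pi.smul_apply, smul_eq_mul]
  show ((HahnSeries.single 0 (HahnSeries.C c : LC) * x : K2).coeff j).coeff t = _
  rw [h1]
  exact h2

theorem kf_aeval_mul {n : ℕ} (X : Fin n → K2) (Y : Fin n → AddMonoidAlgebra ℂ (ℤ × ℤ))
    (h : ∀ i x, kf (X i * x) = act (Y i) (kf x)) (p : MvPolynomial (Fin n) ℂ) :
    ∀ x, kf (MvPolynomial.aeval X p * x) = act (MvPolynomial.aeval Y p) (kf x) := by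
  induction p using MvPolynomial.induction_on with
  | C a =>
    intro x
    rw [kf_aeval_C_mul, MvPolynomial.aeval_C, AlgHom.commutes, Module.algebraMap_end_apply]
  | add p q hp hq => intro x; rw [map_add, map_add, k2_add_mul, kf_add, hp, hq, act_add]
  | mul_X p i hp =>
    intro x
    rw [map_mul, map_mul, MvPolynomial.aeval_X, MvPolynomial.aeval_X, k2_mul_assoc, hp, h, act_mul]

theorem kf_qK_mul (p : MvPolynomial (Fin 2) ℂ) (x : K2) :
    kf (qK p 1 * x) = act (qe p) (kf x) :=
  kf_aeval_mul _ _ (by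
    intro i x
    fin_cases i
    · show kf ((xOuter + xInnerC 1) * x) = act (tr (1, 0) + tr (0, 1)) (kf x)
      rw [k2_add_mul, kf_add, kf_xOuter_mul, kf_inner_mul, one_smul, act_add]
    · exact kf_xInner_mul x) p x

theorem kf_one : kf 1 = fun g => if g = 0 then (1 : ℂ) else 0 := by
  funext ⟨j, t⟩
  simp only [kf, k2Fun, HahnSeries.coeff_one, Prod.mk_eq_zero]
  by_cases h : j = 0 <;> by_cases h' : t = 0 <;> simp [h, h']

theorem sf_one (F : ℤ × ℤ → V) : sf (kf 1) F = F := by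
  funext g
  rw [sf, kf_one, finsum_eq_single _ 0]
  · simp
  · intro s hs; simp [hs]

theorem kf_zero : kf 0 = 0 := by
  funext g; simp [kf, k2Fun]

theorem qK_ne_zero {p : MvPolynomial (Fin 2) ℂ} (hp : p ≠ 0) : qK p 1 ≠ 0 := by
  intro h
  have h1 := kf_qK_mul p 1
  rw [h, k2_zero_mul, kf_zero, kf_one] at h1
  obtain ⟨d, hd⟩ := exists_act_ne (qe_ne_zero hp)
  rw [coeff_eq_act] at hd
  replace h1 := congrFun h1 d
  rw [Pi.zero_apply] at h1
  exact hd (by convert h1.symm)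

/-! ### The vertex operation -/

/-- The family `a(x₁) b(x) w`, indexed by pairs. -/
def FabP (a b : EW W) (w : W) : ℤ × ℤ → W := fun g => Fab a b w g.1 g.2

theorem mf_add (a : EW W) (w w' : W) (n : ℤ) : mf a (w + w') n = mf a w n + mf a w' n := by
  simp [mf]

theorem mf_smul (a : EW W) (c : ℂ) (w : W) (n : ℤ) : mf a (c • w) n = c • mf a w n := by
  simp [mf]

/-- The mode `a_n` as a linear map. -/
def md (a : EW W) (n : ℤ) : W →ₗ[ℂ] W where
  toFun w := mf a w n
  map_add' _ _ := mf_add _ _ _ _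
  map_smul' _ _ := mf_smul _ _ _ _

theorem FabP_add (a b : EW W) (w w' : W) : FabP a b (w + w') = FabP a b w + FabP a b w' := by
  funext g; simp [FabP, Fab, mf_add]

theorem FabP_smul (a b : EW W) (c : ℂ) (w : W) : FabP a b (c • w) = c • FabP a b w := by
  funext g; simp [FabP, Fab, mf_smul]

theorem EW_ext {a b : EW W} (h : ∀ w n, mf a w n = mf b w n) : a = b :=
  Subtype.ext (LinearMap.ext fun w => funext fun n => h w n)

theorem mf_bdd (a : EW W) (w : W) : ∃ N : ℤ, ∀ t < N, mf a w (-t - 1) = 0 := by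
  obtain ⟨N, hN⟩ := a.2 w
  exact ⟨-N, fun t ht => hN _ (by omega)⟩

theorem qcPair_iff (a b : EW W) : QCPair a b ↔
    ∃ p : MvPolynomial (Fin 2) ℂ, p ≠ 0 ∧ ∀ w, Laurent (act (pe p) (FabP a b w)) := by
  refine exists_congr fun p => and_congr_right fun _ => forall_congr' fun w => ?_
  refine exists_congr fun N => forall₂_congr fun m t => ?_
  rw [mulPoly_eq]
  rfl

theorem fullYE_eq (p : MvPolynomial (Fin 2) ℂ) (a b : EW W) (w : W) (g : ℤ × ℤ) :
    fullYE 1 p a b w g.1 g.2 =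
      sf (kf (qInv p 1)) (sub κin (act (pe p) (FabP a b w))) g := by
  refine finsum_congr fun s => ?_
  congr 1
  simp only [sub, substYE, κin, Prod.fst_sub, Prod.snd_sub]
  by_cases h : 0 ≤ g.1 - s.1
  · simp only [if_pos h, one_zpow, mul_one, mulPoly_eq]
    refine finsum_congr fun m => ?_
    have e : g.2 - s.2 - m + ((g.1 - s.1).toNat : ℤ) = g.1 - s.1 + (g.2 - s.2) - m := by
      rw [Int.toNat_of_nonneg h]; ring
    rw [e]
    rfl
  · simp only [if_neg h, zero_smul, finsum_zero]

theorem fullYE_nested {p : MvPolynomial (Fin 2) ℂ} {a b : EW W} {w : W}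
    (hL : Laurent (act (pe p) (FabP a b w))) :
    Nested2 (fun g => fullYE 1 p a b w g.1 g.2) := by
  simp only [fullYE_eq]
  exact sf_nested (kf_nested _) hL.sub_nested

theorem act_fullYE {p : MvPolynomial (Fin 2) ℂ} (hp : p ≠ 0) {a b : EW W} {w : W}
    (hL : Laurent (act (pe p) (FabP a b w))) :
    act (qe p) (fun g => fullYE 1 p a b w g.1 g.2) = sub κin (act (pe p) (FabP a b w)) := by
  simp only [fullYE_eq]
  rw [show (fun g => sf (kf (qInv p 1)) (sub κin (act (pe p) (FabP a b w))) g) =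
    sf (kf (qInv p 1)) (sub κin (act (pe p) (FabP a b w))) from rfl,
    ← sf_act _ (kf_nested _) hL.sub_nested, ← kf_qK_mul, qInv, k2_mul_inv (qK_ne_zero hp),
    sf_one]

/-- `Y_ℰ(a(x), x₀) b(x) w` as a family indexed by pairs of exponents of `x₀` and `x`. -/
def Yfam (a b : EW W) (w : W) : ℤ × ℤ → W := fun g => mf (YE a b (-g.1 - 1)) w (-g.2 - 1)

theorem YE_eq {a b : EW W} (h : QCPair a b) (n : ℤ) (w : W) (m : ℤ) :
    mf (YE a b n) w m = fullYE 1 h.choose a b w (-n - 1) (-m - 1) := by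
  set p := h.choose with hp
  obtain ⟨hp0, hL⟩ := h.choose_spec
  replace hL : ∀ w, Laurent (act (pe p) (FabP a b w)) := fun w => by
    obtain ⟨N, hN⟩ := hL w
    exact ⟨N, fun m t hmt => by rw [← hN m t hmt, mulPoly_eq]; rfl⟩
  have hadd : ∀ w w', (fun g : ℤ × ℤ => fullYE 1 p a b (w + w') g.1 g.2) =
      (fun g => fullYE 1 p a b w g.1 g.2) + fun g => fullYE 1 p a b w' g.1 g.2 := fun w w' => by
    refine (fullYE_nested (hL _)).eq_of_act ((fullYE_nested (hL _)).add (fullYE_nested (hL _)))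
      (qe_ne_zero hp0) ?_
    rw [map_add, act_fullYE hp0 (hL _), act_fullYE hp0 (hL _), act_fullYE hp0 (hL _), FabP_add,
      map_add, sub_add (hL _).SD (hL _).SD]
  have hsmul : ∀ (c : ℂ) w, (fun g : ℤ × ℤ => fullYE 1 p a b (c • w) g.1 g.2) =
      c • (fun g : ℤ × ℤ => fullYE 1 p a b w g.1 g.2) := fun c w => by
    refine (fullYE_nested (hL _)).eq_of_act ((fullYE_nested (hL _)).smul c)
      (qe_ne_zero hp0) ?_
    rw [map_smul, act_fullYE hp0 (hL _), act_fullYE hp0 (hL _), FabP_smul, map_smul, sub_smul]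
  have hex : ∃ c : EW W, ∀ w m, mf c w m = rawYE ((1 : ℂˣ) : ℂ) a b n w m := by
    refine ⟨⟨{ toFun := fun w m => fullYE 1 p a b w (-n - 1) (-m - 1)
               map_add' := fun w w' => funext fun m => congrFun (hadd w w') (-n - 1, -m - 1)
               map_smul' := fun c w => funext fun m => congrFun (hsmul c w) (-n - 1, -m - 1) },
      fun w => ?_⟩, fun w m => ?_⟩
    · obtain ⟨N, hN⟩ := (fullYE_nested (hL w)).2 (-n - 1)
      exact ⟨-N, fun m hm => hN _ (by omega)⟩
    · rw [rawYE, dif_pos h, Units.val_one]; rfl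
  rw [YE, YEa, dif_pos hex, hex.choose_spec, rawYE, dif_pos h, Units.val_one]

theorem Yfam_spec {a b : EW W} (h : QCPair a b) : ∃ p : MvPolynomial (Fin 2) ℂ, p ≠ 0 ∧
    (∀ w, Laurent (act (pe p) (FabP a b w))) ∧
    (∀ w, act (qe p) (Yfam a b w) = sub κin (act (pe p) (FabP a b w))) ∧
    (∀ w, Nested2 (Yfam a b w)) ∧ ∃ K : ℤ, ∀ j < K, YE a b (-j - 1) = 0 := by
  have hY : ∀ w, Yfam a b w = fun g => fullYE 1 h.choose a b w g.1 g.2 := fun w => by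
    funext g
    rw [Yfam, YE_eq h]
    congr 1 <;> ring
  obtain ⟨hp0, hL⟩ := h.choose_spec
  replace hL : ∀ w, Laurent (act (pe h.choose) (FabP a b w)) := fun w => by
    obtain ⟨N, hN⟩ := hL w
    exact ⟨N, fun m t hmt => by rw [← hN m t hmt, mulPoly_eq]; rfl⟩
  refine ⟨h.choose, hp0, hL, fun w => ?_, fun w => ?_, ?_⟩
  · rw [hY]; exact act_fullYE hp0 (hL w)
  · rw [hY]; exact fullYE_nested (hL w)
  · obtain ⟨N, hN⟩ := (kf_nested (qInv h.choose 1)).1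
    refine ⟨N, fun j hj => EW_ext fun w m => ?_⟩
    rw [YE_eq h, show fullYE 1 h.choose a b w (-(-j - 1) - 1) (-m - 1) = _ from
      fullYE_eq h.choose a b w (-(-j - 1) - 1, -m - 1)]
    show _ = (0 : W)
    refine finsum_eq_zero_of_forall_eq_zero fun s => ?_
    by_cases h1 : s.1 < N
    · rw [show s = (s.1, s.2) from rfl, hN _ h1, zero_smul]
    · rw [sub, finsum_eq_zero_of_forall_eq_zero, smul_zero]
      intro m'
      rw [κin, if_neg (by simp; omega), zero_smul]

theorem qe_mul (p q : MvPolynomial (Fin 2) ℂ) : qe (p * q) = qe p * qe q := map_mul _ _ _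

theorem pe_mul (p q : MvPolynomial (Fin 2) ℂ) : pe (p * q) = pe p * pe q := map_mul _ _ _

theorem sub_sum {ι : Type*} (s : Finset ι) {κ : ℤ → ℤ → ℂ} {F : ι → ℤ × ℤ → V}
    (h : ∀ i ∈ s, SD κ (F i)) :
    SD κ (∑ i ∈ s, F i) ∧ sub κ (∑ i ∈ s, F i) = ∑ i ∈ s, sub κ (F i) := by
  induction s using Finset.induction_on with
  | empty =>
    refine ⟨fun a s => by simp, ?_⟩
    funext g; simp [sub]
  | insert a s ha ih =>
    obtain ⟨h1, h2⟩ := ih fun i hi => h i (by simp [hi])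
    rw [Finset.sum_insert ha, Finset.sum_insert ha, sub_add (h a (by simp)) h1, h2]
    exact ⟨(h a (by simp)).add h1, rfl⟩

/-- The operation `Y_ℰ` turns linear relations with polynomial coefficients, up to elements of
`V((x₁, x))`, into the substituted relations. -/
theorem Yfam_relation {ι : Type*} (s : Finset ι) {a b : ι → EW W} (hq : ∀ i ∈ s, QCPair (a i) (b i))
    (w : ι → W) (φ : ι → W →ₗ[ℂ] V) (r : ι → MvPolynomial (Fin 2) ℂ) {F : ℤ × ℤ → V}
    (hF : Laurent F)
    (h : ∑ i ∈ s, act (pe (r i)) (fun g => φ i (FabP (a i) (b i) (w i) g)) = F) :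
    ∑ i ∈ s, act (qe (r i)) (fun g => φ i (Yfam (a i) (b i) (w i) g)) = sub κin F := by
  have hsp : ∀ i : s, _ := fun i => Yfam_spec (hq i.1 i.2)
  choose p hp0 hL hY hN _ using hsp
  set P := ∏ i, p i with hP
  have hP0 : P ≠ 0 := Finset.prod_ne_zero_iff.mpr fun i _ => hp0 i
  have hdvd : ∀ i : s, ∃ q, P = p i * q := fun i => Finset.dvd_prod_of_mem p (Finset.mem_univ i)
  choose q hq' using hdvd
  rw [← Finset.sum_coe_sort] at h ⊢
  refine Nested2.eq_of_act (Nested2.sum _ fun i _ => ((hN i _).map _).act _) hF.sub_nested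
    (qe_ne_zero hP0) ?_
  have hS : ∀ i : s, SD κin (act (pe (r i * q i)) fun g =>
      φ i (act (pe (p i)) (FabP (a i) (b i) (w i)) g)) :=
    fun i => (sub_act κin_pascal _ ((hL i _).SD.map _)).1
  rw [map_sum, ← (sub_act κin_pascal P hF.SD).2, ← h, map_sum]
  have e : ∀ i : s, act (pe P) (act (pe (r i)) fun g => φ i (FabP (a i) (b i) (w i) g)) =
      act (pe (r i * q i)) fun g => φ i (act (pe (p i)) (FabP (a i) (b i) (w i)) g) := fun i => by
    rw [← act_map, ← act_mul, ← act_mul, ← pe_mul, ← pe_mul, hq' i,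
      show p i * q i * r i = r i * q i * p i by ring]
  simp only [e]
  rw [(sub_sum _ fun i _ => hS i).2]
  refine Finset.sum_congr rfl fun i _ => ?_
  rw [(sub_act κin_pascal _ ((hL i _).SD.map _)).2, sub_map _ (hL i _).SD, ← hY, ← act_map,
    ← act_mul, ← act_mul, ← qe_mul, ← qe_mul, hq' i,
    show p i * q i * r i = r i * q i * p i by ring]

/-! ### Bilinearity and the vacuum -/

theorem mf_YE (a b : EW W) (n : ℤ) (w : W) (m : ℤ) :
    mf (YE a b n) w m = Yfam a b w (-n - 1, -m - 1) := by
  rw [Yfam]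
  congr 2 <;> ring

theorem act_aeval_C (X : Fin 2 → AddMonoidAlgebra ℂ G) (c : ℂ) (F : G → V) :
    act (MvPolynomial.aeval X (MvPolynomial.C c : MvPolynomial (Fin 2) ℂ)) F = c • F := by
  rw [MvPolynomial.aeval_C, AlgHom.commutes, Module.algebraMap_end_apply]

theorem sub_zero_fam (κ : ℤ → ℤ → ℂ) : sub κ (0 : ℤ × ℤ → V) = 0 := by
  funext g
  exact finsum_eq_zero_of_forall_eq_zero fun m => smul_zero _

theorem Laurent.zero : Laurent (0 : ℤ × ℤ → V) := ⟨0, fun _ _ _ => rfl⟩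

theorem YE_linear {ι : Type*} (s : Finset ι) {a b : ι → EW W}
    (hq : ∀ i ∈ s, QCPair (a i) (b i)) (c : ι → ℂ)
    (h : ∀ w, ∑ i ∈ s, c i • FabP (a i) (b i) w = 0) (n : ℤ) (w : W) (m : ℤ) :
    ∑ i ∈ s, c i • mf (YE (a i) (b i) n) w m = 0 := by
  have h1 := Yfam_relation s hq (fun _ => w) (fun _ => LinearMap.id)
    (fun i => MvPolynomial.C (c i)) (F := 0) Laurent.zero (by
      simp only [act_aeval_C, LinearMap.id_apply]
      exact h w)
  simp only [act_aeval_C, LinearMap.id_apply, sub_zero_fam] at h1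
  have h2 := congrFun h1 (-n - 1, -m - 1)
  rw [Finset.sum_apply] at h2
  simp only [mf_YE]
  exact h2

theorem mf_add_left (a a' : EW W) (w : W) (n : ℤ) : mf (a + a') w n = mf a w n + mf a' w n := rfl

theorem mf_smul_left (c : ℂ) (a : EW W) (w : W) (n : ℤ) : mf (c • a) w n = c • mf a w n := rfl

theorem YE_add_left {a a' b : EW W} (h : QCPair (a + a') b) (h₁ : QCPair a b) (h₂ : QCPair a' b)
    (n : ℤ) : YE (a + a') b n = YE a b n + YE a' b n := by
  refine EW_ext fun w m => ?_
  have := YE_linear Finset.univ (a := ![a + a', a, a']) (b := ![b, b, b])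
    (by intro i _; fin_cases i <;> assumption) ![1, -1, -1] (by
      intro w; funext g
      simp [Fin.sum_univ_three, FabP, Fab, mf_add_left]) n w m
  simp only [Fin.sum_univ_three, Matrix.cons_val_zero, Matrix.cons_val_one, Matrix.cons_val,
    one_smul, neg_smul] at this
  rw [mf_add_left, ← sub_eq_zero, ← this]
  abel

theorem YE_add_right {a b b' : EW W} (h : QCPair a (b + b')) (h₁ : QCPair a b) (h₂ : QCPair a b')
    (n : ℤ) : YE a (b + b') n = YE a b n + YE a b' n := by
  refine EW_ext fun w m => ?_
  have := YE_linear Finset.univ (a := ![a, a, a]) (b := ![b + b', b, b'])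
    (by intro i _; fin_cases i <;> assumption) ![1, -1, -1] (by
      intro w; funext g
      simp [Fin.sum_univ_three, FabP, Fab, mf_add_left, mf_add]) n w m
  simp only [Fin.sum_univ_three, Matrix.cons_val_zero, Matrix.cons_val_one, Matrix.cons_val,
    one_smul, neg_smul] at this
  rw [mf_add_left, ← sub_eq_zero, ← this]
  abel

theorem YE_smul_left (c : ℂ) {a b : EW W} (h : QCPair (c • a) b) (h₁ : QCPair a b)
    (n : ℤ) : YE (c • a) b n = c • YE a b n := by
  refine EW_ext fun w m => ?_
  have := YE_linear Finset.univ (a := ![c • a, a]) (b := ![b, b])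
    (by intro i _; fin_cases i <;> assumption) ![1, -c] (by
      intro w; funext g
      simp [Fin.sum_univ_two, FabP, Fab, mf_smul_left]) n w m
  simp only [Fin.sum_univ_two, Matrix.cons_val_zero, Matrix.cons_val_one,
    one_smul, neg_smul] at this
  rw [mf_smul_left, ← sub_eq_zero, ← this]
  abel

theorem YE_smul_right (c : ℂ) {a b : EW W} (h : QCPair a (c • b)) (h₁ : QCPair a b)
    (n : ℤ) : YE a (c • b) n = c • YE a b n := by
  refine EW_ext fun w m => ?_
  have := YE_linear Finset.univ (a := ![a, a]) (b := ![c • b, b])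
    (by intro i _; fin_cases i <;> assumption) ![1, -c] (by
      intro w; funext g
      simp [Fin.sum_univ_two, FabP, Fab, mf_smul_left, mf_smul]) n w m
  simp only [Fin.sum_univ_two, Matrix.cons_val_zero, Matrix.cons_val_one,
    one_smul, neg_smul] at this
  rw [mf_smul_left, ← sub_eq_zero, ← this]
  abel

theorem Yfam_eq_sub {a b : EW W} (hq : QCPair a b) (w : W) (h : Laurent (FabP a b w)) :
    Yfam a b w = sub κin (FabP a b w) := by
  have := Yfam_relation {()} (a := fun _ => a) (b := fun _ => b) (fun _ _ => hq) (fun _ => w)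
    (fun _ => LinearMap.id) (fun _ => MvPolynomial.C 1) h (by simp only [act_aeval_C]; simp)
  simp only [act_aeval_C] at this
  simpa using this

theorem mf_oneE (w : W) (n : ℤ) : mf oneE w n = if n = -1 then w else 0 := rfl

theorem FabP_one_left (b : EW W) (w : W) (m t : ℤ) :
    FabP oneE b w (m, t) = if m = 0 then mf b w (-t - 1) else 0 := by
  simp only [FabP, Fab, mf_oneE]
  congr 1
  exact propext ⟨fun h => by omega, fun h => by omega⟩

theorem FabP_one_right (b : EW W) (w : W) (m t : ℤ) :
    FabP b oneE w (m, t) = if t = 0 then mf b w (-m - 1) else 0 := by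
  simp only [FabP, Fab, mf_oneE]
  by_cases h : t = 0
  · rw [if_pos h, if_pos (by omega)]
  · rw [if_neg h, if_neg (by omega)]
    exact map_zero (md b _)

theorem laurent_one_left (b : EW W) (w : W) : Laurent (FabP oneE b w) := by
  obtain ⟨N, hN⟩ := mf_bdd b w
  refine ⟨min N 0, fun m t h => ?_⟩
  rw [FabP_one_left]
  split_ifs with h1
  · exact hN _ (by omega)
  · rfl

theorem laurent_one_right (b : EW W) (w : W) : Laurent (FabP b oneE w) := by
  obtain ⟨N, hN⟩ := mf_bdd b w
  refine ⟨min N 0, fun m t h => ?_⟩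
  rw [FabP_one_right]
  split_ifs with h1
  · exact hN _ (by omega)
  · rfl

theorem Laurent.qcPair {a b : EW W} (h : ∀ w, Laurent (FabP a b w)) : QCPair a b := by
  rw [qcPair_iff]
  refine ⟨1, one_ne_zero, fun w => ?_⟩
  rw [pe, map_one, act_one]
  exact h w

theorem YE_one_left (b : EW W) (n : ℤ) : YE oneE b n = if n = -1 then b else 0 := by
  refine EW_ext fun w m => ?_
  rw [mf_YE, Yfam_eq_sub (Laurent.qcPair (laurent_one_left b)) w (laurent_one_left b w), sub,
    finsum_eq_single _ 0]
  · simp only [FabP_one_left, κin, if_true]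
    split_ifs with h1 h2 h2
    · subst h2
      simp only [neg_neg, sub_self, Int.toNat_zero, binom_zero, one_smul]
      congr 1; ring
    · obtain ⟨k, hk⟩ : ∃ k : ℕ, (-n - 1).toNat = k + 1 := ⟨(-n - 2).toNat, by omega⟩
      rw [hk, show (0 : ℤ) = (0 : ℕ) from rfl, binom_nat]
      simp only [Nat.choose_zero_succ, Nat.cast_zero, zero_smul]
      rfl
    · omega
    · rw [zero_smul]; rfl
  · intro m' hm'
    rw [FabP_one_left, if_neg hm', smul_zero]

theorem YE_one_right (b : EW W) (n : ℤ) (hn : -1 ≤ n) :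
    YE b oneE n = if n = -1 then b else 0 := by
  refine EW_ext fun w m => ?_
  rw [mf_YE, Yfam_eq_sub (Laurent.qcPair (laurent_one_right b)) w (laurent_one_right b w), sub]
  by_cases h : n = -1
  · subst h
    rw [finsum_eq_single _ (-m - 1)]
    · simp only [FabP_one_right, κin]
      simp
      rw [binom_zero, one_smul]
    · intro m' hm'
      dsimp only
      rw [FabP_one_right, if_neg (by omega), smul_zero]
  · rw [if_neg h]
    refine finsum_eq_zero_of_forall_eq_zero fun m' => ?_
    rw [κin, if_neg (by simp; omega), zero_smul]

/-! ### Weak quasi associativity on the module -/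

theorem sub_out_eq_prodCE (a b : EW W) (w : W) (i j : ℤ) :
    sub κout (FabP a b w) (i, j) = prodCE mf mf a b w i j := by
  refine finsum_congr fun m => ?_
  simp only [κout, FabP, Fab, ite_smul, zero_smul]
  rw [show -(i + j - m) - 1 = -(j - (m - i)) - 1 by ring]

theorem SD_out_FabP (a b : EW W) (w : W) : SD κout (FabP a b w) := fun i s => by
  obtain ⟨N, hN⟩ := mf_bdd b w
  refine (Set.finite_Icc i (s - N)).subset fun m ⟨h1, h2⟩ => ?_
  refine ⟨?_, ?_⟩
  · by_contra h; exact h1 (if_neg h)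
  · by_contra h
    refine h2 ?_
    simp only [FabP, Fab]
    rw [hN _ (by omega)]
    exact map_zero (md a _)

theorem act_pe_X0_pow (k : ℕ) (F : ℤ × ℤ → V) (g : ℤ × ℤ) :
    act (pe (MvPolynomial.X 0 ^ k)) F g = F (g.1 - k, g.2) := by
  rw [pe, map_pow, MvPolynomial.aeval_X]
  simp only [Matrix.cons_val_zero]
  rw [tr_pow, act_tr]
  congr 1
  ext <;> simp

theorem quasi_assoc {a b : EW W} (hq : QCPair a b) (w : W) :
    ∃ f : MvPolynomial (Fin 2) ℂ, f ≠ 0 ∧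
      act (qe f) (sub κout (FabP a b w)) = act (qe f) (Yfam a b w) := by
  obtain ⟨p, hp0, hL, hY, -, -⟩ := Yfam_spec hq
  obtain ⟨N, hN⟩ := hL w
  refine ⟨MvPolynomial.X 0 ^ (-N).toNat * p,
    mul_ne_zero (pow_ne_zero _ (MvPolynomial.X_ne_zero _)) hp0, ?_⟩
  have h1 : SD κin (act (pe p) (FabP a b w)) := (hL w).SD
  rw [qe_mul, act_mul _ _ (Yfam a b w), hY, ← (sub_act κin_pascal _ h1).2, ← qe_mul,
    ← (sub_act κout_pascal _ (SD_out_FabP a b w)).2, pe_mul, act_mul]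
  refine (sub_in_eq_out fun m hm t => ?_).symm
  rw [act_pe_X0_pow]
  exact hN _ _ (by left; simp only; omega)

/-! ### Families in several variables, viewed as two-variable families with a spectator -/

/-- Exponents in a pair of variables, as exponents in all the variables. -/
def up (σ : (ℤ × ℤ) × ℤ ≃+ G) : AddMonoidAlgebra ℂ (ℤ × ℤ) →ₐ[ℂ] AddMonoidAlgebra ℂ G :=
  AddMonoidAlgebra.mapDomainAlgHom ℂ ℂ (σ.toAddMonoidHom.comp (AddMonoidHom.inl (ℤ × ℤ) ℤ))

/-- The two-variable family obtained by fixing the exponent of the spectator variable. -/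
def slice (σ : (ℤ × ℤ) × ℤ ≃+ G) (F : G → V) (s : ℤ) : ℤ × ℤ → V := fun g => F (σ (g, s))

theorem up_tr (σ : (ℤ × ℤ) × ℤ ≃+ G) (g : ℤ × ℤ) : up σ (tr g) = tr (σ (g, 0)) := by
  simp only [up, AddMonoidAlgebra.mapDomainAlgHom_apply, AddMonoidAlgebra.mapDomain_single]
  rfl

theorem up_single (σ : (ℤ × ℤ) × ℤ ≃+ G) (g : ℤ × ℤ) (c : ℂ) :
    up σ (AddMonoidAlgebra.single g c) = AddMonoidAlgebra.single (σ (g, 0)) c := by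
  simp only [up, AddMonoidAlgebra.mapDomainAlgHom_apply, AddMonoidAlgebra.mapDomain_single]
  rfl

theorem slice_act_up (σ : (ℤ × ℤ) × ℤ ≃+ G) (f : AddMonoidAlgebra ℂ (ℤ × ℤ)) (F : G → V)
    (s : ℤ) : slice σ (act (up σ f) F) s = act f (slice σ F s) := by
  induction f using AddMonoidAlgebra.induction_on with
  | of g =>
    funext h
    show act (up σ (tr g)) F (σ (h, s)) = act (tr g) (slice σ F s) h
    rw [up_tr, act_tr, act_tr, ← map_sub]
    simp [slice]
  | add f g hf hg =>
    rw [map_add, act_add, act_add, ← hf, ← hg]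
    rfl
  | smul c f hf =>
    rw [map_smul, map_smul, map_smul, LinearMap.smul_apply, LinearMap.smul_apply, ← hf]
    rfl

theorem slice_act_tr (σ : (ℤ × ℤ) × ℤ ≃+ G) (F : G → V) (n s : ℤ) :
    slice σ (act (tr (σ (0, n))) F) s = slice σ F (s - n) := by
  funext h
  show act (tr (σ (0, n))) F (σ (h, s)) = _
  rw [act_tr, ← map_sub]
  simp [slice]

theorem slice_act_aeval (σ : (ℤ × ℤ) × ℤ ≃+ G) (X Y : AddMonoidAlgebra ℂ (ℤ × ℤ))
    (Q : MvPolynomial (Fin 3) ℂ) (F : G → V) (s : ℤ) :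
    slice σ (act (MvPolynomial.aeval ![up σ X, up σ Y, tr (σ (0, 1))] Q) F) s =
      ∑ d ∈ Q.support, act (MvPolynomial.aeval ![X, Y]
        (MvPolynomial.C (MvPolynomial.coeff d Q) * MvPolynomial.X 0 ^ d 0 *
          MvPolynomial.X 1 ^ d 1 : MvPolynomial (Fin 2) ℂ)) (slice σ F (s - d 2)) := by
  rw [MvPolynomial.aeval_def, MvPolynomial.eval₂_eq', map_sum, LinearMap.sum_apply]
  have : ∀ F' : (Fin 3 →₀ ℕ) → G → V, slice σ (∑ d ∈ Q.support, F' d) s =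
      ∑ d ∈ Q.support, slice σ (F' d) s := fun F' => by
    funext g; simp [slice]
  rw [this]
  refine Finset.sum_congr rfl fun d _ => ?_
  rw [Fin.prod_univ_three]
  simp only [Matrix.cons_val_zero, Matrix.cons_val_one, Matrix.cons_val, map_mul, map_pow,
    MvPolynomial.aeval_X, MvPolynomial.aeval_C]
  simp only [Module.End.mul_apply, ← map_pow, AlgHom.commutes, Module.algebraMap_end_apply]
  rw [show ∀ (c : ℂ) (F' : G → V), slice σ (c • F') s = c • slice σ F' s from fun _ _ => rfl,
    slice_act_up, slice_act_up, tr_pow, ← map_nsmul, show d 2 • ((0 : ℤ × ℤ), (1 : ℤ)) =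
      (0, (d 2 : ℤ)) by simp, slice_act_tr]

theorem slice_ext (σ : (ℤ × ℤ) × ℤ ≃+ G) {F F' : G → V} (h : ∀ s, slice σ F s = slice σ F' s) :
    F = F' := by
  funext g
  have := congrFun (h (σ.symm g).2) (σ.symm g).1
  simpa [slice] using this

/-- Substitution in a pair of variables. -/
def subσ (σ : (ℤ × ℤ) × ℤ ≃+ G) (κ : ℤ → ℤ → ℂ) (F : G → V) : G → V :=
  fun g => sub κ (slice σ F (σ.symm g).2) (σ.symm g).1

theorem slice_subσ (σ : (ℤ × ℤ) × ℤ ≃+ G) (κ : ℤ → ℤ → ℂ) (F : G → V) (s : ℤ) :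
    slice σ (subσ σ κ F) s = sub κ (slice σ F s) := by
  funext g
  simp [slice, subσ]

theorem subσ_act (σ : (ℤ × ℤ) × ℤ ≃+ G) {κ : ℤ → ℤ → ℂ} (hκ : IsPascal κ)
    (Q : MvPolynomial (Fin 3) ℂ) {F : G → V} (h : ∀ s, SD κ (slice σ F s)) :
    subσ σ κ (act (MvPolynomial.aeval
      ![tr (σ ((1, 0), 0)), tr (σ ((0, 1), 0)), tr (σ (0, 1))] Q) F) =
    act (MvPolynomial.aeval ![tr (σ ((1, 0), 0)) + tr (σ ((0, 1), 0)), tr (σ ((0, 1), 0)),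
      tr (σ (0, 1))] Q) (subσ σ κ F) := by
  refine slice_ext σ fun s => ?_
  simp only [← up_tr, ← map_add]
  rw [slice_subσ, slice_act_aeval, slice_act_aeval, (sub_sum _ fun d _ =>
    (sub_act hκ _ (h _)).1).2]
  refine Finset.sum_congr rfl fun d _ => ?_
  rw [(sub_act hκ _ (h _)).2, slice_subσ]

theorem Yfam_relation_slice (σ : (ℤ × ℤ) × ℤ ≃+ G) {a b : ℤ → EW W} (hq : ∀ s, QCPair (a s) (b s))
    (w : ℤ → W) (φ : ℤ → W →ₗ[ℂ] V) {E Y F : G → V}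
    (hE : ∀ s, slice σ E s = fun g => φ s (FabP (a s) (b s) (w s) g))
    (hY : ∀ s, slice σ Y s = fun g => φ s (Yfam (a s) (b s) (w s) g))
    (Q : MvPolynomial (Fin 3) ℂ) (hF : ∀ s, Laurent (slice σ F s))
    (h : act (MvPolynomial.aeval
      ![tr (σ ((1, 0), 0)), tr (σ ((0, 1), 0)), tr (σ (0, 1))] Q) E = F) :
    act (MvPolynomial.aeval ![tr (σ ((1, 0), 0)) + tr (σ ((0, 1), 0)), tr (σ ((0, 1), 0)),
      tr (σ (0, 1))] Q) Y = subσ σ κin F := by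
  refine slice_ext σ fun s => ?_
  rw [slice_subσ]
  simp only [← up_tr, ← map_add] at h ⊢
  rw [slice_act_aeval]
  simp only [hY]
  refine Yfam_relation (V := V) Q.support (a := fun d => a (s - d 2)) (b := fun d => b (s - d 2))
    (fun d _ => hq _) (fun d => w (s - d 2)) (fun d => φ (s - d 2)) _ (hF s) ?_
  rw [← h, slice_act_aeval]
  simp only [hE]

/-! ### Three variables -/

/-- The first and the second of three variables. -/
def σ12 : (ℤ × ℤ) × ℤ ≃+ ℤ × ℤ × ℤ where
  toFun g := (g.1.1, g.1.2, g.2)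
  invFun g := ((g.1, g.2.1), g.2.2)
  left_inv _ := rfl
  right_inv _ := rfl
  map_add' _ _ := rfl

/-- The first and the third of three variables. -/
def σ13 : (ℤ × ℤ) × ℤ ≃+ ℤ × ℤ × ℤ where
  toFun g := (g.1.1, g.2, g.1.2)
  invFun g := ((g.1, g.2.2), g.2.1)
  left_inv _ := rfl
  right_inv _ := rfl
  map_add' _ _ := rfl

/-- The second and the third of three variables. -/
def σ23 : (ℤ × ℤ) × ℤ ≃+ ℤ × ℤ × ℤ where
  toFun g := (g.2, g.1.1, g.1.2)
  invFun g := ((g.2.1, g.2.2), g.1)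
  left_inv _ := rfl
  right_inv _ := rfl
  map_add' _ _ := rfl

/-- The first of three variables, as an element of the group algebra. -/
abbrev tX : AddMonoidAlgebra ℂ (ℤ × ℤ × ℤ) := tr (1, 0, 0)
/-- The second variable, as an element of the group algebra. -/
abbrev tY : AddMonoidAlgebra ℂ (ℤ × ℤ × ℤ) := tr (0, 1, 0)
/-- The third variable, as an element of the group algebra. -/
abbrev tZ : AddMonoidAlgebra ℂ (ℤ × ℤ × ℤ) := tr (0, 0, 1)

theorem aeval_vec3 {A B : Type*} [CommRing A] [Algebra ℂ A] [CommRing B] [Algebra ℂ B]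
    (φ : A →ₐ[ℂ] B) (a b c : A) (P : MvPolynomial (Fin 3) ℂ) :
    φ (MvPolynomial.aeval ![a, b, c] P) = MvPolynomial.aeval ![φ a, φ b, φ c] P := by
  rw [← AlgHom.comp_apply]
  congr 1
  apply MvPolynomial.algHom_ext
  intro i; fin_cases i <;> simp

theorem aeval_vec2 {A B : Type*} [CommRing A] [Algebra ℂ A] [CommRing B] [Algebra ℂ B]
    (φ : A →ₐ[ℂ] B) (a b : A) (P : MvPolynomial (Fin 2) ℂ) :
    φ (MvPolynomial.aeval ![a, b] P) = MvPolynomial.aeval ![φ a, φ b] P := by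
  rw [← AlgHom.comp_apply]
  congr 1
  apply MvPolynomial.algHom_ext
  intro i; fin_cases i <;> simp

/-- The family `u(x₁) v(x₂) c(x₃) w`. -/
def Fam3 (u v c : EW W) (w : W) : ℤ × ℤ × ℤ → W :=
  fun g => mf u (mf v (mf c w (-g.2.2 - 1)) (-g.2.1 - 1)) (-g.1 - 1)

/-- A family in `V((x₁, x₂, x₃))`. -/
def Laurent3 (F : ℤ × ℤ × ℤ → V) : Prop :=
  ∃ N : ℤ, ∀ i j k : ℤ, i < N ∨ j < N ∨ k < N → F (i, j, k) = 0

theorem subσ23_apply (κ : ℤ → ℤ → ℂ) (F : ℤ × ℤ × ℤ → V) (i j k : ℤ) :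
    subσ σ23 κ F (i, j, k) = ∑ᶠ m, κ m j • F (i, m, j + k - m) := rfl

theorem subσ13_apply (κ : ℤ → ℤ → ℂ) (F : ℤ × ℤ × ℤ → V) (i j k : ℤ) :
    subσ σ13 κ F (i, j, k) = ∑ᶠ m, κ m i • F (m, j, i + k - m) := rfl

theorem subσ12_apply (κ : ℤ → ℤ → ℂ) (F : ℤ × ℤ × ℤ → V) (i j k : ℤ) :
    subσ σ12 κ F (i, j, k) = ∑ᶠ m, κ m i • F (m, i + j - m, k) := rfl

theorem act_Yfam_left {u v c : EW W} (w : W) (h1 : QCPair v c)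
    (h2 : ∀ n, QCPair u (YE v c n)) (P : MvPolynomial (Fin 3) ℂ) {F : ℤ × ℤ × ℤ → W}
    (hF : Laurent3 F) (h : act (MvPolynomial.aeval ![tX, tY, tZ] P) (Fam3 u v c w) = F) :
    act (MvPolynomial.aeval ![tX + tZ, tY + tZ, tZ] P)
      (fun g => Yfam u (YE v c (-g.2.1 - 1)) w (g.1, g.2.2)) =
      subσ σ13 κin (subσ σ23 κin F) := by
  obtain ⟨N, hN⟩ := hF
  have hF1 : ∀ s, Laurent (slice σ23 F s) := fun s => ⟨N, fun m t h => hN _ _ _ (Or.inr h)⟩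
  have e1 := Yfam_relation_slice σ23 (a := fun _ => v) (b := fun _ => c) (fun _ => h1)
    (fun _ => w) (fun s => md u (-s - 1)) (E := Fam3 u v c w)
    (Y := fun g => mf u (mf (YE v c (-g.2.1 - 1)) w (-g.2.2 - 1)) (-g.1 - 1)) (F := F)
    (fun _ => rfl) (fun _ => rfl)
    (MvPolynomial.aeval ![MvPolynomial.X 2, MvPolynomial.X 0, MvPolynomial.X 1] P) hF1 (by
      rw [← h, aeval_vec3]
      simp; rfl)
  rw [aeval_vec3] at e1
  have hF2 : ∀ s, Laurent (slice σ13 (subσ σ23 κin F) s) := fun s => by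
    refine ⟨min N (2 * N - s), fun m t h => ?_⟩
    show subσ σ23 κin F (m, s, t) = 0
    rw [subσ23_apply]
    refine finsum_eq_zero_of_forall_eq_zero fun n => ?_
    rw [hN _ _ _ (by omega), smul_zero]
  have e2 := Yfam_relation_slice σ13 (a := fun _ => u) (b := fun s => YE v c (-s - 1))
    (fun _ => h2 _) (fun _ => w) (fun _ => LinearMap.id)
    (E := fun g => mf u (mf (YE v c (-g.2.1 - 1)) w (-g.2.2 - 1)) (-g.1 - 1))
    (Y := fun g => Yfam u (YE v c (-g.2.1 - 1)) w (g.1, g.2.2)) (F := subσ σ23 κin F)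
    (fun _ => rfl) (fun _ => rfl)
    (MvPolynomial.aeval ![MvPolynomial.X 0, MvPolynomial.X 2 + MvPolynomial.X 1,
      MvPolynomial.X 1] P) hF2 (by
      rw [← e1, aeval_vec3]
      simp; rfl)
  rw [aeval_vec3] at e2
  rw [← e2]
  simp; rfl

theorem act_Yfam_right {u v c : EW W} (w : W) (h1 : QCPair u v)
    (h2 : ∀ n, QCPair (YE u v n) c) (P : MvPolynomial (Fin 3) ℂ) {F : ℤ × ℤ × ℤ → W}
    (hF : Laurent3 F) (h : act (MvPolynomial.aeval ![tX, tY, tZ] P) (Fam3 u v c w) = F) :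
    act (MvPolynomial.aeval ![tX + (tY + tZ), tY + tZ, tZ] P)
      (fun g => Yfam (YE u v (-g.1 - 1)) c w g.2) =
      subσ σ23 κin (subσ σ12 κin F) := by
  obtain ⟨N, hN⟩ := hF
  have hF1 : ∀ s, Laurent (slice σ12 F s) := fun s =>
    ⟨N, fun m t h => hN _ _ _ (h.imp_right Or.inl)⟩
  have e1 := Yfam_relation_slice σ12 (a := fun _ => u) (b := fun _ => v) (fun _ => h1)
    (fun s => mf c w (-s - 1)) (fun _ => LinearMap.id) (E := Fam3 u v c w)
    (Y := fun g => mf (YE u v (-g.1 - 1)) (mf c w (-g.2.2 - 1)) (-g.2.1 - 1)) (F := F)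
    (fun _ => rfl) (fun _ => rfl) P hF1 h
  have hF2 : ∀ s, Laurent (slice σ23 (subσ σ12 κin F) s) := fun s => by
    refine ⟨min N (2 * N - s), fun m t h => ?_⟩
    show subσ σ12 κin F (s, m, t) = 0
    rw [subσ12_apply]
    refine finsum_eq_zero_of_forall_eq_zero fun n => ?_
    rw [hN _ _ _ (by omega), smul_zero]
  have e2 := Yfam_relation_slice σ23 (a := fun s => YE u v (-s - 1)) (b := fun _ => c)
    (fun _ => h2 _) (fun _ => w) (fun _ => LinearMap.id)
    (E := fun g => mf (YE u v (-g.1 - 1)) (mf c w (-g.2.2 - 1)) (-g.2.1 - 1))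
    (Y := fun g => Yfam (YE u v (-g.1 - 1)) c w g.2) (F := subσ σ12 κin F)
    (fun _ => rfl) (fun _ => rfl)
    (MvPolynomial.aeval ![MvPolynomial.X 2 + MvPolynomial.X 0, MvPolynomial.X 0,
      MvPolynomial.X 1] P) hF2 (by
      rw [← e1, aeval_vec3]
      simp; rfl)
  rw [aeval_vec3] at e2
  rw [← e2]
  simp; rfl

theorem κin_neg {m a : ℤ} (h : a < 0) : κin m a = 0 := if_neg (by omega)

theorem κin_nat (m : ℤ) (a : ℕ) : κin m a = binom m a := by simp [κin]

theorem sum_κin (m n i j : ℤ) :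
    ∑ M ∈ Finset.Icc 0 (i + j), κin M i * κin m M * κin n (i + j - M) =
      κin m i * κin (n + m - i) j := by
  rcases lt_or_ge i 0 with hi | hi
  · rw [κin_neg hi, zero_mul]
    exact Finset.sum_eq_zero fun M _ => by rw [κin_neg hi]; ring
  lift i to ℕ using hi
  rcases lt_or_ge j 0 with hj | hj
  · rw [κin_neg hj, mul_zero]
    refine Finset.sum_eq_zero fun M hM => ?_
    rw [Finset.mem_Icc] at hM
    lift M to ℕ using hM.1
    rw [κin_nat, binom_nat, Nat.choose_eq_zero_of_lt (by omega)]
    simp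
  lift j to ℕ using hj
  rw [κin_nat, κin_nat, show n + m - i = (m - i) + n by ring, binom_add, Finset.mul_sum]
  symm
  refine Finset.sum_bij_ne_zero (fun q _ _ => ((i + q.1 : ℕ) : ℤ)) ?_ ?_ ?_ ?_
  · intro q hq _
    rw [Finset.HasAntidiagonal.mem_antidiagonal] at hq
    rw [Finset.mem_Icc]
    omega
  · intro q hq _ q' hq' _ h
    rw [Finset.HasAntidiagonal.mem_antidiagonal] at hq hq'
    ext <;> omega
  · intro M hM hne
    rw [Finset.mem_Icc] at hM
    obtain ⟨M, rfl⟩ : ∃ n : ℕ, M = n := ⟨M.toNat, by omega⟩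
    have h1 : i ≤ M := by
      by_contra h
      apply hne
      rw [κin_nat, binom_nat, Nat.choose_eq_zero_of_lt (by omega)]
      simp
    have h2 : ((i : ℤ) + j - M) = ((i + j - M : ℕ) : ℤ) := by omega
    refine ⟨(M - i, i + j - M), by rw [Finset.HasAntidiagonal.mem_antidiagonal]; omega, ?_, by simp; omega⟩
    intro h
    apply hne
    rw [κin_nat, κin_nat, h2, κin_nat, binom_nat, mul_comm ((M.choose i : ℕ) : ℂ),
      show M = i + (M - i) by omega, binom_mul_choose, mul_assoc]
    rw [show i + (M - i) = M by omega]
    exact h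
  · intro q hq _
    rw [Finset.HasAntidiagonal.mem_antidiagonal] at hq
    have h2 : ((i : ℤ) + j - (i + q.1 : ℕ)) = (q.2 : ℤ) := by omega
    rw [κin_nat, κin_nat, h2, κin_nat, binom_nat, mul_comm (((i + q.1).choose i : ℕ) : ℂ),
      binom_mul_choose, mul_assoc]

theorem finsum_eq_sum_of_forall {ι M : Type*} [AddCommMonoid M] {f : ι → M} (s : Finset ι)
    (h : ∀ i, i ∉ s → f i = 0) : ∑ᶠ i, f i = ∑ i ∈ s, f i :=
  finsum_eq_sum_of_support_subset f fun i hi => by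
    by_contra h'
    exact hi (h i h')

theorem sub_sub {F : ℤ × ℤ × ℤ → V} (hF : Laurent3 F) :
    subσ σ12 κin (subσ σ13 κin (subσ σ23 κin F)) = subσ σ23 κin (subσ σ12 κin F) := by
  obtain ⟨N, hN⟩ := hF
  funext ⟨i, j, k⟩
  set A := Finset.Icc N (i + j + k - 2 * N) with hA
  have hz : ∀ m n l, m + n + l = i + j + k → (m ∉ A ∨ n ∉ A) → F (m, n, l) = 0 := by
    intro m n l h1 h2
    rw [hA, Finset.mem_Icc, Finset.mem_Icc] at h2
    exact hN _ _ _ (by omega)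
  have e1 : ∀ M m, subσ σ23 κin F (m, i + j - M, M + k - m) =
      ∑ n ∈ A, κin n (i + j - M) • F (m, n, i + j + k - m - n) := fun M m => by
    rw [subσ23_apply, finsum_eq_sum_of_forall A fun n hn => by
      rw [hz _ _ _ (by ring) (Or.inr hn), smul_zero]]
    refine Finset.sum_congr rfl fun n _ => ?_
    rw [show i + j - M + (M + k - m) - n = i + j + k - m - n by ring]
  have e2 : ∀ M, subσ σ13 κin (subσ σ23 κin F) (M, i + j - M, k) =
      ∑ m ∈ A, κin m M • ∑ n ∈ A, κin n (i + j - M) • F (m, n, i + j + k - m - n) := fun M => by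
    rw [subσ13_apply, finsum_eq_sum_of_forall A fun m hm => by
      rw [e1, Finset.sum_eq_zero fun n _ => by
        rw [hz _ _ _ (by ring) (Or.inl hm), smul_zero], smul_zero]]
    simp only [e1]
  have e3 : subσ σ12 κin (subσ σ13 κin (subσ σ23 κin F)) (i, j, k) =
      ∑ M ∈ Finset.Icc 0 (i + j), κin M i • ∑ m ∈ A, κin m M •
        ∑ n ∈ A, κin n (i + j - M) • F (m, n, i + j + k - m - n) := by
    rw [subσ12_apply, finsum_eq_sum_of_forall (Finset.Icc 0 (i + j))]
    · simp only [e2]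
    intro M hM
    rw [Finset.mem_Icc, not_and_or, not_le, not_le] at hM
    rw [e2]
    rcases hM with hM | hM
    · simp [κin_neg hM]
    · simp [κin_neg (show i + j - M < 0 by omega)]
  have e4 : ∀ n, subσ σ12 κin F (i, n, j + k - n) =
      ∑ m ∈ A, κin m i • F (m, i + n - m, j + k - n) := fun n => by
    rw [subσ12_apply, finsum_eq_sum_of_forall A fun m hm => by
      rw [hz _ _ _ (by ring) (Or.inl hm), smul_zero]]
  have e5 : subσ σ23 κin (subσ σ12 κin F) (i, j, k) =
      ∑ m ∈ A, κin m i • ∑ n ∈ A, κin (n + m - i) j • F (m, n, i + j + k - m - n) := by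
    rw [subσ23_apply]
    simp only [e4, Finset.smul_sum]
    rw [finsum_sum_comm]
    · refine Finset.sum_congr rfl fun m _ => ?_
      rw [← finsum_comp_equiv (Equiv.addRight (m - i)), finsum_eq_sum_of_forall A]
      · refine Finset.sum_congr rfl fun n _ => ?_
        simp only [Equiv.coe_addRight]
        rw [smul_comm, show n + (m - i) = n + m - i by ring,
          show i + (n + m - i) - m = n by ring, show j + k - (n + m - i) = i + j + k - m - n by ring]
      · intro n hn
        rw [hz _ _ _ _ (Or.inr (by
          show i + (n + (m - i)) - m ∉ A
          rwa [show i + (n + (m - i)) - m = n by ring])), smul_zero,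
          smul_zero]
        simp only [Equiv.coe_addRight]
        ring
    · intro m _
      refine (A.finite_toSet.image (· + (m - i))).subset fun n hn => ?_
      rw [Function.mem_support] at hn
      refine ⟨i + n - m, ?_, by simp⟩
      by_contra h
      refine hn ?_
      rw [hz _ _ _ (by ring) (Or.inr h), smul_zero, smul_zero]
  rw [e3, e5]
  simp only [Finset.smul_sum, smul_smul]
  rw [Finset.sum_comm]
  refine Finset.sum_congr rfl fun m _ => ?_
  rw [Finset.sum_comm]
  refine Finset.sum_congr rfl fun n _ => ?_
  rw [← sum_κin, Finset.sum_smul]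
  exact Finset.sum_congr rfl fun M _ => by rw [mul_assoc]

/-- The additive map to the lexicographic product. -/
def lex3 : ℤ × ℤ × ℤ →+ ℤ ×ₗ (ℤ ×ₗ ℤ) where
  toFun g := toLex (g.1, toLex g.2)
  map_zero' := rfl
  map_add' _ _ := rfl

theorem exists_lex3_min {P : ℤ × ℤ × ℤ → Prop} (h1 : ∃ N : ℤ, ∀ i < N, ∀ j k, ¬ P (i, j, k))
    (h2 : ∀ i, ∃ N : ℤ, ∀ j < N, ∀ k, ¬ P (i, j, k))
    (h3 : ∀ i j, ∃ N : ℤ, ∀ k < N, ¬ P (i, j, k)) (h : ∃ g, P g) :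
    ∃ g, P g ∧ ∀ g', P g' → lex3 g ≤ lex3 g' := by
  obtain ⟨⟨i0, j0, k0⟩, h⟩ := h
  obtain ⟨N, hN⟩ := h1
  obtain ⟨i, ⟨j0, k0, hi⟩, hi'⟩ := exists_int_min (P := fun i => ∃ j k, P (i, j, k)) N
    (fun i hi ⟨j, k, h⟩ => hN i hi j k h) ⟨i0, j0, k0, h⟩
  obtain ⟨N, hN⟩ := h2 i
  obtain ⟨j, ⟨k0, hj⟩, hj'⟩ := exists_int_min (P := fun j => ∃ k, P (i, j, k)) N
    (fun j hj ⟨k, h⟩ => hN j hj k h) ⟨j0, k0, hi⟩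
  obtain ⟨N, hN⟩ := h3 i j
  obtain ⟨k, hk, hk'⟩ := exists_int_min (P := fun k => P (i, j, k)) N
    (fun k hk h => hN k hk h) ⟨k0, hj⟩
  refine ⟨(i, j, k), hk, fun ⟨i', j', k'⟩ h' => ?_⟩
  show toLex (i, toLex (j, k)) ≤ toLex (i', toLex (j', k'))
  rw [Prod.Lex.toLex_le_toLex, Prod.Lex.toLex_le_toLex]
  rcases (hi' i' ⟨j', k', h'⟩).lt_or_eq with h | rfl
  · exact Or.inl h
  rcases (hj' j' ⟨k', h'⟩).lt_or_eq with h | rfl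
  · exact Or.inr ⟨rfl, Or.inl h⟩
  exact Or.inr ⟨rfl, Or.inr ⟨rfl, hk' k' h'⟩⟩

theorem tr3_coeff (q : MvPolynomial (Fin 3) ℂ) (g : ℤ × ℤ × ℤ) :
    (MvPolynomial.aeval ![tX, tY, tZ] q : AddMonoidAlgebra ℂ (ℤ × ℤ × ℤ)).coeff g =
      ∑ d ∈ q.support, if g = ((d 0 : ℤ), (d 1 : ℤ), (d 2 : ℤ))
        then MvPolynomial.coeff d q else 0 := by
  rw [coeff_eq_act, vec3_tr, act_aeval_apply]
  refine Finset.sum_congr rfl fun d _ => ?_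
  rw [smul_eq_mul, mul_ite, mul_one, mul_zero]
  congr 1
  rw [sub_eq_zero, Fin.sum_univ_three]
  simp

theorem tr3_coeff_nat (q : MvPolynomial (Fin 3) ℂ) (d : Fin 3 →₀ ℕ) :
    (MvPolynomial.aeval ![tX, tY, tZ] q : AddMonoidAlgebra ℂ (ℤ × ℤ × ℤ)).coeff
      ((d 0 : ℤ), (d 1 : ℤ), (d 2 : ℤ)) = MvPolynomial.coeff d q := by
  rw [tr3_coeff, Finset.sum_eq_single d]
  · simp
  · intro d' _ hne
    refine if_neg fun h => hne ?_
    simp only [Prod.mk.injEq, Nat.cast_inj] at h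
    ext i; fin_cases i
    · exact h.1.symm
    · exact h.2.1.symm
    · exact h.2.2.symm
  · intro h
    rw [MvPolynomial.notMem_support_iff] at h
    simp [h]

theorem tr3_coeff_nonneg {q : MvPolynomial (Fin 3) ℂ} {g : ℤ × ℤ × ℤ}
    (h : (MvPolynomial.aeval ![tX, tY, tZ] q : AddMonoidAlgebra ℂ (ℤ × ℤ × ℤ)).coeff g ≠ 0) :
    0 ≤ g.1 ∧ 0 ≤ g.2.1 := by
  by_contra h'
  refine h ?_
  rw [tr3_coeff]
  refine Finset.sum_eq_zero fun d _ => if_neg fun h'' => h' ?_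
  rw [h'']
  simp

theorem exists_coeff_ne_of_eval {q : MvPolynomial (Fin 3) ℂ}
    (h : MvPolynomial.aeval ![0, 0, Polynomial.X] q ≠ (0 : Polynomial ℂ)) :
    ∃ k : ℤ, (MvPolynomial.aeval ![tX, tY, tZ] q : AddMonoidAlgebra ℂ (ℤ × ℤ × ℤ)).coeff
      (0, 0, k) ≠ 0 := by
  by_contra! h'
  apply h
  rw [MvPolynomial.aeval_def, MvPolynomial.eval₂_eq']
  refine Finset.sum_eq_zero fun d _ => ?_
  rw [Fin.prod_univ_three]
  by_cases h0 : d 0 = 0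
  · by_cases h1 : d 1 = 0
    · have := h' (d 2)
      rw [show ((0 : ℤ), (0 : ℤ), (d 2 : ℤ)) = ((d 0 : ℤ), (d 1 : ℤ), (d 2 : ℤ)) by
        rw [h0, h1]; rfl, tr3_coeff_nat] at this
      rw [this, map_zero, zero_mul]
    · simp [h1]
  · simp [h0]

/-- A polynomial in `x₀` and `x`, up to powers of `x₀`, is nonzero at `x₀ = 0`. -/
theorem exists_factor {p : MvPolynomial (Fin 2) ℂ} (hp : p ≠ 0) :
    ∃ (k : ℕ) (q : MvPolynomial (Fin 2) ℂ), p = MvPolynomial.X 0 ^ k * q ∧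
      MvPolynomial.aeval ![0, Polynomial.X] q ≠ (0 : Polynomial ℂ) := by
  obtain ⟨k, q, hq, rfl⟩ := WfDvdMonoid.max_power_factor hp
    (MvPolynomial.X_prime (R := ℂ) (i := (0 : Fin 2))).irreducible
  refine ⟨k, q, rfl, fun h => hq ?_⟩
  have h1 : MvPolynomial.aeval ![0, (MvPolynomial.X 1 : MvPolynomial (Fin 2) ℂ)] q = 0 := by
    have := congrArg (Polynomial.aeval (MvPolynomial.X 1 : MvPolynomial (Fin 2) ℂ)) h
    rw [aeval_vec2] at this
    simpa using this
  have h2 : ∀ q : MvPolynomial (Fin 2) ℂ, (MvPolynomial.X 0 : MvPolynomial (Fin 2) ℂ) ∣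
      q - MvPolynomial.aeval ![0, (MvPolynomial.X 1 : MvPolynomial (Fin 2) ℂ)] q := by
    intro q
    induction q using MvPolynomial.induction_on with
    | C a => simp
    | add p q hp hq =>
      rw [map_add, add_sub_add_comm]
      exact dvd_add hp hq
    | mul_X p i hp =>
      rw [map_mul, MvPolynomial.aeval_X]
      fin_cases i
      · simp
      · simp only [Fin.mk_one, Matrix.cons_val_one, Matrix.cons_val_fin_one]
        rw [← sub_mul]
        exact hp.mul_right _
  have := h2 q
  rwa [h1, sub_zero] at this

section

/-- Families in `V((x_k))((x_j))((x_i))`, for `(i, j, k)` the reordering `τ` of the variables. -/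
def Nested3 (τ : ℤ × ℤ × ℤ ≃+ ℤ × ℤ × ℤ) (Y : ℤ × ℤ × ℤ → V) : Prop :=
  (∃ N : ℤ, ∀ i < N, ∀ j k, Y (τ (i, j, k)) = 0) ∧
  (∀ i, ∃ N : ℤ, ∀ j < N, ∀ k, Y (τ (i, j, k)) = 0) ∧
  ∀ i j, ∃ N : ℤ, ∀ k < N, Y (τ (i, j, k)) = 0

variable {τ : ℤ × ℤ × ℤ ≃+ ℤ × ℤ × ℤ} {Y Z : ℤ × ℤ × ℤ → V}

theorem Nested3.smul (c : ℂ) (hY : Nested3 τ Y) : Nested3 τ (c • Y) := by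
  refine ⟨?_, fun i => ?_, fun i j => ?_⟩
  · obtain ⟨N, hN⟩ := hY.1
    exact ⟨N, fun i hi j k => by simp [hN i hi j k]⟩
  · obtain ⟨N, hN⟩ := hY.2.1 i
    exact ⟨N, fun j hj k => by simp [hN j hj k]⟩
  · obtain ⟨N, hN⟩ := hY.2.2 i j
    exact ⟨N, fun k hk => by simp [hN k hk]⟩

theorem Nested3.add (hY : Nested3 τ Y) (hZ : Nested3 τ Z) : Nested3 τ (Y + Z) := by
  refine ⟨?_, fun i => ?_, fun i j => ?_⟩
  · obtain ⟨N, hN⟩ := hY.1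
    obtain ⟨M, hM⟩ := hZ.1
    exact ⟨min N M, fun i hi j k => by simp [hN i (by omega) j k, hM i (by omega) j k]⟩
  · obtain ⟨N, hN⟩ := hY.2.1 i
    obtain ⟨M, hM⟩ := hZ.2.1 i
    exact ⟨min N M, fun j hj k => by simp [hN j (by omega) k, hM j (by omega) k]⟩
  · obtain ⟨N, hN⟩ := hY.2.2 i j
    obtain ⟨M, hM⟩ := hZ.2.2 i j
    exact ⟨min N M, fun k hk => by simp [hN k (by omega), hM k (by omega)]⟩

theorem Nested3.tr (d : ℤ × ℤ × ℤ) (hY : Nested3 τ Y) : Nested3 τ (fun g => Y (g - d)) := by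
  obtain ⟨⟨a, b, c⟩, rfl⟩ := τ.surjective d
  simp only [Nested3, ← map_sub, Prod.mk_sub_mk]
  refine ⟨?_, fun i => ?_, fun i j => ?_⟩
  · obtain ⟨N, hN⟩ := hY.1
    exact ⟨N + a, fun i hi j k => hN _ (by omega) _ _⟩
  · obtain ⟨N, hN⟩ := hY.2.1 (i - a)
    exact ⟨N + b, fun j hj k => hN _ (by omega) _⟩
  · obtain ⟨N, hN⟩ := hY.2.2 (i - a) (j - b)
    exact ⟨N + c, fun k hk => hN _ (by omega)⟩

theorem Nested3.act (f : AddMonoidAlgebra ℂ (ℤ × ℤ × ℤ)) (hY : Nested3 τ Y) :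
    Nested3 τ (act f Y) := by
  rw [act_eq_sum]
  induction f.coeff.support using Finset.induction_on with
  | empty => exact ⟨⟨0, fun _ _ _ _ => rfl⟩, fun _ => ⟨0, fun _ _ _ => rfl⟩,
      fun _ _ => ⟨0, fun _ _ => rfl⟩⟩
  | insert a s ha ih =>
    rw [Finset.sum_insert ha]
    exact ((hY.tr a).smul _).add ih

theorem Nested3.exists_min (hY : Nested3 τ Y) (B : Set (ℤ × ℤ × ℤ)) (h : ∃ g ∈ B, Y g ≠ 0) :
    ∃ g ∈ B, Y g ≠ 0 ∧ ∀ g' ∈ B, Y g' ≠ 0 →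
      (lex3.comp τ.symm.toAddMonoidHom) g ≤ (lex3.comp τ.symm.toAddMonoidHom) g' := by
  obtain ⟨g, hg, hne⟩ := h
  obtain ⟨g, ⟨h1, h2⟩, h3⟩ := exists_lex3_min (P := fun g => τ g ∈ B ∧ Y (τ g) ≠ 0)
    (by
      obtain ⟨N, hN⟩ := hY.1
      exact ⟨N, fun i hi j k h => h.2 (hN i hi j k)⟩)
    (fun i => by
      obtain ⟨N, hN⟩ := hY.2.1 i
      exact ⟨N, fun j hj k h => h.2 (hN j hj k)⟩)
    (fun i j => by
      obtain ⟨N, hN⟩ := hY.2.2 i j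
      exact ⟨N, fun k hk h => h.2 (hN k hk)⟩) ⟨τ.symm g, by simpa using ⟨hg, hne⟩⟩
  refine ⟨τ g, h1, h2, fun g' h h' => ?_⟩
  have := h3 (τ.symm g') (by simpa using ⟨h, h'⟩)
  simpa using this

theorem lex3_comp_injective (τ : ℤ × ℤ × ℤ ≃+ ℤ × ℤ × ℤ) :
    Function.Injective (lex3.comp τ.symm.toAddMonoidHom) := by
  intro a b h
  apply τ.symm.injective
  have h' : toLex ((τ.symm a).1, toLex (τ.symm a).2) = toLex ((τ.symm b).1, toLex (τ.symm b).2) := h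
  exact h'

theorem Nested3.eq_of_act (hY : Nested3 τ Y) (hZ : Nested3 τ Z)
    {f : AddMonoidAlgebra ℂ (ℤ × ℤ × ℤ)} (hf : f ≠ 0) (h : NVA.act f Y = NVA.act f Z) :
    Y = Z := by
  have hYZ : Nested3 τ (Y + (-1 : ℂ) • Z) := hY.add (hZ.smul _)
  have h0 : NVA.act f (Y + (-1 : ℂ) • Z) = 0 := by
    rw [map_add, map_smul, h, neg_one_smul, add_neg_cancel]
  obtain ⟨d₀, h1, h2⟩ := exists_min_coeff (lex3.comp τ.symm.toAddMonoidHom) hf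
  have := act_cancel (lex3.comp τ.symm.toAddMonoidHom) (lex3_comp_injective τ) f d₀ h1 h2 Set.univ
    (fun _ _ _ _ => trivial) _ (hYZ.exists_min _) (fun g _ => by rw [h0]; rfl)
  rw [← sub_eq_zero]
  funext g
  simpa [sub_eq_add_neg] using this g trivial

/-- The exchange of the first two variables. -/
def swap12 : ℤ × ℤ × ℤ ≃+ ℤ × ℤ × ℤ where
  toFun g := (g.2.1, g.1, g.2.2)
  invFun g := (g.2.1, g.1, g.2.2)
  left_inv _ := rfl
  right_inv _ := rfl
  map_add' _ _ := rfl

theorem Nested3.nonneg (hY : Nested3 swap12 Y) {q : MvPolynomial (Fin 3) ℂ}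
    (hq : MvPolynomial.aeval ![0, 0, Polynomial.X] q ≠ (0 : Polynomial ℂ))
    (h0 : ∀ i j k, i < 0 ∨ j < 0 →
      NVA.act (MvPolynomial.aeval ![tX, tY, tZ] q) Y (i, j, k) = 0) :
    ∀ i j k, i < 0 ∨ j < 0 → Y (i, j, k) = 0 := by
  obtain ⟨k₀, hk₀⟩ := exists_coeff_ne_of_eval hq
  obtain ⟨d₀, h1, h2⟩ := exists_min_coeff (lex3.comp swap12.symm.toAddMonoidHom)
    (f := MvPolynomial.aeval ![tX, tY, tZ] q) (fun h => hk₀ (by rw [h]; rfl))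
  have h3 := tr3_coeff_nonneg h1
  have h4 : d₀.1 = 0 ∧ d₀.2.1 = 0 := by
    have h5 : toLex (d₀.2.1, toLex (d₀.1, d₀.2.2)) ≤ toLex ((0 : ℤ), toLex ((0 : ℤ), k₀)) :=
      h2 _ hk₀
    rw [Prod.Lex.toLex_le_toLex, Prod.Lex.toLex_le_toLex] at h5
    simp only at h5
    omega
  intro i j k hij
  refine act_cancel (lex3.comp swap12.symm.toAddMonoidHom) (lex3_comp_injective swap12) _ d₀ h1 h2
    {g | g.1 < 0 ∨ g.2.1 < 0} (fun g hg d hd => ?_) Y (hY.exists_min _) (fun g hg => ?_)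
    (i, j, k) hij
  · have := tr3_coeff_nonneg hd
    simp only [Set.mem_ofPred_eq, Prod.fst_sub, Prod.snd_sub] at hg ⊢
    omega
  · refine h0 _ _ _ ?_
    simp only [Set.mem_ofPred_eq] at hg ⊢
    omega

theorem aeval_pairPoly_three {A : Type*} [CommRing A] [Algebra ℂ A] (p : MvPolynomial (Fin 2) ℂ)
    (a b c : A) : MvPolynomial.aeval ![a, b, c] (pairPoly p 3) =
      MvPolynomial.aeval ![a, b] p * MvPolynomial.aeval ![a, c] p *
        MvPolynomial.aeval ![b, c] p := by
  have h : (Finset.univ.filter fun ij : Fin 3 × Fin 3 => ij.1 < ij.2) =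
      {(0, 1), (0, 2), (1, 2)} := by decide
  rw [pairPoly, h, Finset.prod_insert (by decide), Finset.prod_insert (by decide),
    Finset.prod_singleton, map_mul, map_mul, mul_assoc]
  simp only [MvPolynomial.aeval_rename]
  have h1 : ![a, b, c] ∘ ![0, 1] = ![a, b] := by funext i; fin_cases i <;> rfl
  have h2 : ![a, b, c] ∘ ![0, 2] = ![a, c] := by funext i; fin_cases i <;> rfl
  have h3 : ![a, b, c] ∘ ![1, 2] = ![b, c] := by funext i; fin_cases i <;> rfl
  rw [h1, h2, h3]

theorem aeval_pairPoly_two {A : Type*} [CommRing A] [Algebra ℂ A] (p : MvPolynomial (Fin 2) ℂ)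
    (a b : A) : MvPolynomial.aeval ![a, b] (pairPoly p 2) = MvPolynomial.aeval ![a, b] p := by
  have h : (Finset.univ.filter fun ij : Fin 2 × Fin 2 => ij.1 < ij.2) = {(0, 1)} := by decide
  rw [pairPoly, h, Finset.prod_singleton, MvPolynomial.aeval_rename]
  congr 2
  funext i; fin_cases i <;> rfl

theorem QCSet.qcPair {S : Set (EW W)} (hS : QCSet S) {a b : EW W} (ha : a ∈ S) (hb : b ∈ S) :
    QCPair a b := by
  obtain ⟨p, hp, h⟩ := hS 2 ![a, b] (by intro i; fin_cases i <;> assumption)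
  rw [qcPair_iff]
  refine ⟨p, hp, fun w => ?_⟩
  obtain ⟨N, hN⟩ := h w
  refine ⟨N, fun m t hmt => ?_⟩
  have := hN ![m, t] (by
    rcases hmt with h | h
    · exact ⟨0, h⟩
    · exact ⟨1, h⟩)
  rw [pe, ← aeval_pairPoly_two, vec2_tr, act_aeval_apply, ← this]
  refine Finset.sum_congr rfl fun d _ => ?_
  simp [seqCoeff, Fin.tail, FabP, Fab]

theorem QCSet.exists_laurent3 {S : Set (EW W)} (hS : QCSet S) {u v c : EW W} (hu : u ∈ S)
    (hv : v ∈ S) (hc : c ∈ S) : ∃ p : MvPolynomial (Fin 2) ℂ, p ≠ 0 ∧ ∀ w,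
      Laurent3 (act (MvPolynomial.aeval ![tX, tY, tZ] (pairPoly p 3)) (Fam3 u v c w)) := by
  obtain ⟨p, hp, h⟩ := hS 3 ![u, v, c] (by intro i; fin_cases i <;> assumption)
  refine ⟨p, hp, fun w => ?_⟩
  obtain ⟨N, hN⟩ := h w
  refine ⟨N, fun i j k hijk => ?_⟩
  have := hN ![i, j, k] (by
    rcases hijk with h | h | h
    · exact ⟨0, h⟩
    · exact ⟨1, h⟩
    · exact ⟨2, h⟩)
  rw [vec3_tr, act_aeval_apply, ← this]
  refine Finset.sum_congr rfl fun d _ => ?_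
  simp [seqCoeff, Fin.tail, Fam3, Fin.sum_univ_three]

theorem aeval_shear {A : Type*} [CommRing A] [Algebra ℂ A] (p : MvPolynomial (Fin 2) ℂ)
    (a b : A) : MvPolynomial.aeval ![a, b] (shear p) = MvPolynomial.aeval ![a + b, b] p := by
  rw [shear, aeval_vec2]
  simp

theorem act_tr_injective (g : G) : Function.Injective (act (V := V) (tr g)) := by
  intro F F' h
  funext x
  have := congrFun h (x + g)
  simpa [act_tr] using this

end

theorem YE_zero_right {a : EW W} (h : QCPair a 0) (n : ℤ) : YE a 0 n = 0 := by
  have := YE_smul_right (0 : ℂ) (b := (0 : EW W)) (by simpa using h) h n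
  simpa using this

/-- If `shear p = X 0 ^ k * q` then `p(x,z) p(y,z) p(x,y)` splits after the substitution
`x = x₀ + z`, `y = x₂ + z`; this is the factor not involving `q`. -/
def iteratePoly (k : ℕ) : MvPolynomial (Fin 3) ℂ :=
  (MvPolynomial.X 0 - MvPolynomial.X 1) ^ k * MvPolynomial.X 0 ^ k * MvPolynomial.X 1 ^ k

/-- The factor involving `q` in the variables `x₀`, `x₂`, `z`. -/
def leftPoly (q : MvPolynomial (Fin 2) ℂ) : MvPolynomial (Fin 3) ℂ :=
  MvPolynomial.aeval ![MvPolynomial.X 0 - MvPolynomial.X 1, MvPolynomial.X 1 + MvPolynomial.X 2] q *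
  MvPolynomial.aeval ![MvPolynomial.X 0, MvPolynomial.X 2] q *
  MvPolynomial.aeval ![MvPolynomial.X 1, MvPolynomial.X 2] q

theorem aeval_leftPoly {A : Type*} [CommRing A] [Algebra ℂ A] (q : MvPolynomial (Fin 2) ℂ)
    (a b c : A) : MvPolynomial.aeval ![a, b, c] (leftPoly q) =
      MvPolynomial.aeval ![a - b, b + c] q * MvPolynomial.aeval ![a, c] q *
        MvPolynomial.aeval ![b, c] q := by
  rw [leftPoly, map_mul, map_mul, aeval_vec2, aeval_vec2, aeval_vec2]
  simp

theorem aeval_iteratePoly {A : Type*} [CommRing A] [Algebra ℂ A] (k : ℕ)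
    (a b c : A) : MvPolynomial.aeval ![a, b, c] (iteratePoly k) = (a - b) ^ k * a ^ k * b ^ k := by
  simp [iteratePoly]

theorem aeval_pairPoly_shift {A : Type*} [CommRing A] [Algebra ℂ A] {p q : MvPolynomial (Fin 2) ℂ}
    {k : ℕ} (hq : shear p = MvPolynomial.X 0 ^ k * q) (a b c : A) :
    MvPolynomial.aeval ![a + c, b + c, c] (pairPoly p 3) =
      MvPolynomial.aeval ![a, b, c] (leftPoly q) *
        MvPolynomial.aeval ![a, b, c] (iteratePoly k) := by
  have h : ∀ x y : A, MvPolynomial.aeval ![x + y, y] p = x ^ k * MvPolynomial.aeval ![x, y] q := by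
    intro x y
    rw [← aeval_shear, hq]
    simp
  rw [aeval_pairPoly_three, aeval_leftPoly, aeval_iteratePoly,
    show a + c = (a - b) + (b + c) by ring, h, show (a - b) + (b + c) = a + c by ring, h, h]
  ring

theorem YE_weak_assoc {u v c : EW W} (h1 : QCPair v c) (h2 : ∀ n, QCPair u (YE v c n))
    (h3 : QCPair u v) (h4 : ∀ n, QCPair (YE u v n) c) {p : MvPolynomial (Fin 2) ℂ} (hp : p ≠ 0)
    (hL : ∀ w, Laurent3 (act (MvPolynomial.aeval ![tX, tY, tZ] (pairPoly p 3)) (Fam3 u v c w))) :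
    ∃ k : ℕ, ∀ (w : W) (t : ℤ),
      act (qe (MvPolynomial.X 0 ^ k)) (sub κout fun g => mf (YE u (YE v c (-g.2 - 1)) (-g.1 - 1)) w t) =
        act (qe (MvPolynomial.X 0 ^ k)) fun g => mf (YE (YE u v (-g.1 - 1)) c (-g.2 - 1)) w t := by
  obtain ⟨k, q, hk, hq⟩ := exists_factor (shear_ne_zero hp)
  refine ⟨k, fun w t => ?_⟩
  set F := act (MvPolynomial.aeval ![tX, tY, tZ] (pairPoly p 3)) (Fam3 u v c w) with hF
  set Y : ℤ × ℤ × ℤ → W := fun g => Yfam u (YE v c (-g.2.1 - 1)) w (g.1, g.2.2) with hY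
  set Z : ℤ × ℤ × ℤ → W := fun g => Yfam (YE u v (-g.1 - 1)) c w g.2 with hZ
  have hleft := act_Yfam_left w h1 h2 _ (hL w) rfl
  have hright := act_Yfam_right w h3 h4 _ (hL w) rfl
  have hass := sub_sub (hL w)
  rw [← hF, ← hY, aeval_pairPoly_shift hk, act_mul] at hleft
  rw [← hF, ← hZ, ← add_assoc, aeval_pairPoly_shift hk, act_mul, ← hass] at hright
  set T := act (MvPolynomial.aeval ![tX, tY, tZ] (iteratePoly k)) Y with hT
  obtain ⟨-, -, -, -, -, K, hK⟩ := Yfam_spec h1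
  obtain ⟨-, -, -, -, -, L, hLL⟩ := Yfam_spec h3
  have hYK : ∀ j < K, ∀ i s, Y (i, j, s) = 0 := by
    intro j hj i s
    have h0 : QCPair u 0 := by
      have := h2 (-j - 1)
      rwa [hK j hj] at this
    simp only [hY, Yfam]
    rw [hK j hj, YE_zero_right h0]
    rfl
  have hYn : Nested3 swap12 Y := by
    refine ⟨⟨K, fun j hj i s => hYK j hj i s⟩, fun j => ?_, fun j i => ?_⟩
    · obtain ⟨-, -, -, -, hn, -⟩ := Yfam_spec (h2 (-j - 1))
      exact (hn w).1
    · obtain ⟨-, -, -, -, hn, -⟩ := Yfam_spec (h2 (-j - 1))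
      exact (hn w).2 i
  have hZn : Nested3 (AddEquiv.refl _) Z := by
    refine ⟨⟨L, fun i hi j s => ?_⟩, fun i => ?_, fun i j => ?_⟩
    · have h0 : QCPair 0 c := by
        have := h4 (-i - 1)
        rwa [hLL i hi] at this
      change Yfam (YE u v (-i - 1)) c w (j, s) = 0
      have := YE_smul_left (0 : ℂ) (a := (0 : EW W)) (by simpa using h0) h0 (-j - 1)
      rw [Yfam, hLL i hi]
      simp only [zero_smul] at this
      rw [this]
      rfl
    · obtain ⟨-, -, -, -, hn, -⟩ := Yfam_spec (h4 (-i - 1))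
      exact (hn w).1
    · obtain ⟨-, -, -, -, hn, -⟩ := Yfam_spec (h4 (-i - 1))
      exact (hn w).2 j
  have hev : ∀ q' : MvPolynomial (Fin 3) ℂ, MvPolynomial.aeval ![0, 0, Polynomial.X] q' =
      (MvPolynomial.aeval ![0, Polynomial.X] q : Polynomial ℂ) ^ 3 →
      MvPolynomial.aeval ![0, 0, Polynomial.X] q' ≠ (0 : Polynomial ℂ) := fun q' h => by
    rw [h]
    exact pow_ne_zero _ hq
  have hTs : ∀ i j s, i < 0 ∨ j < 0 → T (i, j, s) = 0 := by
    refine Nested3.nonneg (hYn.act _) (q := leftPoly q) (hev _ ?_) fun i j s hij => ?_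
    · rw [aeval_leftPoly]
      simp only [sub_zero, zero_add]
      ring
    · rw [hleft, subσ13_apply]
      refine finsum_eq_zero_of_forall_eq_zero fun m => ?_
      rcases hij with h | h
      · rw [κin_neg h, zero_smul]
      · rw [subσ23_apply, finsum_eq_zero_of_forall_eq_zero, smul_zero]
        intro m'
        rw [κin_neg h, zero_smul]
  have hTin : ∀ s, SD κin (slice σ12 T s) := fun s a b =>
    (Finset.finite_toSet (Finset.Icc 0 b)).subset fun m hm => by
      rw [Finset.mem_coe, Finset.mem_Icc]
      by_contra hcon
      exact hm.2 (hTs m (b - m) s (by omega))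
  have hYout : ∀ s, SD κout (slice σ12 Y s) := fun s a b =>
    (Finset.finite_toSet (Finset.Icc a (b - K))).subset fun m hm => by
      rw [Finset.mem_coe, Finset.mem_Icc]
      by_contra hcon
      rcases lt_or_ge m a with h | h
      · exact hm.1 (by rw [κout, if_neg (by omega)])
      · exact hm.2 (hYK (b - m) (by omega) m s)
  have hsubT : subσ σ12 κin T =
      act (MvPolynomial.aeval ![tX + tY, tY, tZ] (iteratePoly k)) Z := by
    have hg : (MvPolynomial.aeval ![tX + tY, tY, tZ] (leftPoly q) :
        AddMonoidAlgebra ℂ (ℤ × ℤ × ℤ)) ≠ 0 := by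
      have h5 : (MvPolynomial.aeval ![tX + tY, tY, tZ] (leftPoly q) :
          AddMonoidAlgebra ℂ (ℤ × ℤ × ℤ)) = MvPolynomial.aeval ![tX, tY, tZ]
          (MvPolynomial.aeval ![MvPolynomial.X 0 + MvPolynomial.X 1, MvPolynomial.X 1,
            MvPolynomial.X 2] (leftPoly q) : MvPolynomial (Fin 3) ℂ) := by
        rw [aeval_vec3]
        simp
      obtain ⟨s, hs⟩ := exists_coeff_ne_of_eval (q := MvPolynomial.aeval
        ![MvPolynomial.X 0 + MvPolynomial.X 1, MvPolynomial.X 1, MvPolynomial.X 2] (leftPoly q))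
        (hev _ (by
          rw [aeval_vec3, aeval_leftPoly]
          simp only [map_add, MvPolynomial.aeval_X, Matrix.cons_val_zero, Matrix.cons_val_one,
            Matrix.cons_val]
          simp only [add_zero, sub_zero, zero_add]
          ring))
      intro h
      rw [← h5, h] at hs
      exact hs rfl
    refine Nested3.eq_of_act (τ := AddEquiv.refl _) ?_ (hZn.act _) hg ?_
    · refine ⟨⟨0, fun i hi j s => ?_⟩, fun i => ⟨-i, fun j hj s => ?_⟩, fun i j => ?_⟩
      · change subσ σ12 κin T (i, j, s) = 0
        rw [subσ12_apply]
        exact finsum_eq_zero_of_forall_eq_zero fun m => by rw [κin_neg hi, zero_smul]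
      · change subσ σ12 κin T (i, j, s) = 0
        rw [subσ12_apply]
        refine finsum_eq_zero_of_forall_eq_zero fun m => ?_
        rw [hTs _ _ _ (by omega), smul_zero]
      · have hex : ∀ m, ∃ N : ℤ, ∀ s < N, T (m, i + j - m, s) = 0 := fun m =>
          (hYn.act _).2.2 (i + j - m) m
        choose N hN using hex
        obtain ⟨M, hM⟩ := ((Finset.Icc 0 (i + j)).image N).bddBelow
        refine ⟨M, fun s hs => ?_⟩
        change subσ σ12 κin T (i, j, s) = 0
        rw [subσ12_apply]
        refine finsum_eq_zero_of_forall_eq_zero fun m => ?_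
        by_cases hm : m ∈ Finset.Icc 0 (i + j)
        · rw [hN m s (lt_of_lt_of_le hs (hM (Finset.mem_coe.2 (Finset.mem_image_of_mem N hm)))),
            smul_zero]
        · rw [Finset.mem_Icc] at hm
          rw [hTs _ _ _ (by omega), smul_zero]
    · have := subσ_act σ12 κin_pascal (leftPoly q) hTin
      rw [hright]
      exact this.symm.trans (by
        change subσ σ12 κin (act (MvPolynomial.aeval ![tX, tY, tZ] (leftPoly q)) T) = _
        rw [hleft])
  have hinout : subσ σ12 κin T = subσ σ12 κout T := by
    refine slice_ext σ12 fun s => ?_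
    rw [slice_subσ, slice_subσ]
    exact sub_in_eq_out fun m hm j => hTs m j s (Or.inl hm)
  have hfin : act (MvPolynomial.aeval ![tX + tY, tY, tZ] (iteratePoly k)) (subσ σ12 κout Y) =
      act (MvPolynomial.aeval ![tX + tY, tY, tZ] (iteratePoly k)) Z := by
    rw [← hsubT, hinout]
    exact (subσ_act σ12 κout_pascal (iteratePoly k) hYout).symm
  have hsplit : (MvPolynomial.aeval ![tX + tY, tY, tZ] (iteratePoly k) :
      AddMonoidAlgebra ℂ (ℤ × ℤ × ℤ)) = tr ((k : ℤ), (k : ℤ), (0 : ℤ)) * up σ12 (qe (MvPolynomial.X 0 ^ k)) := by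
    have h6 : up σ12 (qe (MvPolynomial.X 0 ^ k)) = (tX + tY) ^ k := by
      simp [qe, up_tr, σ12]
    rw [aeval_iteratePoly, h6, add_sub_cancel_right, tr_pow, tr_pow]
    rw [show (tr (k • ((1 : ℤ), (0 : ℤ), (0 : ℤ))) * (tX + tY) ^ k * tr (k • ((0 : ℤ), (1 : ℤ), (0 : ℤ)))
      : AddMonoidAlgebra ℂ (ℤ × ℤ × ℤ)) = (tr (k • ((1 : ℤ), (0 : ℤ), (0 : ℤ))) *
        tr (k • ((0 : ℤ), (1 : ℤ), (0 : ℤ)))) * (tX + tY) ^ k by ring, tr_mul]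
    congr 2
    simp
  rw [hsplit, act_mul, act_mul] at hfin
  have h7 := congrArg (fun f => slice σ12 f (-t - 1)) (act_tr_injective _ hfin)
  simp only [slice_act_up, slice_subσ] at h7
  have h8 : slice σ12 Y (-t - 1) = fun g => mf (YE u (YE v c (-g.2 - 1)) (-g.1 - 1)) w t := by
    funext g
    change Yfam u (YE v c (-g.2 - 1)) w (g.1, -t - 1) = _
    rw [Yfam]
    congr 1
    ring
  have h9 : slice σ12 Z (-t - 1) = fun g => mf (YE (YE u v (-g.1 - 1)) c (-g.2 - 1)) w t := by
    funext g
    change Yfam (YE u v (-g.1 - 1)) c w (g.2, -t - 1) = _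
    rw [Yfam]
    congr 1
    ring
  rwa [h8, h9] at h7

/-- The map `a(x) ↦ Y_ℰ(a(x), x₀)` on a closed quasi compatible subspace. -/
def stateField (U : Submodule ℂ (EW W)) (hQ : QCSet (U : Set (EW W)))
    (hC : ∀ a ∈ U, ∀ b ∈ U, ∀ n : ℤ, YE a b n ∈ U) : U →ₗ[ℂ] EW U where
  toFun a := ⟨{
      toFun b n := ⟨YE a b n, hC a a.2 b b.2 n⟩
      map_add' b b' := funext fun n => Subtype.ext
        (YE_add_right (hQ.qcPair a.2 (b + b').2) (hQ.qcPair a.2 b.2) (hQ.qcPair a.2 b'.2) n)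
      map_smul' c b := funext fun n => Subtype.ext
        (YE_smul_right c (hQ.qcPair a.2 (c • b).2) (hQ.qcPair a.2 b.2) n) }, fun b => by
    obtain ⟨-, -, -, -, -, K, hK⟩ := Yfam_spec (hQ.qcPair a.2 b.2)
    refine ⟨-K, fun n hn => Subtype.ext ?_⟩
    have := hK (-n - 1) (by omega)
    rwa [show -(-n - 1) - 1 = n by ring] at this⟩
  map_add' a a' := EW_ext fun b n => Subtype.ext
    (YE_add_left (hQ.qcPair (a + a').2 b.2) (hQ.qcPair a.2 b.2) (hQ.qcPair a'.2 b.2) n)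
  map_smul' c a := EW_ext fun b n => Subtype.ext
    (YE_smul_left c (hQ.qcPair (c • a).2 b.2) (hQ.qcPair a.2 b.2) n)

/-- A closed quasi compatible subspace containing `1_W` is a nonlocal vertex algebra. -/
def closedNLVA (U : Submodule ℂ (EW W)) (hQ : QCSet (U : Set (EW W)))
    (hC : ∀ a ∈ U, ∀ b ∈ U, ∀ n : ℤ, YE a b n ∈ U) (h1 : oneE ∈ U) : NLVA U where
  Y := stateField U hQ hC
  one := ⟨oneE, h1⟩
  vac v n := Subtype.ext ((YE_one_left (v : EW W) n).trans (by split_ifs <;> rfl))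
  creation0 v n hn := Subtype.ext
    ((YE_one_right (v : EW W) n (by omega)).trans (if_neg (by omega)))
  creation1 v := Subtype.ext ((YE_one_right (v : EW W) (-1) le_rfl).trans (if_pos rfl))
  wassoc u v c := by
    obtain ⟨p, hp, hL⟩ := hQ.exists_laurent3 u.2 v.2 c.2
    obtain ⟨k, hk⟩ := YE_weak_assoc (hQ.qcPair v.2 c.2)
      (fun n => hQ.qcPair u.2 (hC _ v.2 _ c.2 n)) (hQ.qcPair u.2 v.2)
      (fun n => hQ.qcPair (hC _ u.2 _ v.2 n) c.2) hp hL
    refine ⟨k, fun a b => Subtype.ext (EW_ext fun w t => ?_)⟩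
    rw [mulSubPoly_eq, mulSubPoly_eq]
    let φ : U →ₗ[ℂ] W :=
      { toFun := fun x => mf (x : EW W) w t
        map_add' := fun x y => mf_add_left _ _ _ _
        map_smul' := fun c x => mf_smul_left _ _ _ _ }
    have hprod : (fun g : ℤ × ℤ => prodCE (fun x => mf (stateField U hQ hC x))
        (fun x => mf (stateField U hQ hC x)) u v c g.1 g.2) =
        sub κout (FabP (stateField U hQ hC u) (stateField U hQ hC v) c) :=
      funext fun g => (sub_out_eq_prodCE _ _ _ _ _).symm
    change φ _ = φ _
    rw [hprod]
    refine (congrFun (act_map φ _ _) (a, b)).symm.trans (Eq.trans ?_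
      (congrFun (act_map φ _ _) (a, b)))
    rw [← sub_map φ (SD_out_FabP _ _ c)]
    exact congrFun (hk w t) (a, b)

theorem closedNLVA_isQuasiModule (U : Submodule ℂ (EW W)) (hQ : QCSet (U : Set (EW W)))
    (hC : ∀ a ∈ U, ∀ b ∈ U, ∀ n : ℤ, YE a b n ∈ U) (h1 : oneE ∈ U) :
    IsQuasiModule (closedNLVA U hQ hC h1) U.subtype := by
  refine ⟨fun w n => mf_oneE w n, fun u v w => ?_⟩
  obtain ⟨f, hf, h⟩ := quasi_assoc (hQ.qcPair u.2 v.2) w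
  refine ⟨f, hf, fun a b => ?_⟩
  rw [mulSubPoly_eq, mulSubPoly_eq]
  have hprod : (fun g : ℤ × ℤ => prodCE (YWf U.subtype) (YWf U.subtype) u v w g.1 g.2) =
      sub κout (FabP (u : EW W) v w) :=
    funext fun g => (sub_out_eq_prodCE _ _ _ _ _).symm
  rw [hprod, h]
  rfl

section

variable {n : ℕ}

/-! ### Infinite sums of operators -/

/-- Pointwise finiteness of the sum of the operators `f i` applied to the family `E`. -/
def PF (f : I → AddMonoidAlgebra ℂ G) (E : G → V) : Prop :=
  ∀ g, (Function.support fun i => act (f i) E g).Finite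

/-- The sum of the operators `f i` applied to the family `E`. -/
def psA (f : I → AddMonoidAlgebra ℂ G) (E : G → V) : G → V := fun g => ∑ᶠ i, act (f i) E g

theorem psA_add {f : I → AddMonoidAlgebra ℂ G} {E E' : G → V} (h : PF f E) (h' : PF f E') :
    psA f (E + E') = psA f E + psA f E' := by
  funext g
  simp only [psA, map_add, Pi.add_apply]
  exact finsum_add_distrib (h g) (h' g)

theorem psA_smul (f : I → AddMonoidAlgebra ℂ G) (c : ℂ) (E : G → V) :
    psA f (c • E) = c • psA f E := by
  funext g
  simp only [psA, map_smul, Pi.smul_apply]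
  exact (smul_finsum c _).symm

theorem psA_zero (f : I → AddMonoidAlgebra ℂ G) : psA f (0 : G → V) = 0 := by
  funext g
  simp [psA]

theorem act_psA {f : I → AddMonoidAlgebra ℂ G} {E : G → V} (h : PF f E)
    (q : AddMonoidAlgebra ℂ G) : NVA.act q (psA f E) = psA f (NVA.act q E) := by
  funext g
  rw [act_apply]
  simp only [psA]
  have : ∀ i, NVA.act (f i) (NVA.act q E) g =
      ∑ d ∈ q.coeff.support, q.coeff d • NVA.act (f i) E (g - d) := fun i => by
    rw [act_comm, act_apply]
  simp only [this]
  rw [finsum_sum_comm]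
  · refine Finset.sum_congr rfl fun d _ => ?_
    rw [smul_finsum]
  · intro d _
    refine (h (g - d)).subset fun i hi => ?_
    intro h0
    exact hi (by simp only [h0, smul_zero])

theorem psA_psA {f : I → AddMonoidAlgebra ℂ G} {f' : J → AddMonoidAlgebra ℂ G} {E : G → V}
    (h' : PF f' E) (h : PF (fun ij : I × J => f ij.1 * f' ij.2) E) :
    psA f (psA f' E) = psA (fun ij : I × J => f ij.1 * f' ij.2) E := by
  funext g
  have h1 : psA (fun ij : I × J => f ij.1 * f' ij.2) E g =
      ∑ᶠ i, ∑ᶠ j, act (f i * f' j) E g := finsum_curry _ (h g)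
  rw [h1]
  refine finsum_congr fun i => ?_
  rw [act_psA h']
  refine finsum_congr fun j => ?_
  rw [act_mul, act_comm]

theorem psA_unit (f : AddMonoidAlgebra ℂ G) (E : G → V) : psA (fun _ : Unit => f) E = act f E := by
  funext g
  simp [psA, finsum_unique]

/-- A family of polynomials is locally finite when each monomial occurs in finitely many of its
members. -/
def LocFin (h : I → MvPolynomial (Fin n) ℂ) : Prop :=
  ∀ N : ℕ, {i | ∃ d ∈ (h i).support, d.degree ≤ N}.Finite

/-- The Laurent polynomial obtained from a polynomial by substituting translations. -/
abbrev ev (x : Fin n → G) : MvPolynomial (Fin n) ℂ →ₐ[ℂ] AddMonoidAlgebra ℂ G :=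
  MvPolynomial.aeval fun i => tr (x i)

/-- The translates of `E` in the directions `x` eventually vanish. -/
def LowDeg (x : Fin n → G) (E : G → V) : Prop :=
  ∀ g, ∃ N : ℕ, ∀ d : Fin n →₀ ℕ, N < d.degree → E (g - ∑ j, d j • x j) = 0

/-- Each nonzero value of `E'` lies above a nonzero value of `E` in the directions `x`. -/
def Dom (x : Fin n → G) (E' E : G → V) : Prop :=
  ∀ g, E' g ≠ 0 → ∃ d : Fin n →₀ ℕ, E (g - ∑ j, d j • x j) ≠ 0

theorem dom_act (x : Fin n → G) (p : MvPolynomial (Fin n) ℂ) (E : G → V) :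
    Dom x (act (ev x p) E) E := by
  intro g hg
  rw [act_aeval_apply] at hg
  obtain ⟨d, _, hd⟩ := Finset.exists_ne_zero_of_sum_ne_zero hg
  exact ⟨d, fun h0 => hd (by rw [h0, smul_zero])⟩

theorem dom_psA (x : Fin n → G) (h : I → MvPolynomial (Fin n) ℂ) (E : G → V) :
    Dom x (psA (fun i => ev x (h i)) E) E := by
  intro g hg
  have : ∃ i, act (ev x (h i)) E g ≠ 0 := by
    by_contra hc
    push Not at hc
    exact hg (by simp [psA, hc])
  obtain ⟨i, hi⟩ := this
  exact dom_act x (h i) E g hi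

theorem LowDeg.dom {x : Fin n → G} {E E' : G → V} (h : LowDeg x E) (hd : Dom x E' E) :
    LowDeg x E' := by
  intro g
  obtain ⟨N, hN⟩ := h g
  refine ⟨N, fun d hlt => ?_⟩
  by_contra hne
  obtain ⟨d', hd'⟩ := hd _ hne
  refine hd' ?_
  have := hN (d + d') (by rw [map_add]; omega)
  simp only [Finsupp.add_apply, add_smul, Finset.sum_add_distrib] at this
  rwa [_root_.sub_sub]

theorem LowDeg.add {x : Fin n → G} {E E' : G → V} (h : LowDeg x E) (h' : LowDeg x E') :
    LowDeg x (E + E') := by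
  intro g
  obtain ⟨N, hN⟩ := h g
  obtain ⟨N', hN'⟩ := h' g
  refine ⟨max N N', fun d hlt => ?_⟩
  rw [Pi.add_apply, hN d (lt_of_le_of_lt (le_max_left _ _) hlt),
    hN' d (lt_of_le_of_lt (le_max_right _ _) hlt), add_zero]

theorem LowDeg.smul {x : Fin n → G} {E : G → V} (c : ℂ) (h : LowDeg x E) :
    LowDeg x (c • E) := by
  intro g
  obtain ⟨N, hN⟩ := h g
  exact ⟨N, fun d hlt => by rw [Pi.smul_apply, hN d hlt, smul_zero]⟩

theorem LowDeg.zero {x : Fin n → G} : LowDeg x (0 : G → V) := fun _ => ⟨0, fun _ _ => rfl⟩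

theorem LocFin.pf {x : Fin n → G} {h : I → MvPolynomial (Fin n) ℂ} (hh : LocFin h)
    {E : G → V} (hE : LowDeg x E) : PF (fun i => ev x (h i)) E := by
  intro g
  obtain ⟨N, hN⟩ := hE g
  refine (hh N).subset fun i hi => ?_
  rw [Function.mem_support, act_aeval_apply] at hi
  obtain ⟨d, hd, hne⟩ := Finset.exists_ne_zero_of_sum_ne_zero hi
  refine ⟨d, hd, not_lt.1 fun hlt => hne (by rw [hN d hlt, smul_zero])⟩

theorem LocFin.of_degree {m : ℕ} {h : I → MvPolynomial (Fin n) ℂ} (hh : LocFin h) (K : ℕ)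
    {h' : I → MvPolynomial (Fin m) ℂ}
    (H : ∀ i, ∀ d' ∈ (h' i).support, ∃ d ∈ (h i).support, d.degree ≤ d'.degree + K) :
    LocFin h' := by
  intro N
  refine (hh (N + K)).subset ?_
  rintro i ⟨d', hd', hle⟩
  obtain ⟨d, hd, hle'⟩ := H i d' hd'
  exact ⟨d, hd, by omega⟩

theorem mem_support_mul {p q : MvPolynomial (Fin n) ℂ} {d : Fin n →₀ ℕ}
    (h : d ∈ (p * q).support) : ∃ d1 ∈ p.support, ∃ d2 ∈ q.support, d1 + d2 = d := by
  have := MvPolynomial.support_mul p q h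
  simpa [Finset.mem_add] using Finset.mem_add.1 this

theorem LocFin.mul {h : I → MvPolynomial (Fin n) ℂ} {h' : J → MvPolynomial (Fin n) ℂ}
    (hh : LocFin h) (hh' : LocFin h') : LocFin fun ij : I × J => h ij.1 * h' ij.2 := by
  intro N
  refine ((hh N).prod (hh' N)).subset ?_
  rintro ⟨i, j⟩ ⟨d, hd, hle⟩
  obtain ⟨d1, h1, d2, h2, rfl⟩ := mem_support_mul hd
  rw [map_add] at hle
  exact ⟨⟨d1, h1, by omega⟩, ⟨d2, h2, by omega⟩⟩

theorem LocFin.unit (q : MvPolynomial (Fin n) ℂ) : LocFin fun _ : Unit => q :=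
  fun _ => Set.toFinite _

theorem LocFin.aeval {m : ℕ} {h : I → MvPolynomial (Fin n) ℂ} (hh : LocFin h)
    {y : Fin n → MvPolynomial (Fin m) ℂ} (hy : ∀ j, (y j).IsHomogeneous 1) :
    LocFin fun i => MvPolynomial.aeval y (h i) := by
  refine hh.of_degree 0 fun i d' hd' => ?_
  rw [MvPolynomial.aeval_def, MvPolynomial.eval₂_eq, MvPolynomial.mem_support_iff,
    MvPolynomial.coeff_sum] at hd'
  obtain ⟨d, hd, hne⟩ := Finset.exists_ne_zero_of_sum_ne_zero hd'
  refine ⟨d, hd, ?_⟩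
  have hom : (∏ j ∈ d.support, y j ^ d j).IsHomogeneous (∑ j ∈ d.support, 1 * d j) :=
    MvPolynomial.IsHomogeneous.prod _ _ _ fun j _ => (hy j).pow _
  rw [MvPolynomial.algebraMap_eq, MvPolynomial.coeff_C_mul] at hne
  have := hom.coeff_eq_zero (d := d')
  by_contra hc
  refine hne ?_
  have hs : d.degree = ∑ j ∈ d.support, d j := rfl
  rw [this (by simp only [one_mul]; omega), mul_zero]

end

section

variable {n : ℕ}

/-- The action of the power series `∑ h i` in the translations `x` on a family. -/
abbrev ser (x : Fin n → G) (h : I → MvPolynomial (Fin n) ℂ) (E : G → V) : G → V :=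
  psA (fun i => ev x (h i)) E

/-- The span of the images of the elements of `𝒮` under power series in the translations `x`. -/
def SerSpan (x : Fin n → G) (𝒮 : Set (W → G → V)) : Submodule ℂ (W → G → V) :=
  Submodule.span ℂ {Φ | ∃ (I : Type) (h : I → MvPolynomial (Fin n) ℂ), LocFin h ∧
    ∃ E ∈ 𝒮, Φ = fun w => ser x h (E w)}

variable {x : Fin n → G} {𝒮 𝒮' : Set (W → G → V)} {Φ : W → G → V}

theorem SerSpan.induction {p : (W → G → V) → Prop} (hΦ : Φ ∈ SerSpan x 𝒮)
    (gen : ∀ (I : Type) (h : I → MvPolynomial (Fin n) ℂ), LocFin h → ∀ E ∈ 𝒮,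
      p fun w => ser x h (E w))
    (zero : p 0) (add : ∀ Φ Ψ, p Φ → p Ψ → p (Φ + Ψ)) (smul : ∀ (c : ℂ) Φ, p Φ → p (c • Φ)) :
    p Φ := by
  refine Submodule.span_induction (p := fun Φ _ => p Φ) ?_ zero (fun Φ Ψ _ _ => add Φ Ψ)
    (fun c Φ _ => smul c Φ) hΦ
  rintro Φ ⟨I, h, hh, E, hE, rfl⟩
  exact gen I h hh E hE

theorem ser_mem {h : I → MvPolynomial (Fin n) ℂ} (hh : LocFin h) {E : W → G → V} (hE : E ∈ 𝒮) :
    (fun w => ser x h (E w)) ∈ SerSpan x 𝒮 :=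
  Submodule.subset_span ⟨I, h, hh, E, hE, rfl⟩

theorem ser_unit (q : MvPolynomial (Fin n) ℂ) (E : G → V) :
    ser x (fun _ : Unit => q) E = act (ev x q) E := psA_unit _ _

theorem ser_add {h : I → MvPolynomial (Fin n) ℂ} (hh : LocFin h) {E E' : G → V}
    (hE : LowDeg x E) (hE' : LowDeg x E') : ser x h (E + E') = ser x h E + ser x h E' :=
  psA_add (hh.pf hE) (hh.pf hE')

theorem act_ser {h : I → MvPolynomial (Fin n) ℂ} (hh : LocFin h) {E : G → V}
    (hE : LowDeg x E) (q : AddMonoidAlgebra ℂ G) : act q (ser x h E) = ser x h (act q E) :=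
  act_psA (hh.pf hE) q

theorem ser_ser {h : I → MvPolynomial (Fin n) ℂ} (hh : LocFin h)
    {h' : J → MvPolynomial (Fin n) ℂ} (hh' : LocFin h') {E : G → V} (hE : LowDeg x E) :
    ser x h (ser x h' E) = ser x (fun ij : I × J => h ij.1 * h' ij.2) E := by
  have e : ∀ ij : I × J, ev x (h ij.1 * h' ij.2) = ev x (h ij.1) * ev x (h' ij.2) :=
    fun ij => map_mul (ev x) _ _
  have hpf := (hh.mul hh').pf hE
  unfold ser
  simp only [e] at hpf ⊢
  exact psA_psA (hh'.pf hE) hpf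

theorem subset_serSpan : 𝒮 ⊆ SerSpan x 𝒮 := by
  intro E hE
  have := ser_mem (x := x) (LocFin.unit (1 : MvPolynomial (Fin n) ℂ)) hE
  have e : (fun w => ser x (fun _ : Unit => (1 : MvPolynomial (Fin n) ℂ)) (E w)) = E := by
    funext w
    rw [ser_unit, map_one, act_one]
  rwa [e] at this

theorem SerSpan.ser_mem (h𝒮 : ∀ E ∈ 𝒮, ∀ w, LowDeg x (E w)) (hΦ : Φ ∈ SerSpan x 𝒮)
    {h : I → MvPolynomial (Fin n) ℂ} (hh : LocFin h) :
    (fun w => ser x h (Φ w)) ∈ SerSpan x 𝒮 := by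
  have := SerSpan.induction hΦ
    (p := fun Φ => (∀ w, LowDeg x (Φ w)) ∧ (fun w => ser x h (Φ w)) ∈ SerSpan x 𝒮)
  refine (this ?_ ?_ ?_ ?_).2
  · intro J h' hh' E hE
    refine ⟨fun w => (h𝒮 E hE w).dom (dom_psA x h' (E w)), ?_⟩
    simp only [fun w => ser_ser hh hh' (h𝒮 E hE w)]
    exact NVA.ser_mem (hh.mul hh') hE
  · refine ⟨fun _ => LowDeg.zero, ?_⟩
    simp only [Pi.zero_apply, ser, psA_zero]
    exact Submodule.zero_mem _
  · rintro Φ Ψ ⟨h1, h2⟩ ⟨h3, h4⟩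
    refine ⟨fun w => (h1 w).add (h3 w), ?_⟩
    simp only [Pi.add_apply, fun w => ser_add hh (h1 w) (h3 w)]
    exact Submodule.add_mem _ h2 h4
  · rintro c Φ ⟨h1, h2⟩
    refine ⟨fun w => (h1 w).smul c, ?_⟩
    simp only [Pi.smul_apply, ser, psA_smul]
    exact Submodule.smul_mem _ c h2

theorem SerSpan.act_mem (h𝒮 : ∀ E ∈ 𝒮, ∀ w, LowDeg x (E w)) (hΦ : Φ ∈ SerSpan x 𝒮)
    (q : MvPolynomial (Fin n) ℂ) : (fun w => act (ev x q) (Φ w)) ∈ SerSpan x 𝒮 := by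
  simpa only [ser_unit] using SerSpan.ser_mem h𝒮 hΦ (LocFin.unit q)

theorem SerSpan.mono (h : 𝒮 ⊆ 𝒮') : SerSpan x 𝒮 ≤ SerSpan x 𝒮' := by
  refine Submodule.span_mono ?_
  rintro _ ⟨I, f, hf, E, hE, rfl⟩
  exact ⟨I, f, hf, E, h hE, rfl⟩

theorem SerSpan.exists_denom (h𝒮 : ∀ E ∈ 𝒮, ∀ w, LowDeg x (E w))
    (h𝒮' : ∀ E ∈ 𝒮', ∀ w, LowDeg x (E w)) {m : ℕ}
    (M : Submonoid (MvPolynomial (Fin m) ℂ))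
    (ρ : MvPolynomial (Fin m) ℂ →ₐ[ℂ] MvPolynomial (Fin n) ℂ)
    (H : ∀ E ∈ 𝒮, ∃ Q ∈ M, (fun w => act (ev x (ρ Q)) (E w)) ∈ SerSpan x 𝒮')
    (hΦ : Φ ∈ SerSpan x 𝒮) :
    ∃ Q ∈ M, (fun w => act (ev x (ρ Q)) (Φ w)) ∈ SerSpan x 𝒮' := by
  refine SerSpan.induction hΦ
    (p := fun Φ => ∃ Q ∈ M, (fun w => act (ev x (ρ Q)) (Φ w)) ∈ SerSpan x 𝒮') ?_ ?_ ?_ ?_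
  · intro I h hh E hE
    obtain ⟨Q, hQ, hmem⟩ := H E hE
    refine ⟨Q, hQ, ?_⟩
    simp only [fun w => act_ser hh (h𝒮 E hE w)]
    exact SerSpan.ser_mem h𝒮' hmem hh
  · refine ⟨1, M.one_mem, ?_⟩
    simp only [Pi.zero_apply, map_zero]
    exact Submodule.zero_mem _
  · rintro Φ Ψ ⟨Q, hQ, h1⟩ ⟨Q', hQ', h2⟩
    refine ⟨Q * Q', M.mul_mem hQ hQ', ?_⟩
    have e1 : (fun w => act (ev x (ρ (Q * Q'))) ((Φ + Ψ) w)) =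
        (fun w => act (ev x (ρ Q')) (act (ev x (ρ Q)) (Φ w))) +
          fun w => act (ev x (ρ Q)) (act (ev x (ρ Q')) (Ψ w)) := by
      funext w
      rw [Pi.add_apply, Pi.add_apply, map_add (act _), map_mul ρ, map_mul (ev x), act_mul,
        act_mul, act_comm (ev x (ρ Q)) _ (Φ w)]
    rw [e1]
    exact Submodule.add_mem _ (SerSpan.act_mem h𝒮' h1 _) (SerSpan.act_mem h𝒮' h2 _)
  · rintro c Φ ⟨Q, hQ, h1⟩
    refine ⟨Q, hQ, ?_⟩
    simp only [Pi.smul_apply, map_smul]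
    exact Submodule.smul_mem _ c h1

/-- The family in one more variable whose slices along `σ` are `φ s (Φ (ψ s w) ·)`. -/
def lift (σ : (ℤ × ℤ) × ℤ ≃+ G) (φ : ℤ → V →ₗ[ℂ] V') (ψ : ℤ → W → W) (Φ : W → ℤ × ℤ → V) :
    W → G → V' :=
  fun w g => φ (σ.symm g).2 (Φ (ψ (σ.symm g).2 w) (σ.symm g).1)

theorem lift_act (σ : (ℤ × ℤ) × ℤ ≃+ G) (φ : ℤ → V →ₗ[ℂ] V') (ψ : ℤ → W → W)
    (Φ : W → ℤ × ℤ → V) (f : AddMonoidAlgebra ℂ (ℤ × ℤ)) (w : W) :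
    lift σ φ ψ (fun w => act f (Φ w)) w = act (up σ f) (lift σ φ ψ Φ w) := by
  refine slice_ext σ fun s => ?_
  rw [slice_act_up]
  have : ∀ Φ : W → ℤ × ℤ → V, slice σ (lift σ φ ψ Φ w) s = fun g => φ s (Φ (ψ s w) g) := by
    intro Φ
    funext g
    simp [slice, lift]
  rw [this, this, act_map]

theorem up_ev (σ : (ℤ × ℤ) × ℤ ≃+ G) {m : ℕ} (y : Fin m → ℤ × ℤ) (x : Fin n → G)
    (ι : Fin m → Fin n) (hι : ∀ i, x (ι i) = σ (y i, 0)) (p : MvPolynomial (Fin m) ℂ) :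
    up σ (ev y p) = ev x (MvPolynomial.rename ι p) := by
  rw [ev, ev, MvPolynomial.aeval_rename, ← AlgHom.comp_apply]
  congr 1
  refine MvPolynomial.algHom_ext fun i => ?_
  simp [up_single, hι]

theorem LocFin.rename {m : ℕ} {h : I → MvPolynomial (Fin m) ℂ} (hh : LocFin h)
    (ι : Fin m → Fin n) : LocFin fun i => MvPolynomial.rename ι (h i) := by
  have e : (MvPolynomial.rename ι : MvPolynomial (Fin m) ℂ →ₐ[ℂ] MvPolynomial (Fin n) ℂ) =
      MvPolynomial.aeval fun j => MvPolynomial.X (ι j) :=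
    MvPolynomial.algHom_ext fun i => by simp
  rw [e]
  exact hh.aeval fun j => MvPolynomial.isHomogeneous_X ℂ _

theorem lift_mem (σ : (ℤ × ℤ) × ℤ ≃+ G) (φ : ℤ → V →ₗ[ℂ] V') (ψ : ℤ → W → W) {m : ℕ}
    {y : Fin m → ℤ × ℤ} {x : Fin n → G} (ι : Fin m → Fin n) (hι : ∀ i, x (ι i) = σ (y i, 0))
    {𝒮 : Set (W → ℤ × ℤ → V)} {𝒮' : Set (W → G → V')}
    (h𝒮 : ∀ E ∈ 𝒮, ∀ w, LowDeg y (E w)) (H : ∀ E ∈ 𝒮, lift σ φ ψ E ∈ 𝒮')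
    {Φ : W → ℤ × ℤ → V} (hΦ : Φ ∈ SerSpan y 𝒮) : lift σ φ ψ Φ ∈ SerSpan x 𝒮' := by
  refine SerSpan.induction hΦ (p := fun Φ => lift σ φ ψ Φ ∈ SerSpan x 𝒮') ?_ ?_ ?_ ?_
  · intro I h hh E hE
    have e : lift σ φ ψ (fun w => ser y h (E w)) =
        fun w => ser x (fun i => MvPolynomial.rename ι (h i)) (lift σ φ ψ E w) := by
      funext w g
      have h1 : ∀ i, act (ev x (MvPolynomial.rename ι (h i))) (lift σ φ ψ E w) g =
          φ (σ.symm g).2 (act (ev y (h i)) (E (ψ (σ.symm g).2 w)) (σ.symm g).1) := by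
        intro i
        rw [← up_ev σ y x ι hι, ← lift_act]
        rfl
      simp only [psA, h1]
      exact (φ (σ.symm g).2).toAddMonoidHom.map_finsum ((hh.pf (h𝒮 E hE _)) _)
    rw [e]
    exact NVA.ser_mem (hh.rename ι) (H E hE)
  · have : lift σ φ ψ (0 : W → ℤ × ℤ → V) = 0 := by
      funext w g
      simp [lift]
    rw [this]
    exact Submodule.zero_mem _
  · intro Φ Ψ h1 h2
    have : lift σ φ ψ (Φ + Ψ) = lift σ φ ψ Φ + lift σ φ ψ Ψ := by
      funext w g
      simp [lift]
    rw [this]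
    exact Submodule.add_mem _ h1 h2
  · intro c Φ h1
    have : lift σ φ ψ (c • Φ) = c • lift σ φ ψ Φ := by
      funext w g
      simp [lift]
    rw [this]
    exact Submodule.smul_mem _ c h1

end

/-! ### Families of two and three fields -/

/-- The generators of `ℤ × ℤ`. -/
abbrev x2 : Fin 2 → ℤ × ℤ := ![(1, 0), (0, 1)]

/-- The generators of `ℤ × ℤ × ℤ`. -/
abbrev x3 : Fin 3 → ℤ × ℤ × ℤ := ![(1, 0, 0), (0, 1, 0), (0, 0, 1)]

theorem pe_eq_ev (p : MvPolynomial (Fin 2) ℂ) : pe p = ev x2 p := by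
  rw [pe, vec2_tr]

theorem aeval_tXYZ (p : MvPolynomial (Fin 3) ℂ) :
    MvPolynomial.aeval ![tX, tY, tZ] p = ev x3 p := by
  rw [vec3_tr]

/-- Vanishing, on each lower orthant, outside of a finite square. -/
def BD2 (E : ℤ × ℤ → V) : Prop :=
  ∀ i₀ k₀ : ℤ, ∃ N : ℤ, ∀ i k : ℤ, i ≤ i₀ → k ≤ k₀ → (i < N ∨ k < N) → E (i, k) = 0

/-- Vanishing, on each lower orthant, outside of a finite box. -/
def BD3 (E : ℤ × ℤ × ℤ → V) : Prop :=
  ∀ i₀ j₀ k₀ : ℤ, ∃ N : ℤ, ∀ i j k : ℤ, i ≤ i₀ → j ≤ j₀ → k ≤ k₀ → (i < N ∨ j < N ∨ k < N) →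
    E (i, j, k) = 0

theorem BD2.lowDeg {E : ℤ × ℤ → V} (h : BD2 E) : LowDeg x2 E := by
  rintro ⟨i, k⟩
  obtain ⟨N, hN⟩ := h i k
  refine ⟨(i - N).toNat + (k - N).toNat, fun d hd => ?_⟩
  rw [Finsupp.degree_eq_sum, Fin.sum_univ_two] at hd
  have : ((i, k) - ∑ j, d j • x2 j : ℤ × ℤ) = (i - d 0, k - d 1) := by
    ext <;> simp
  rw [this]
  exact hN _ _ (by omega) (by omega) (by omega)

theorem BD3.lowDeg {E : ℤ × ℤ × ℤ → V} (h : BD3 E) : LowDeg x3 E := by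
  rintro ⟨i, j, k⟩
  obtain ⟨N, hN⟩ := h i j k
  refine ⟨(i - N).toNat + (j - N).toNat + (k - N).toNat, fun d hd => ?_⟩
  rw [Finsupp.degree_eq_sum, Fin.sum_univ_three] at hd
  have : ((i, j, k) - ∑ l, d l • x3 l : ℤ × ℤ × ℤ) = (i - d 0, j - d 1, k - d 2) := by
    rw [Fin.sum_univ_three]
    ext <;> simp
  rw [this]
  exact hN _ _ _ (by omega) (by omega) (by omega) (by omega)

theorem exists_uniform_bound {P : ℤ → ℤ → Prop} (h : ∀ i, ∃ N : ℤ, ∀ j < N, P i j) (A B : ℤ) :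
    ∃ N : ℤ, ∀ i, A ≤ i → i ≤ B → ∀ j < N, P i j := by
  choose N hN using h
  obtain ⟨K, hK⟩ : ∃ K : ℤ, ∀ i ∈ Finset.Icc A B, K ≤ N i := by
    obtain ⟨K, hK⟩ := ((Finset.Icc A B).image N).bddBelow
    exact ⟨K, fun i hi => hK (Finset.mem_coe.2 (Finset.mem_image_of_mem N hi))⟩
  exact ⟨K, fun i h1 h2 j hj => hN i j (lt_of_lt_of_le hj (hK i (Finset.mem_Icc.2 ⟨h1, h2⟩)))⟩

/-- The mode operator of `c` on the left for `false`, and nothing for `true`. -/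
def phi : Bool → EW W → ℤ → W →ₗ[ℂ] W
  | true, _, _ => LinearMap.id
  | false, c, k => md c (-k - 1)

/-- The mode operator of `c` applied to `w` for `true`, and `w` for `false`. -/
def omega : Bool → EW W → W → ℤ → W
  | true, c, w, k => mf c w (-k - 1)
  | false, _, w, _ => w

/-- The coefficients of `e(x₁)c(x₂)w` for `true` and of `c(x₂)e(x₁)w` for `false`. -/
def Xf (s : Bool) (e c : EW W) (w : W) : ℤ × ℤ → W :=
  fun g => phi s c g.2 (mf e (omega s c w g.2) (-g.1 - 1))

/-- The coefficients of `a(x₁)b(x₂)c(x₃)w` for `true` and of `c(x₃)a(x₁)b(x₂)w` for `false`. -/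
def X3 (s : Bool) (a b c : EW W) (w : W) : ℤ × ℤ × ℤ → W :=
  fun g => phi s c g.2.2 (FabP a b (omega s c w g.2.2) (g.1, g.2.1))

/-- The coefficients of `(Y_ℰ(a(x), x₀)b(x)) c(x₃)w` for `true`, and with `c(x₃)` on the left
for `false`. -/
def Y3 (s : Bool) (a b c : EW W) (w : W) : ℤ × ℤ × ℤ → W :=
  fun g => phi s c g.2.2 (Yfam a b (omega s c w g.2.2) (g.1, g.2.1))

theorem Y3_apply (s : Bool) (a b c : EW W) (w : W) (i j k : ℤ) :
    Y3 s a b c w (i, j, k) = Xf s (YE a b (-i - 1)) c w (j, k) := rfl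

theorem Xf_swap (s : Bool) (e c : EW W) (w : W) (i k : ℤ) :
    Xf s e c w (i, k) = Xf (!s) c e w (k, i) := by
  cases s <;> rfl

theorem Xf_bd (s : Bool) (e c : EW W) (w : W) : BD2 (Xf s e c w) := by
  have key : ∀ e c : EW W, BD2 (Xf true e c w) := by
    intro e c i₀ k₀
    obtain ⟨N, hN⟩ := mf_bdd c w
    obtain ⟨K, hK⟩ := exists_uniform_bound (P := fun k i => Xf true e c w (i, k) = 0)
      (fun k => mf_bdd e (mf c w (-k - 1))) N k₀
    refine ⟨min N K, fun i k _ hk h => ?_⟩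
    rcases lt_or_ge k N with hkN | hkN
    · have : mf c w (-k - 1) = 0 := hN k hkN
      change md e (-i - 1) (mf c w (-k - 1)) = 0
      rw [this, map_zero]
    · exact hK k hkN hk i (by omega)
  cases s
  · intro i₀ k₀
    obtain ⟨N, hN⟩ := key c e k₀ i₀
    exact ⟨N, fun i k hi hk h => (Xf_swap false e c w i k).trans (hN k i hk hi h.symm)⟩
  · exact key e c

/-- Application of the modes of `a` in the first variable to families in the other two. -/
def lift23 (a : EW W) (Φ : W → ℤ × ℤ → W) : W → ℤ × ℤ × ℤ → W :=
  lift σ23 (fun i => md a (-i - 1)) (fun _ w => w) Φ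

/-- Substitution of the modes of `b`, in the second variable, in the vector of a family in the
other two. -/
def lift13 (b : EW W) (Φ : W → ℤ × ℤ → W) : W → ℤ × ℤ × ℤ → W :=
  lift σ13 (fun _ => LinearMap.id) (fun j w => mf b w (-j - 1)) Φ

theorem lift23_bd (a : EW W) {Φ : W → ℤ × ℤ → W} (h : ∀ w, BD2 (Φ w)) (w : W) :
    BD3 (lift23 a Φ w) := by
  intro i₀ j₀ k₀
  obtain ⟨N, hN⟩ := h w j₀ k₀
  have h1 : ∀ k : ℤ, ∃ K : ℤ, ∀ i < K, ∀ j, N ≤ j → j ≤ j₀ → lift23 a Φ w (i, j, k) = 0 := by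
    intro k
    obtain ⟨K, hK⟩ := exists_uniform_bound (P := fun j i => lift23 a Φ w (i, j, k) = 0)
      (fun j => mf_bdd a (Φ w (j, k))) N j₀
    exact ⟨K, fun i hi j h1 h2 => hK j h1 h2 i hi⟩
  obtain ⟨K, hK⟩ := exists_uniform_bound h1 N k₀
  refine ⟨min N K, fun i j k _ hj hk hlt => ?_⟩
  by_cases hc : j < N ∨ k < N
  · change md a (-i - 1) (Φ w (j, k)) = 0
    rw [hN j k hj hk hc, map_zero]
  · exact hK k (by omega) hk i (by omega) j (by omega) hj

theorem lift13_bd (b : EW W) {Φ : W → ℤ × ℤ → W} (h : ∀ w, BD2 (Φ w)) (h0 : Φ 0 = 0) (w : W) :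
    BD3 (lift13 b Φ w) := by
  intro i₀ j₀ k₀
  obtain ⟨N, hN⟩ := mf_bdd b w
  have h1 : ∀ j : ℤ, ∃ K : ℤ, ∀ l < K, ∀ i k : ℤ, i ≤ i₀ → k ≤ k₀ → (i ≤ l ∨ k ≤ l) →
      lift13 b Φ w (i, j, k) = 0 := by
    intro j
    obtain ⟨K, hK⟩ := h (mf b w (-j - 1)) i₀ k₀
    exact ⟨K, fun l hl i k hi hk hlt => hK i k hi hk (by omega)⟩
  obtain ⟨K, hK⟩ := exists_uniform_bound h1 N j₀
  refine ⟨min N K, fun i j k hi hj hk hlt => ?_⟩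
  rcases lt_or_ge j N with hc | hc
  · change Φ (mf b w (-j - 1)) (i, k) = 0
    rw [hN j hc, h0]
    rfl
  · exact hK j hc hj (K - 1) (by omega) i k hi hk (by omega)

theorem Xf_zero_right (s : Bool) (e c : EW W) : Xf s e c 0 = 0 := by
  funext g
  cases s
  · exact congrArg (md c _) (map_zero (md e _)) |>.trans (map_zero _)
  · exact congrArg (md e _) (map_zero (md c _)) |>.trans (map_zero _)

/-- The families of products of two fields. -/
def GX (s : Bool) (A C : Set (EW W)) : Set (W → ℤ × ℤ → W) :=
  {Φ | ∃ a ∈ A, ∃ c ∈ C, Φ = Xf s a c}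

theorem GX_lowDeg {s : Bool} {A C : Set (EW W)} : ∀ E ∈ GX s A C, ∀ w, LowDeg x2 (E w) := by
  rintro _ ⟨a, _, c, _, rfl⟩ w
  exact (Xf_bd s a c w).lowDeg

/-- Commutation up to series, with denominators in `M`. -/
def Loc (M : Submonoid (MvPolynomial (Fin 2) ℂ)) (s : Bool) (A C : Set (EW W)) : Prop :=
  ∀ a ∈ A, ∀ c ∈ C, ∃ Q ∈ M, (fun w => act (ev x2 Q) (Xf s a c w)) ∈ SerSpan x2 (GX (!s) A C)

theorem lift23_mem (a : EW W) {s : Bool} {A C : Set (EW W)} {Φ : W → ℤ × ℤ → W}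
    (hΦ : Φ ∈ SerSpan x2 (GX s A C)) {𝒮 : Set (W → ℤ × ℤ × ℤ → W)}
    (H : ∀ b ∈ A, ∀ c ∈ C, lift23 a (Xf s b c) ∈ 𝒮) : lift23 a Φ ∈ SerSpan x3 𝒮 := by
  refine lift_mem σ23 _ _ ![1, 2] (fun i => ?_) GX_lowDeg ?_ hΦ
  · fin_cases i <;> rfl
  · rintro _ ⟨b, hb, c, hc, rfl⟩
    exact H b hb c hc

theorem lift13_mem (b : EW W) {s : Bool} {A C : Set (EW W)} {Φ : W → ℤ × ℤ → W}
    (hΦ : Φ ∈ SerSpan x2 (GX s A C)) {𝒮 : Set (W → ℤ × ℤ × ℤ → W)}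
    (H : ∀ a ∈ A, ∀ c ∈ C, lift13 b (Xf s a c) ∈ 𝒮) : lift13 b Φ ∈ SerSpan x3 𝒮 := by
  refine lift_mem σ13 _ _ ![0, 2] (fun i => ?_) GX_lowDeg ?_ hΦ
  · fin_cases i <;> rfl
  · rintro _ ⟨b, hb, c, hc, rfl⟩
    exact H b hb c hc

theorem lift23_act (a : EW W) (Φ : W → ℤ × ℤ → W) (Q : MvPolynomial (Fin 2) ℂ) (w : W) :
    lift23 a (fun w => act (ev x2 Q) (Φ w)) w =
      act (ev x3 (MvPolynomial.rename ![1, 2] Q)) (lift23 a Φ w) := by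
  rw [← up_ev σ23 x2 x3 ![1, 2] (fun i => by fin_cases i <;> rfl)]
  exact lift_act _ _ _ _ _ _

theorem lift13_act (b : EW W) (Φ : W → ℤ × ℤ → W) (Q : MvPolynomial (Fin 2) ℂ) (w : W) :
    lift13 b (fun w => act (ev x2 Q) (Φ w)) w =
      act (ev x3 (MvPolynomial.rename ![0, 2] Q)) (lift13 b Φ w) := by
  rw [← up_ev σ13 x2 x3 ![0, 2] (fun i => by fin_cases i <;> rfl)]
  exact lift_act _ _ _ _ _ _

/-- The families of products of three fields. -/
def G3 (s : Bool) (A C : Set (EW W)) : Set (W → ℤ × ℤ × ℤ → W) :=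
  {Φ | ∃ a ∈ A, ∃ b ∈ A, ∃ c ∈ C, Φ = X3 s a b c}

theorem X3_bd (s : Bool) (a b c : EW W) (w : W) : BD3 (X3 s a b c w) := by
  cases s
  · exact lift13_bd b (Xf_bd false a c) (Xf_zero_right _ _ _) w
  · exact lift23_bd a (Xf_bd true b c) w

theorem G3_lowDeg {s : Bool} {A C : Set (EW W)} : ∀ E ∈ G3 s A C, ∀ w, LowDeg x3 (E w) := by
  rintro _ ⟨a, _, b, _, c, _, rfl⟩ w
  exact (X3_bd s a b c w).lowDeg

theorem Loc.exists_X3 {M : Submonoid (MvPolynomial (Fin 2) ℂ)} {s : Bool} {A C : Set (EW W)}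
    (h : Loc M s A C) {a b c : EW W} (ha : a ∈ A) (hb : b ∈ A) (hc : c ∈ C) :
    ∃ Q ∈ M, ∃ Q' ∈ M, (fun w => act (ev x3 (MvPolynomial.rename ![1, 2] Q *
      MvPolynomial.rename ![0, 2] Q')) (X3 s a b c w)) ∈ SerSpan x3 (G3 (!s) A C) := by
  cases s
  · obtain ⟨Q', hQ', h1⟩ := h a ha c hc
    let 𝒮 : Set (W → ℤ × ℤ × ℤ → W) :=
      {Φ | ∃ a' ∈ A, ∃ c' ∈ C, Φ = lift23 a' (Xf false b c')}
    have h2 := lift13_mem b h1 (𝒮 := 𝒮) fun a' ha' c' hc' => ⟨a', ha', c', hc', rfl⟩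
    have hlow : ∀ E ∈ 𝒮, ∀ w, LowDeg x3 (E w) := by
      rintro _ ⟨a', _, c', _, rfl⟩ w
      exact (lift23_bd a' (Xf_bd false b c') w).lowDeg
    have hden : ∀ E ∈ 𝒮, ∃ Q ∈ M,
        (fun w => act (ev x3 (MvPolynomial.rename ![1, 2] Q)) (E w)) ∈
          SerSpan x3 (G3 true A C) := by
      rintro _ ⟨a', ha', c', hc', rfl⟩
      obtain ⟨Q, hQ, h4⟩ := h b hb c' hc'
      refine ⟨Q, hQ, ?_⟩
      simp only [← lift23_act]
      exact lift23_mem a' h4 fun b' hb' c'' hc'' => ⟨a', ha', b', hb', c'', hc'', rfl⟩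
    rw [funext fun w => lift13_act b (Xf false a c) Q' w] at h2
    obtain ⟨Q, hQ, h3⟩ := SerSpan.exists_denom hlow G3_lowDeg M _ hden h2
    refine ⟨Q, hQ, Q', hQ', ?_⟩
    simp only [map_mul (ev x3), act_mul]
    exact h3
  · obtain ⟨Q, hQ, h1⟩ := h b hb c hc
    let 𝒮 : Set (W → ℤ × ℤ × ℤ → W) :=
      {Φ | ∃ b' ∈ A, ∃ c' ∈ C, Φ = lift13 b' (Xf true a c')}
    have h2 := lift23_mem a h1 (𝒮 := 𝒮) fun b' hb' c' hc' => ⟨b', hb', c', hc', rfl⟩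
    have hlow : ∀ E ∈ 𝒮, ∀ w, LowDeg x3 (E w) := by
      rintro _ ⟨b', _, c', _, rfl⟩ w
      exact (lift13_bd b' (Xf_bd true a c') (Xf_zero_right _ _ _) w).lowDeg
    have hden : ∀ E ∈ 𝒮, ∃ Q ∈ M,
        (fun w => act (ev x3 (MvPolynomial.rename ![0, 2] Q)) (E w)) ∈
          SerSpan x3 (G3 false A C) := by
      rintro _ ⟨b', hb', c', hc', rfl⟩
      obtain ⟨Q, hQ, h4⟩ := h a ha c' hc'
      refine ⟨Q, hQ, ?_⟩
      simp only [← lift13_act]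
      exact lift13_mem b' h4 fun a' ha' c'' hc'' => ⟨a', ha', b', hb', c'', hc'', rfl⟩
    rw [funext fun w => lift23_act a (Xf true b c) Q w] at h2
    obtain ⟨Q', hQ', h3⟩ := SerSpan.exists_denom hlow G3_lowDeg M _ hden h2
    refine ⟨Q, hQ, Q', hQ', ?_⟩
    rw [mul_comm]
    simp only [map_mul (ev x3), act_mul]
    exact h3

section

/-! ### Substitution in series of three fields -/

/-- The support condition on three-variable families under which `x₁ = x₂ + x₀` can be
substituted. -/
def Lst (F : ℤ × ℤ × ℤ → V) : Prop :=
  (∀ k₀ : ℤ, ∃ N : ℤ, ∀ i j k : ℤ, k ≤ k₀ → (i < N ∨ j < N) → F (i, j, k) = 0) ∧ BD3 F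

/-- The support condition satisfied by the results of the substitution `x₁ = x₂ + x₀`. -/
def Nst (Y : ℤ × ℤ × ℤ → V) : Prop :=
  (∃ K : ℤ, ∀ i j k : ℤ, i < K → Y (i, j, k) = 0) ∧ BD3 Y

theorem Dom.exists_le {E E' : ℤ × ℤ × ℤ → V} (h : Dom x3 E' E) {i j k : ℤ}
    (hne : E' (i, j, k) ≠ 0) : ∃ i' j' k' : ℤ, i' ≤ i ∧ j' ≤ j ∧ k' ≤ k ∧ E (i', j', k') ≠ 0 := by
  obtain ⟨d, hd⟩ := h _ hne
  have : ((i, j, k) - ∑ l, d l • x3 l : ℤ × ℤ × ℤ) = (i - d 0, j - d 1, k - d 2) := by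
    rw [Fin.sum_univ_three]
    ext <;> simp
  rw [this] at hd
  exact ⟨_, _, _, by omega, by omega, by omega, hd⟩

theorem BD3.dom {E E' : ℤ × ℤ × ℤ → V} (hE : BD3 E) (h : Dom x3 E' E) : BD3 E' := by
  intro i₀ j₀ k₀
  obtain ⟨N, hN⟩ := hE i₀ j₀ k₀
  refine ⟨N, fun i j k hi hj hk hlt => ?_⟩
  by_contra hne
  obtain ⟨i', j', k', h1, h2, h3, h4⟩ := h.exists_le hne
  exact h4 (hN _ _ _ (by omega) (by omega) (by omega) (by omega))

theorem Lst.dom {E E' : ℤ × ℤ × ℤ → V} (hE : Lst E) (h : Dom x3 E' E) : Lst E' := by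
  refine ⟨fun k₀ => ?_, hE.2.dom h⟩
  obtain ⟨N, hN⟩ := hE.1 k₀
  refine ⟨N, fun i j k hk hlt => ?_⟩
  by_contra hne
  obtain ⟨i', j', k', h1, h2, h3, h4⟩ := h.exists_le hne
  exact h4 (hN _ _ _ (by omega) (by omega))

theorem Nst.dom {E E' : ℤ × ℤ × ℤ → V} (hE : Nst E) (h : Dom x3 E' E) : Nst E' := by
  obtain ⟨⟨K, hK⟩, h0⟩ := hE
  refine ⟨⟨K, fun i j k hlt => ?_⟩, h0.dom h⟩
  by_contra hne
  obtain ⟨i', j', k', h1, h2, h3, h4⟩ := h.exists_le hne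
  exact h4 (hK _ _ _ (by omega))

theorem BD3.add {E E' : ℤ × ℤ × ℤ → V} (h : BD3 E) (h' : BD3 E') : BD3 (E + E') := by
  intro i₀ j₀ k₀
  obtain ⟨N, hN⟩ := h i₀ j₀ k₀
  obtain ⟨N', hN'⟩ := h' i₀ j₀ k₀
  refine ⟨min N N', fun i j k hi hj hk hlt => ?_⟩
  rw [Pi.add_apply, hN i j k hi hj hk (by omega), hN' i j k hi hj hk (by omega), add_zero]

theorem Lst.add {E E' : ℤ × ℤ × ℤ → V} (h : Lst E) (h' : Lst E') : Lst (E + E') := by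
  refine ⟨fun k₀ => ?_, h.2.add h'.2⟩
  obtain ⟨N, hN⟩ := h.1 k₀
  obtain ⟨N', hN'⟩ := h'.1 k₀
  refine ⟨min N N', fun i j k hk hlt => ?_⟩
  rw [Pi.add_apply, hN i j k hk (by omega), hN' i j k hk (by omega), add_zero]

theorem Nst.add {E E' : ℤ × ℤ × ℤ → V} (h : Nst E) (h' : Nst E') : Nst (E + E') := by
  obtain ⟨⟨K, hK⟩, h0⟩ := h
  obtain ⟨⟨K', hK'⟩, h0'⟩ := h'
  refine ⟨⟨min K K', fun i j k hlt => ?_⟩, h0.add h0'⟩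
  rw [Pi.add_apply, hK i j k (by omega), hK' i j k (by omega), add_zero]

theorem dom_smul {n : ℕ} (x : Fin n → G) (c : ℂ) (E : G → V) : Dom x (c • E) E := by
  intro g hg
  refine ⟨0, fun h0 => hg ?_⟩
  have : E g = 0 := by simpa using h0
  rw [Pi.smul_apply, this, smul_zero]

theorem Lst.slice_laurent {F : ℤ × ℤ × ℤ → V} (h : Lst F) (k : ℤ) : Laurent (slice σ12 F k) := by
  obtain ⟨N, hN⟩ := h.1 k
  exact ⟨N, fun i j hlt => hN i j k le_rfl hlt⟩

theorem Nst.slice_nested {F : ℤ × ℤ × ℤ → V} (h : Nst F) (k : ℤ) : Nested2 (slice σ12 F k) := by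
  obtain ⟨⟨K, hK⟩, h0⟩ := h
  refine ⟨⟨K, fun i hi j => hK i j k hi⟩, fun i => ?_⟩
  obtain ⟨N, hN⟩ := h0 i 0 k
  exact ⟨min N 0, fun j hj => hN i j k le_rfl (by omega) le_rfl (by omega)⟩

/-- The polynomial obtained by the substitution `x₁ = x₀ + x₂`. -/
def shear3 : MvPolynomial (Fin 3) ℂ →ₐ[ℂ] MvPolynomial (Fin 3) ℂ :=
  MvPolynomial.aeval ![MvPolynomial.X 0 + MvPolynomial.X 1, MvPolynomial.X 1, MvPolynomial.X 2]

theorem ev_shear3 (p : MvPolynomial (Fin 3) ℂ) :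
    ev x3 (shear3 p) = MvPolynomial.aeval ![tX + tY, tY, tZ] p := by
  rw [shear3, ← AlgHom.comp_apply]
  congr 1
  refine MvPolynomial.algHom_ext fun i => ?_
  fin_cases i <;> simp

theorem LocFin.shear3 {h : I → MvPolynomial (Fin 3) ℂ} (hh : LocFin h) :
    LocFin fun i => shear3 (h i) := by
  refine hh.aeval fun j => ?_
  fin_cases j
  · exact (MvPolynomial.isHomogeneous_X ℂ _).add (MvPolynomial.isHomogeneous_X ℂ _)
  · exact MvPolynomial.isHomogeneous_X ℂ _
  · exact MvPolynomial.isHomogeneous_X ℂ _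

/-- A polynomial in the first two of three variables. -/
abbrev r12 : MvPolynomial (Fin 2) ℂ →ₐ[ℂ] MvPolynomial (Fin 3) ℂ := MvPolynomial.rename ![0, 1]

theorem ev_r12 (p : MvPolynomial (Fin 2) ℂ) : ev x3 (r12 p) = up σ12 (pe p) := by
  rw [pe_eq_ev, up_ev σ12 x2 x3 ![0, 1] fun i => by fin_cases i <;> rfl]

theorem ev_shear3_r12 (p : MvPolynomial (Fin 2) ℂ) : ev x3 (shear3 (r12 p)) = up σ12 (qe p) := by
  rw [qe_eq, ← ev_r12]
  congr 1
  rw [shear, ← AlgHom.comp_apply, ← AlgHom.comp_apply]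
  congr 1
  refine MvPolynomial.algHom_ext fun i => ?_
  fin_cases i <;> simp [NVA.shear3]

theorem subσ_act_ev {F : ℤ × ℤ × ℤ → V} (hF : Lst F) (Q : MvPolynomial (Fin 3) ℂ) :
    subσ σ12 κin (act (ev x3 Q) F) = act (ev x3 (shear3 Q)) (subσ σ12 κin F) := by
  rw [ev_shear3, ← aeval_tXYZ]
  exact subσ_act σ12 κin_pascal Q fun s => (hF.slice_laurent s).SD

theorem subσ_add {F F' : ℤ × ℤ × ℤ → V} (hF : Lst F) (hF' : Lst F') :
    subσ σ12 κin (F + F') = subσ σ12 κin F + subσ σ12 κin F' := by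
  refine slice_ext σ12 fun s => ?_
  have h1 : ∀ F F' : ℤ × ℤ × ℤ → V, slice σ12 (F + F') s = slice σ12 F s + slice σ12 F' s :=
    fun _ _ => rfl
  rw [slice_subσ, h1, h1, sub_add (hF.slice_laurent s).SD (hF'.slice_laurent s).SD, slice_subσ,
    slice_subσ]

theorem subσ_smul (c : ℂ) (F : ℤ × ℤ × ℤ → V) :
    subσ σ12 κin (c • F) = c • subσ σ12 κin F := by
  refine slice_ext σ12 fun s => ?_
  have h1 : ∀ F : ℤ × ℤ × ℤ → V, slice σ12 (c • F) s = c • slice σ12 F s := fun _ => rfl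
  rw [slice_subσ, h1, h1, sub_smul, slice_subσ]

theorem subσ_ser {F : ℤ × ℤ × ℤ → V} (hF : Lst F) {h : I → MvPolynomial (Fin 3) ℂ}
    (hh : LocFin h) :
    subσ σ12 κin (ser x3 h F) = ser x3 (fun i => shear3 (h i)) (subσ σ12 κin F) := by
  funext ⟨i, j, k⟩
  obtain ⟨N, hN⟩ := hF.1 k
  have hz : ∀ l, ∀ m ∉ Finset.Icc N (i + j - N), act (ev x3 (h l)) F (m, i + j - m, k) = 0 := by
    intro l m hm
    by_contra hne
    obtain ⟨i', j', k', h1, h2, h3, h4⟩ := (dom_act x3 (h l) F).exists_le hne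
    rw [Finset.mem_Icc] at hm
    exact h4 (hN _ _ _ h3 (by omega))
  have hpf := hh.pf hF.2.lowDeg
  rw [subσ12_apply, finsum_eq_sum_of_support_subset (s := Finset.Icc N (i + j - N))]
  · simp only [ser, psA, ← subσ_act_ev hF, subσ12_apply]
    have : ∀ l, ∑ᶠ m, κin m i • act (ev x3 (h l)) F (m, i + j - m, k) =
        ∑ m ∈ Finset.Icc N (i + j - N), κin m i • act (ev x3 (h l)) F (m, i + j - m, k) := by
      intro l
      refine finsum_eq_sum_of_support_subset _ fun m hm => ?_
      by_contra hc
      exact hm (by simp only [hz l m (by simpa using hc), smul_zero])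
    rw [finsum_congr this, finsum_sum_comm]
    · exact Finset.sum_congr rfl fun m _ => smul_finsum _ _
    · intro m _
      refine (hpf (m, i + j - m, k)).subset fun l hl h0 => hl ?_
      simp only [h0, smul_zero]
  · intro m hm
    by_contra hc
    refine hm ?_
    simp only [ser, psA, hz _ m (by simpa using hc), finsum_zero, smul_zero]

/-- After multiplication by `p(x₁, x₂)`, the substitution `x₁ = x₂ + x₀` takes `Φ` to the product
of `p(x₂ + x₀, x₂)` and `Ψ`. -/
def SubstP (p : MvPolynomial (Fin 2) ℂ) (Φ Ψ : W → ℤ × ℤ × ℤ → V) : Prop :=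
  ∀ w, Lst (act (ev x3 (r12 p)) (Φ w)) ∧ BD3 (Φ w) ∧ Nst (Ψ w) ∧
    subσ σ12 κin (act (ev x3 (r12 p)) (Φ w)) = act (ev x3 (shear3 (r12 p))) (Ψ w)

variable {Φ Φ' Ψ Ψ' : W → ℤ × ℤ × ℤ → V} {p p' : MvPolynomial (Fin 2) ℂ}

theorem SubstP.mul (h : SubstP p Φ Ψ) (q : MvPolynomial (Fin 2) ℂ) : SubstP (q * p) Φ Ψ := by
  intro w
  obtain ⟨h1, h2, h3, h4⟩ := h w
  simp only [map_mul r12, map_mul (ev x3), map_mul shear3, act_mul]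
  exact ⟨h1.dom (dom_act x3 _ _), h2, h3, by rw [subσ_act_ev h1, h4]⟩

theorem SubstP.add (h : SubstP p Φ Ψ) (h' : SubstP p Φ' Ψ') : SubstP p (Φ + Φ') (Ψ + Ψ') := by
  intro w
  obtain ⟨h1, h2, h3, h4⟩ := h w
  obtain ⟨h1', h2', h3', h4'⟩ := h' w
  rw [Pi.add_apply, Pi.add_apply, map_add (act _), map_add (act _)]
  exact ⟨h1.add h1', h2.add h2', h3.add h3', by rw [subσ_add h1 h1', h4, h4']⟩

theorem SubstP.smul (c : ℂ) (h : SubstP p Φ Ψ) : SubstP p (c • Φ) (c • Ψ) := by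
  intro w
  obtain ⟨h1, h2, h3, h4⟩ := h w
  rw [Pi.smul_apply, Pi.smul_apply, map_smul (act _), map_smul (act _)]
  exact ⟨h1.dom (dom_smul _ _ _), h2.dom (dom_smul _ _ _), h3.dom (dom_smul _ _ _),
    by rw [subσ_smul, h4]⟩

theorem SubstP.ser (h : SubstP p Φ Ψ) {f : I → MvPolynomial (Fin 3) ℂ} (hf : LocFin f) :
    SubstP p (fun w => ser x3 f (Φ w)) (fun w => ser x3 (fun i => shear3 (f i)) (Ψ w)) := by
  intro w
  obtain ⟨h1, h2, h3, h4⟩ := h w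
  rw [act_ser hf h2.lowDeg, act_ser hf.shear3 h3.2.lowDeg, subσ_ser h1 hf, h4]
  exact ⟨h1.dom (dom_psA _ _ _), h2.dom (dom_psA _ _ _), h3.dom (dom_psA _ _ _), rfl⟩

theorem SubstP.zero : SubstP 1 (0 : W → ℤ × ℤ × ℤ → V) 0 := by
  have hB : BD3 (0 : ℤ × ℤ × ℤ → V) := fun _ _ _ => ⟨0, fun _ _ _ _ _ _ _ => rfl⟩
  intro w
  simp only [Pi.zero_apply, map_zero]
  refine ⟨⟨fun _ => ⟨0, fun _ _ _ _ _ => rfl⟩, hB⟩, hB, ⟨⟨0, fun _ _ _ _ => rfl⟩, hB⟩, ?_⟩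
  have := subσ_smul 0 (0 : ℤ × ℤ × ℤ → V)
  simpa using this

theorem SubstP.unique (hp : p ≠ 0) (hp' : p' ≠ 0) (h : SubstP p Φ Ψ) (h' : SubstP p' Φ Ψ') :
    Ψ = Ψ' := by
  have h1 := h.mul p'
  have h2 := h'.mul p
  rw [mul_comm] at h2
  funext w
  refine slice_ext σ12 fun s => ?_
  refine ((h w).2.2.1.slice_nested s).eq_of_act ((h' w).2.2.1.slice_nested s)
    (qe_ne_zero (mul_ne_zero hp' hp)) ?_
  rw [← slice_act_up, ← slice_act_up, ← ev_shear3_r12, ← (h1 w).2.2.2, ← (h2 w).2.2.2]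

end

/-! ### The substitution for products of three fields -/

theorem Xf_zero_left (s : Bool) (c : EW W) (w : W) : Xf s 0 c w = 0 := by
  funext g
  have h : ∀ v n, mf (0 : EW W) v n = 0 := fun v n => rfl
  change phi s c g.2 (mf 0 _ _) = 0
  rw [h, map_zero]

theorem SubstP.exists_of_qcPair {a b : EW W} (h : QCPair a b) (s : Bool) (c : EW W) :
    ∃ p : MvPolynomial (Fin 2) ℂ, p ≠ 0 ∧ SubstP p (X3 s a b c) (Y3 s a b c) := by
  obtain ⟨p, hp, hL, hact, hN, K, hK⟩ := Yfam_spec h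
  have hX : ∀ w, act (ev x3 (r12 p)) (X3 s a b c w) =
      lift σ12 (phi s c) (fun k w => omega s c w k) (fun w => act (pe p) (FabP a b w)) w := fun w => by
    rw [lift_act, ← ev_r12]
    rfl
  have hF0 : FabP a b (0 : W) = 0 := by
    have := FabP_smul a b 0 (0 : W)
    rwa [zero_smul, zero_smul] at this
  refine ⟨p, hp, fun w => ⟨⟨fun k₀ => ?_, (X3_bd s a b c w).dom (dom_act x3 _ _)⟩, X3_bd s a b c w,
    ⟨⟨K, fun i j k hi => ?_⟩, ?_⟩, ?_⟩⟩
  · rw [hX]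
    cases s
    · obtain ⟨N, hN⟩ := hL w
      exact ⟨N, fun i j k _ hij =>
        (congrArg (md c _) (hN i j hij)).trans (map_zero _)⟩
    · obtain ⟨N, hN⟩ := mf_bdd c w
      have h1 : ∀ k : ℤ, ∃ K : ℤ, ∀ l < K, ∀ i j : ℤ, (i ≤ l ∨ j ≤ l) →
          act (pe p) (FabP a b (mf c w (-k - 1))) (i, j) = 0 := by
        intro k
        obtain ⟨K, hK⟩ := hL (mf c w (-k - 1))
        exact ⟨K, fun l hl i j hij => hK i j (by omega)⟩
      obtain ⟨K, hK⟩ := exists_uniform_bound h1 N k₀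
      refine ⟨K, fun i j k hk hij => ?_⟩
      change act (pe p) (FabP a b (mf c w (-k - 1))) (i, j) = 0
      rcases lt_or_ge k N with hkN | hkN
      · rw [hN k hkN, hF0, map_zero]
        rfl
      · exact hK k hkN hk (K - 1) (by omega) i j (by omega)
  · rw [Y3_apply, hK i hi, Xf_zero_left]
    rfl
  · intro i₀ j₀ k₀
    have h1 : ∀ i : ℤ, ∃ N : ℤ, ∀ l < N, ∀ j k : ℤ, j ≤ j₀ → k ≤ k₀ → (j ≤ l ∨ k ≤ l) →
        Y3 s a b c w (i, j, k) = 0 := by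
      intro i
      obtain ⟨N, hN⟩ := Xf_bd s (YE a b (-i - 1)) c w j₀ k₀
      exact ⟨N, fun l hl j k hj hk hlt => hN j k hj hk (by omega)⟩
    obtain ⟨N, hN⟩ := exists_uniform_bound h1 K i₀
    refine ⟨min N K, fun i j k hi hj hk hlt => ?_⟩
    rcases lt_or_ge i K with hc | hc
    · rw [Y3_apply, hK i hc, Xf_zero_left]
      rfl
    · exact hN i hc hi (N - 1) (by omega) j k hj hk (by omega)
  · refine slice_ext σ12 fun k => ?_
    rw [slice_subσ, ev_shear3_r12, slice_act_up, hX]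
    change sub κin (fun g => phi s c k (act (pe p) (FabP a b (omega s c w k)) g)) =
      act (qe p) (fun g => phi s c k (Yfam a b (omega s c w k) g))
    rw [sub_map _ (hL _).SD, act_map, hact]

/-- The families obtained from products of three fields by the substitution. -/
def GY (s : Bool) (A C : Set (EW W)) : Set (W → ℤ × ℤ × ℤ → W) :=
  {Ψ | ∃ a ∈ A, ∃ b ∈ A, ∃ c ∈ C, Ψ = Y3 s a b c}

/-! ### Commutation for the products of fields -/

theorem exists_substP {s : Bool} {A C : Set (EW W)} (hA : ∀ a ∈ A, ∀ b ∈ A, QCPair a b)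
    {Φ : W → ℤ × ℤ × ℤ → W} (hΦ : Φ ∈ SerSpan x3 (G3 s A C)) :
    ∃ Ψ ∈ SerSpan x3 (GY s A C), ∃ p : MvPolynomial (Fin 2) ℂ, p ≠ 0 ∧ SubstP p Φ Ψ := by
  refine SerSpan.induction hΦ (p := fun Φ => ∃ Ψ ∈ SerSpan x3 (GY s A C),
    ∃ p : MvPolynomial (Fin 2) ℂ, p ≠ 0 ∧ SubstP p Φ Ψ) ?_ ?_ ?_ ?_
  · rintro I h hh _ ⟨a, ha, b, hb, c, hc, rfl⟩
    obtain ⟨p, hp, hs⟩ := SubstP.exists_of_qcPair (hA a ha b hb) s c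
    exact ⟨_, ser_mem hh.shear3 ⟨a, ha, b, hb, c, hc, rfl⟩, p, hp, hs.ser hh⟩
  · exact ⟨0, Submodule.zero_mem _, 1, one_ne_zero, SubstP.zero⟩
  · rintro Φ Φ' ⟨Ψ, hΨ, p, hp, h⟩ ⟨Ψ', hΨ', p', hp', h'⟩
    refine ⟨Ψ + Ψ', Submodule.add_mem _ hΨ hΨ', p' * p, mul_ne_zero hp' hp, (h.mul p').add ?_⟩
    rw [mul_comm]
    exact h'.mul p
  · rintro c Φ ⟨Ψ, hΨ, p, hp, h⟩
    exact ⟨c • Ψ, Submodule.smul_mem _ c hΨ, p, hp, h.smul c⟩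

theorem Loc.exists_Y3 {M : Submonoid (MvPolynomial (Fin 2) ℂ)} {s : Bool} {A C : Set (EW W)}
    (h : Loc M s A C) (hA : ∀ a ∈ A, ∀ b ∈ A, QCPair a b) {a b c : EW W} (ha : a ∈ A)
    (hb : b ∈ A) (hc : c ∈ C) :
    ∃ Q ∈ M, ∃ Q' ∈ M, (fun w => act (ev x3 (shear3 (MvPolynomial.rename ![1, 2] Q *
      MvPolynomial.rename ![0, 2] Q'))) (Y3 s a b c w)) ∈ SerSpan x3 (GY (!s) A C) := by
  obtain ⟨Q, hQ, Q', hQ', h1⟩ := h.exists_X3 ha hb hc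
  refine ⟨Q, hQ, Q', hQ', ?_⟩
  obtain ⟨Ψ, hΨ, p, hp, h2⟩ := exists_substP hA h1
  obtain ⟨p', hp', h3⟩ := SubstP.exists_of_qcPair (hA a ha b hb) s c
  have h4 := h3.ser (LocFin.unit (MvPolynomial.rename ![1, 2] Q * MvPolynomial.rename ![0, 2] Q'))
  simp only [ser_unit] at h4
  rwa [h4.unique hp' hp h2]

/-- The coefficient of a power of the first variable. -/
def cf (r : ℕ) : MvPolynomial (Fin 3) ℂ →ₗ[ℂ] MvPolynomial (Fin 2) ℂ where
  toFun p := (MvPolynomial.finSuccEquiv ℂ 2 p).coeff r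
  map_add' p q := by rw [map_add, Polynomial.coeff_add]
  map_smul' c p := by rw [map_smul, Polynomial.coeff_smul, RingHom.id_apply]

theorem coeff_cf (r : ℕ) (p : MvPolynomial (Fin 3) ℂ) (d : Fin 2 →₀ ℕ) :
    MvPolynomial.coeff d (cf r p) = MvPolynomial.coeff (d.cons r) p :=
  MvPolynomial.finSuccEquiv_coeff_coeff d p r

theorem LocFin.cf {h : I → MvPolynomial (Fin 3) ℂ} (hh : LocFin h) (r : ℕ) :
    LocFin fun i => cf r (h i) := by
  refine hh.of_degree r fun i d hd => ⟨d.cons r, ?_, ?_⟩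
  · rw [MvPolynomial.mem_support_iff] at hd ⊢
    rwa [← coeff_cf]
  · simp only [Finsupp.degree_eq_sum, Fin.sum_univ_three, Fin.sum_univ_two]
    have h1 : (d.cons r : Fin 3 →₀ ℕ) 0 = r := Finsupp.cons_zero _ _
    have h2 : (d.cons r : Fin 3 →₀ ℕ) 1 = d 0 := Finsupp.cons_succ 0 _ _
    have h3 : (d.cons r : Fin 3 →₀ ℕ) 2 = d 1 := Finsupp.cons_succ 1 _ _
    omega

theorem act_monomial {n : ℕ} (x : Fin n → G) (d : Fin n →₀ ℕ) (c : ℂ) (F : G → V) (g : G) :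
    act (ev x (MvPolynomial.monomial d c)) F g = c • F (g - ∑ j, d j • x j) := by
  rw [act_aeval_apply, MvPolynomial.support_monomial]
  split_ifs with hc
  · rw [hc, Finset.sum_empty, zero_smul]
  · rw [Finset.sum_singleton, MvPolynomial.coeff_monomial, if_pos rfl]

theorem act_slice (p : MvPolynomial (Fin 3) ℂ) (F : ℤ × ℤ × ℤ → V) (i : ℤ) (R : ℕ)
    (hF : ∀ i' ≤ i - R, ∀ g, F (i', g) = 0) (g : ℤ × ℤ) :
    act (ev x3 p) F (i, g) =
      ∑ r ∈ Finset.range R, act (ev x2 (cf r p)) (fun g => F (i - r, g)) g := by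
  induction p using MvPolynomial.induction_on' with
  | add p q hp hq =>
    simp only [map_add, LinearMap.add_apply, Pi.add_apply, hp, hq, Finset.sum_add_distrib]
  | monomial d c =>
    have h1 : ∀ r, cf r (MvPolynomial.monomial d c) =
        if r = d 0 then MvPolynomial.monomial d.tail c else 0 := by
      intro r
      ext m
      rw [coeff_cf, MvPolynomial.coeff_monomial]
      by_cases hr : r = d 0
      · subst hr
        rw [if_pos rfl, MvPolynomial.coeff_monomial]
        refine if_congr ⟨fun h => ?_, fun h => ?_⟩ rfl rfl
        · rw [h, Finsupp.tail_cons]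
        · rw [← h, Finsupp.cons_tail]
      · rw [if_neg hr, MvPolynomial.coeff_zero, if_neg]
        intro h
        exact hr (by rw [h, Finsupp.cons_zero])
    have h2 : ((i, g) - ∑ l, d l • x3 l : ℤ × ℤ × ℤ) = (i - d 0, g - ∑ l, d.tail l • x2 l) := by
      rw [Fin.sum_univ_three, Fin.sum_univ_two]
      ext <;> simp [Finsupp.tail_apply]
    simp only [act_monomial, h1, h2]
    by_cases hd : d 0 < R
    · rw [Finset.sum_eq_single (d 0)]
      · simp [act_monomial]
      · intro r _ hr
        simp [hr]
      · intro hr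
        exact absurd (Finset.mem_range.2 hd) hr
    · rw [hF _ (by omega), smul_zero, Finset.sum_eq_zero]
      intro r hr
      rw [if_neg (by rw [Finset.mem_range] at hr; omega)]
      simp

/-- The families of products of two fields, the first of which is a product of two elements
of `A`. -/
def prods (A : Set (EW W)) : Set (EW W) := {e | ∃ a ∈ A, ∃ b ∈ A, ∃ n : ℤ, e = YE a b n}

theorem Xf_mem (s : Bool) {A C : Set (EW W)} {a c : EW W} (ha : a ∈ A) (hc : c ∈ C) :
    Xf s a c ∈ SerSpan x2 (GX s A C) :=
  subset_serSpan ⟨a, ha, c, hc, rfl⟩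

theorem exists_slice_eq_zero {s : Bool} {A C : Set (EW W)} (hA : ∀ a ∈ A, ∀ b ∈ A, QCPair a b)
    {Ψ : W → ℤ × ℤ × ℤ → W} (hΨ : Ψ ∈ GY s A C) :
    ∃ K : ℤ, ∀ w, ∀ i < K, ∀ g, Ψ w (i, g) = 0 := by
  obtain ⟨a, ha, b, hb, c, hc, rfl⟩ := hΨ
  obtain ⟨-, -, -, -, -, K, hK⟩ := Yfam_spec (hA a ha b hb)
  refine ⟨K, fun w i hi g => ?_⟩
  rw [show g = (g.1, g.2) from rfl, Y3_apply, hK i hi, Xf_zero_left]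
  rfl

theorem slice_ser (h : I → MvPolynomial (Fin 3) ℂ) (hh : LocFin h) (F : ℤ × ℤ × ℤ → V) (i : ℤ)
    (R : ℕ) (hF : ∀ i' ≤ i - R, ∀ g, F (i', g) = 0)
    (hlow : ∀ i, LowDeg x2 fun g => F (i, g)) :
    (fun g => ser x3 h F (i, g)) =
      ∑ r ∈ Finset.range R, ser x2 (fun l => cf r (h l)) (fun g => F (i - r, g)) := by
  funext g
  rw [Finset.sum_apply]
  simp only [ser, psA]
  rw [← finsum_sum_comm]
  · exact finsum_congr fun l => act_slice (h l) F i R hF g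
  · exact fun r _ => (hh.cf r).pf (hlow _) g

theorem slice_mem {s : Bool} {A C : Set (EW W)} (hA : ∀ a ∈ A, ∀ b ∈ A, QCPair a b)
    {Ψ : W → ℤ × ℤ × ℤ → W} (hΨ : Ψ ∈ SerSpan x3 (GY s A C)) (i : ℤ) :
    (fun w g => Ψ w (i, g)) ∈ SerSpan x2 (GX s (prods A) C) := by
  refine SerSpan.induction hΨ (p := fun Ψ => (fun w g => Ψ w (i, g)) ∈
    SerSpan x2 (GX s (prods A) C)) ?_ (Submodule.zero_mem _)
    (fun Φ Ψ h h' => Submodule.add_mem _ h h') (fun c Φ h => Submodule.smul_mem _ c h)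
  intro I h hh E hE
  obtain ⟨K, hK⟩ := exists_slice_eq_zero hA hE
  obtain ⟨a, ha, b, hb, c, hc, rfl⟩ := hE
  have h1 : (fun w g => ser x3 h (Y3 s a b c w) (i, g)) = ∑ r ∈ Finset.range (i - K + 1).toNat,
      fun w => ser x2 (fun l => cf r (h l)) (Xf s (YE a b (-(i - r) - 1)) c w) := by
    funext w
    rw [slice_ser h hh (Y3 s a b c w) i (i - K + 1).toNat (fun i' hi g => hK w i' (by omega) g)
      fun i => (Xf_bd s (YE a b (-i - 1)) c w).lowDeg, Finset.sum_apply]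
    rfl
  rw [h1]
  refine Submodule.sum_mem _ fun r _ => SerSpan.ser_mem GX_lowDeg (Xf_mem s ?_ hc) (hh.cf r)
  exact ⟨a, ha, b, hb, _, rfl⟩

theorem cf_zero_shear3 (Q Q' : MvPolynomial (Fin 2) ℂ) :
    cf 0 (shear3 (MvPolynomial.rename ![1, 2] Q * MvPolynomial.rename ![0, 2] Q')) = Q * Q' := by
  let f : MvPolynomial (Fin 3) ℂ →+* MvPolynomial (Fin 2) ℂ :=
    Polynomial.constantCoeff.comp (MvPolynomial.finSuccEquiv ℂ 2 : _ →+* _)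
  have hf : ∀ p, cf 0 p = f p := fun p => rfl
  have h1 : ∀ i : Fin 2, f (MvPolynomial.X i.succ) = MvPolynomial.X i := fun i => by
    simp [f, MvPolynomial.finSuccEquiv_X_succ]
  have h0 : f (MvPolynomial.X 0) = 0 := by
    simp [f, MvPolynomial.finSuccEquiv_X_zero]
  have hC : ∀ c, f (MvPolynomial.C c) = MvPolynomial.C c := fun c => by
    simp [f, MvPolynomial.finSuccEquiv_apply]
  have key : ∀ (ι : Fin 2 → Fin 3) (Q : MvPolynomial (Fin 2) ℂ),
      (∀ i, f (shear3 (MvPolynomial.X (ι i))) = MvPolynomial.X i) →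
      f (shear3 (MvPolynomial.rename ι Q)) = Q := by
    intro ι Q hι
    induction Q using MvPolynomial.induction_on with
    | C c =>
      rw [MvPolynomial.rename_C, ← MvPolynomial.algebraMap_eq, AlgHom.commutes,
        MvPolynomial.algebraMap_eq, hC]
    | add p q hp hq => rw [map_add, map_add, map_add, hp, hq]
    | mul_X p i hp => rw [map_mul, map_mul, map_mul, hp, MvPolynomial.rename_X, hι]
  rw [hf, map_mul, map_mul, key _ Q, key _ Q']
  · intro i
    fin_cases i
    · simpa [shear3, h0] using h1 0
    · simpa [shear3] using h1 1
  · intro i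
    fin_cases i
    · simpa [shear3] using h1 0
    · simpa [shear3] using h1 1

/-- Commutation passes from a set of pairwise quasi compatible fields to their products. -/
theorem Loc.prods {M : Submonoid (MvPolynomial (Fin 2) ℂ)} {s : Bool} {A C : Set (EW W)}
    (h : Loc M s A C) (hA : ∀ a ∈ A, ∀ b ∈ A, QCPair a b) : Loc M s (prods A) C := by
  rintro _ ⟨a, ha, b, hb, n, rfl⟩ c hc
  obtain ⟨Q, hQ, Q', hQ', h1⟩ := h.exists_Y3 hA ha hb hc
  obtain ⟨K, hK⟩ := exists_slice_eq_zero (s := s) (C := C) hA ⟨a, ha, b, hb, c, hc, rfl⟩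
  set T := shear3 (MvPolynomial.rename ![1, 2] Q * MvPolynomial.rename ![0, 2] Q') with hT
  have key : ∀ m : ℕ, ∃ D ∈ M, ∀ i < K + m, (fun w => act (ev x2 D) (Xf s (YE a b (-i - 1)) c w)) ∈
      SerSpan x2 (GX (!s) (NVA.prods A) C) := by
    intro m
    induction m with
    | zero =>
      refine ⟨1, M.one_mem, fun i hi => ?_⟩
      have : (fun w => act (ev x2 1) (Xf s (YE a b (-i - 1)) c w)) = 0 := by
        funext w
        have : Xf s (YE a b (-i - 1)) c w = 0 := funext fun g => hK w i (by simpa using hi) g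
        rw [this, map_zero]
        rfl
      rw [this]
      exact Submodule.zero_mem _
    | succ m ih =>
      obtain ⟨D, hD, hi⟩ := ih
      have hcf : cf 0 T ∈ M := by
        rw [hT, cf_zero_shear3]
        exact M.mul_mem hQ hQ'
      refine ⟨cf 0 T * D, M.mul_mem hcf hD, fun i hlt => ?_⟩
      have hlow : ∀ q : MvPolynomial (Fin 2) ℂ, ∀ i < K + m,
          (fun w => act (ev x2 (q * D)) (Xf s (YE a b (-i - 1)) c w)) ∈
            SerSpan x2 (GX (!s) (NVA.prods A) C) := by
        intro q i hlt
        simp only [map_mul (ev x2), act_mul]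
        exact SerSpan.act_mem GX_lowDeg (hi i hlt) q
      rcases lt_or_ge i (K + m) with hlt' | hge
      · exact hlow _ i hlt'
      · obtain rfl : i = K + m := by push_cast at hlt; omega
        have h2 := SerSpan.act_mem GX_lowDeg (slice_mem hA h1 (K + m)) D
        have h3 : (fun w => act (ev x2 D) fun g => act (ev x3 T) (Y3 s a b c w) (K + m, g)) =
            (∑ r ∈ Finset.range m, fun w => act (ev x2 (cf (r + 1) T * D))
              (Xf s (YE a b (-(K + m - (r + 1 : ℕ)) - 1)) c w)) +
            fun w => act (ev x2 (cf 0 T * D)) (Xf s (YE a b (-(K + m) - 1)) c w) := by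
          funext w
          have h4 : (fun g => act (ev x3 T) (Y3 s a b c w) (K + m, g)) =
              ∑ r ∈ Finset.range (m + 1), act (ev x2 (cf r T))
                (Xf s (YE a b (-(K + m - r) - 1)) c w) := by
            funext g
            rw [act_slice T (Y3 s a b c w) (K + m) (m + 1)
              (fun i' hi' g => hK w i' (by push_cast at hi'; omega) g), Finset.sum_apply]
            rfl
          rw [h4, map_sum, Finset.sum_range_succ', Pi.add_apply, Finset.sum_apply]
          simp only [mul_comm _ D, map_mul (ev x2), act_mul, Nat.cast_zero, sub_zero]
        rw [h3] at h2
        refine (Submodule.add_mem_iff_right _ ?_).1 h2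
        exact Submodule.sum_mem _ fun r hr => hlow _ _ (by push_cast; omega)
  obtain ⟨D, hD, h2⟩ := key (-n - K).toNat
  refine ⟨D, hD, ?_⟩
  have := h2 (-n - 1) (by omega)
  rwa [show -(-n - 1) - 1 = n by ring] at this

section

/-! ### Commutation for the generated space -/

variable {M : Submonoid (MvPolynomial (Fin 2) ℂ)} {s : Bool} {A A' C C' : Set (EW W)}

theorem GX_mono (s : Bool) (hA : A ⊆ A') (hC : C ⊆ C') : GX s A C ⊆ GX s A' C' := by
  rintro _ ⟨a, ha, c, hc, rfl⟩
  exact ⟨a, hA ha, c, hC hc, rfl⟩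

theorem Xf_add (s : Bool) (a b c : EW W) : Xf s (a + b) c = Xf s a c + Xf s b c := by
  funext w g
  change phi s c g.2 (mf (a + b) _ _) = phi s c g.2 _ + phi s c g.2 _
  rw [mf_add_left, map_add]

theorem Xf_smul (s : Bool) (z : ℂ) (a c : EW W) : Xf s (z • a) c = z • Xf s a c := by
  funext w g
  change phi s c g.2 (mf (z • a) _ _) = z • phi s c g.2 _
  rw [mf_smul_left, map_smul]

theorem Loc.span (h : Loc M s A C) : Loc M s (Submodule.span ℂ A) C := by
  intro a ha c hc
  have hle : SerSpan x2 (GX (!s) A C) ≤ SerSpan x2 (GX (!s) (Submodule.span ℂ A : Set (EW W)) C) :=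
    SerSpan.mono (GX_mono _ Submodule.subset_span le_rfl)
  induction ha using Submodule.span_induction with
  | mem a ha =>
    obtain ⟨Q, hQ, h1⟩ := h a ha c hc
    exact ⟨Q, hQ, hle h1⟩
  | zero =>
    refine ⟨1, M.one_mem, ?_⟩
    simp only [Xf_zero_left, map_zero]
    exact Submodule.zero_mem _
  | add a b _ _ ha hb =>
    obtain ⟨Q, hQ, h1⟩ := ha
    obtain ⟨Q', hQ', h2⟩ := hb
    refine ⟨Q * Q', M.mul_mem hQ hQ', ?_⟩
    have h3 := Submodule.add_mem _ (SerSpan.act_mem GX_lowDeg h1 Q')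
      (SerSpan.act_mem GX_lowDeg h2 Q)
    convert h3 using 1
    funext w
    rw [Pi.add_apply, Xf_add, Pi.add_apply, map_add, ← act_mul, ← act_mul, ← map_mul, ← map_mul,
      mul_comm Q']
  | smul z a _ ha =>
    obtain ⟨Q, hQ, h1⟩ := ha
    refine ⟨Q, hQ, ?_⟩
    have h3 := Submodule.smul_mem _ z h1
    convert h3 using 1
    funext w
    rw [Pi.smul_apply, Xf_smul, Pi.smul_apply, map_smul]

theorem QCSet.pairwise (h : QCSet A) : ∀ a ∈ A, ∀ b ∈ A, QCPair a b :=
  fun _ ha _ hb => h.qcPair ha hb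

/-- Commutation passes from a generating set to the generated space. -/
theorem Loc.gen {S : Set (EW W)} {U : Submodule ℂ (EW W)} (hU : IsGenVA S U)
    (h : Loc M s (insert oneE S) C) : Loc M s U C := by
  obtain ⟨hQ, hY, h1, hS, hmin⟩ := hU
  let 𝒜 : Set (Set (EW W)) := {A | A ⊆ U ∧ Loc M s A C}
  have hsub : ⋃₀ 𝒜 ⊆ (U : Set (EW W)) := Set.sUnion_subset fun A hA => hA.1
  have hloc : Loc M s (⋃₀ 𝒜) C := by
    rintro a ⟨A, hA, ha⟩ c hc
    obtain ⟨Q, hQ, h2⟩ := hA.2 a ha c hc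
    exact ⟨Q, hQ, SerSpan.mono (GX_mono _ (Set.subset_sUnion_of_mem hA) le_rfl) h2⟩
  let N : Submodule ℂ (EW W) := Submodule.span ℂ (⋃₀ 𝒜)
  have hNU : N ≤ U := Submodule.span_le.2 hsub
  have hNloc : Loc M s N C := hloc.span
  have hmem : ∀ A ∈ 𝒜, A ⊆ N := fun A hA =>
    (Set.subset_sUnion_of_mem hA).trans Submodule.subset_span
  have hNQ : QCSet (N : Set (EW W)) := fun r ψ hψ => hQ r ψ fun i => hNU (hψ i)
  have hNY : ∀ a ∈ N, ∀ b ∈ N, ∀ n : ℤ, YE a b n ∈ N := by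
    intro a ha b hb n
    refine hmem (NVA.prods N) ⟨?_, hNloc.prods hNQ.pairwise⟩ ⟨a, ha, b, hb, n, rfl⟩
    rintro _ ⟨a, ha, b, hb, n, rfl⟩
    exact hY a (hNU ha) b (hNU hb) n
  have hgen : insert oneE S ⊆ (N : Set (EW W)) :=
    hmem _ ⟨Set.insert_subset h1 hS, h⟩
  have : U ≤ N := hmin N ⟨hNQ, hNY, hgen (Set.mem_insert _ _), (Set.subset_insert _ _).trans hgen⟩
  rwa [le_antisymm this hNU]

theorem Xf_one_left (s : Bool) (c : EW W) : Xf s oneE c = Xf (!s) oneE c := by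
  have h : Xf true oneE c = Xf false oneE c := by
    funext w g
    change mf oneE (mf c w (-g.2 - 1)) (-g.1 - 1) = md c (-g.2 - 1) (mf oneE w (-g.1 - 1))
    rw [mf_oneE, mf_oneE]
    split_ifs
    · rfl
    · rw [map_zero]
  cases s
  · exact h.symm
  · exact h

theorem Xf_one_right (s : Bool) (a : EW W) : Xf s a oneE = Xf (!s) a oneE := by
  funext w ⟨i, k⟩
  rw [Xf_swap, Xf_one_left, ← Xf_swap]

theorem Loc.insert_one (h : Loc M s A C) : Loc M s (insert oneE A) (insert oneE C) := by
  have key : ∀ a ∈ insert oneE A, ∀ c ∈ insert oneE C, Xf s a c = Xf (!s) a c →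
      ∃ Q ∈ M, (fun w => act (ev x2 Q) (Xf s a c w)) ∈
        SerSpan x2 (GX (!s) (insert oneE A) (insert oneE C)) := by
    intro a ha c hc hac
    refine ⟨1, M.one_mem, ?_⟩
    rw [hac]
    exact SerSpan.act_mem GX_lowDeg (Xf_mem (!s) ha hc) 1
  rintro a (rfl | ha) c hc
  · exact key _ (Set.mem_insert _ _) c hc (Xf_one_left s c)
  rcases hc with rfl | hc
  · exact key a (Or.inr ha) _ (Set.mem_insert _ _) (Xf_one_right s a)
  obtain ⟨Q, hQ, h1⟩ := h a ha c hc
  exact ⟨Q, hQ, SerSpan.mono (GX_mono _ (Set.subset_insert _ _) (Set.subset_insert _ _)) h1⟩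

/-- The exchange of the two variables. -/
abbrev swp : MvPolynomial (Fin 2) ℂ →ₐ[ℂ] MvPolynomial (Fin 2) ℂ := MvPolynomial.rename ![1, 0]

theorem act_swp (Q : MvPolynomial (Fin 2) ℂ) (F : ℤ × ℤ → V) :
    (fun g : ℤ × ℤ => act (ev x2 Q) F g.swap) = act (ev x2 (swp Q)) fun g => F g.swap := by
  rw [MvPolynomial.aeval_rename]
  refine (act_comp_equiv AddEquiv.prodComm x2 Q F).trans ?_
  congr 4
  funext i
  fin_cases i <;> rfl

theorem Loc.swap (hM : ∀ Q ∈ M, swp Q ∈ M) (h : Loc M s A C) : Loc M (!s) C A := by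
  have hX : ∀ (s : Bool) (a c : EW W) (w : W), Xf (!s) c a w = fun g => Xf s a c w g.swap :=
    fun s a c w => funext fun g => (Xf_swap s a c w g.2 g.1).symm
  intro c hc a ha
  obtain ⟨Q, hQ, h1⟩ := h a ha c hc
  refine ⟨swp Q, hM Q hQ, ?_⟩
  simp only [hX, ← act_swp]
  refine SerSpan.induction h1 (p := fun Φ => (fun w (g : ℤ × ℤ) => Φ w g.swap) ∈
    SerSpan x2 (GX (!!s) C A)) ?_ (Submodule.zero_mem _)
    (fun Φ Ψ h h' => Submodule.add_mem _ h h') (fun c Φ h => Submodule.smul_mem _ c h)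
  rintro I f hf _ ⟨a', ha', c', hc', rfl⟩
  have := SerSpan.ser_mem GX_lowDeg (Xf_mem (!!s) hc' ha') (hf.rename ![1, 0])
  convert this using 1
  funext w g
  rw [hX]
  exact finsum_congr fun i => congrFun (act_swp (f i) _) g

/-- Commutation passes from a generating set to the generated space in both arguments. -/
theorem Loc.gen_gen (hM : ∀ Q ∈ M, swp Q ∈ M) {S : Set (EW W)} {U : Submodule ℂ (EW W)}
    (hU : IsGenVA S U) (h : Loc M true S S) :
    Loc M true (U : Set (EW W)) (U : Set (EW W)) := by
  have h1 : Loc M true (U : Set (EW W)) (insert oneE S) := Loc.gen hU h.insert_one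
  have h2 : Loc M false (insert oneE S) (U : Set (EW W)) := Loc.swap (s := true) hM h1
  have h3 : Loc M false (U : Set (EW W)) (U : Set (EW W)) := Loc.gen hU h2
  exact Loc.swap (s := false) hM h3

end

/-! ### Power series and rational functions as multipliers -/

/-- The double power series with coefficients `F`, as a family of monomials. -/
def psS (F : ℕ → ℕ → ℂ) (n : ℕ × ℕ) : MvPolynomial (Fin 2) ℂ :=
  MvPolynomial.monomial (Finsupp.single 0 n.1 + Finsupp.single 1 n.2) (F n.1 n.2)

theorem locFin_psS (F : ℕ → ℕ → ℂ) : LocFin (psS F) := by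
  intro N
  refine ((Set.finite_Iic N).prod (Set.finite_Iic N)).subset ?_
  rintro ⟨m, t⟩ ⟨d, hd, hN⟩
  have h := Finset.mem_singleton.1 (MvPolynomial.support_monomial_subset hd)
  subst h
  rw [map_add, Finsupp.degree_single, Finsupp.degree_single] at hN
  dsimp only at hN
  exact ⟨Set.mem_Iic.2 (by omega), Set.mem_Iic.2 (by omega)⟩

theorem kf_psEmbed (F : ℕ → ℕ → ℂ) (m t : ℕ) : kf (psEmbed F) ((m : ℤ), (t : ℤ)) = F m t := by
  change ((psEmbed F).coeff (m : ℤ)).coeff (t : ℤ) = _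
  rw [psEmbed, HahnSeries.ofPowerSeries_apply_coeff, PowerSeries.coeff_mk, psN,
    HahnSeries.ofPowerSeries_apply_coeff, PowerSeries.coeff_mk]

theorem coeff_ofPowerSeries_neg {R : Type*} [Semiring R] (f : PowerSeries R) {j : ℤ} (hj : j < 0) :
    (HahnSeries.ofPowerSeries ℤ R f).coeff j = 0 := by
  rw [HahnSeries.ofPowerSeries_apply]
  refine HahnSeries.embDomain_of_notMem_range ?_
  rintro ⟨n, hn⟩
  have h : (n : ℤ) = j := hn
  omega

theorem kf_psEmbed_eq_zero (F : ℕ → ℕ → ℂ) {g : ℤ × ℤ} (hg : g.1 < 0 ∨ g.2 < 0) :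
    kf (psEmbed F) g = 0 := by
  obtain ⟨j, t⟩ := g
  change ((psEmbed F).coeff j).coeff t = 0
  rcases lt_or_ge j 0 with hj | hj
  · rw [psEmbed, coeff_ofPowerSeries_neg _ hj, HahnSeries.coeff_zero]
  · obtain ⟨m, rfl⟩ := Int.eq_ofNat_of_zero_le hj
    have ht : t < 0 := by
      rcases hg with h | h
      · exact absurd h (not_lt.2 hj)
      · exact h
    rw [psEmbed, HahnSeries.ofPowerSeries_apply_coeff, PowerSeries.coeff_mk, psN,
      coeff_ofPowerSeries_neg _ ht]

theorem castPair_injective : Function.Injective fun n : ℕ × ℕ => ((n.1 : ℤ), (n.2 : ℤ)) := by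
  rintro ⟨a, b⟩ ⟨c, d⟩ h
  rw [Prod.mk.injEq, Nat.cast_inj, Nat.cast_inj] at h
  exact Prod.ext h.1 h.2

theorem sf_psEmbed (F : ℕ → ℕ → ℂ) (E : ℤ × ℤ → V) :
    sf (kf (psEmbed F)) E = ser x2 (psS F) E := by
  funext g
  change ∑ᶠ s : ℤ × ℤ, _ = ∑ᶠ n : ℕ × ℕ, act (ev x2 (psS F n)) E g
  have h : ∀ n : ℕ × ℕ, act (ev x2 (psS F n)) E g =
      (fun s : ℤ × ℤ => kf (psEmbed F) s • E (g - s)) ((n.1 : ℤ), (n.2 : ℤ)) := by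
    intro n
    rw [psS, act_monomial]
    dsimp only
    rw [kf_psEmbed, Fin.sum_univ_two]
    congr 2
    simp
  rw [finsum_congr h]
  have hi : Set.InjOn (fun n : ℕ × ℕ => ((n.1 : ℤ), (n.2 : ℤ))) Set.univ :=
    castPair_injective.injOn
  have h2 := finsum_mem_image (f := fun s : ℤ × ℤ => kf (psEmbed F) s • E (g - s)) hi
  rw [finsum_mem_univ] at h2
  rw [← h2, finsum_mem_def]
  refine finsum_congr fun s => ?_
  by_cases hs : s ∈ (fun n : ℕ × ℕ => ((n.1 : ℤ), (n.2 : ℤ))) '' Set.univ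
  · rw [Set.indicator_of_mem hs]
  · rw [Set.indicator_of_notMem hs, kf_psEmbed_eq_zero, zero_smul]
    by_contra! hc
    obtain ⟨m, hm⟩ := Int.eq_ofNat_of_zero_le hc.1
    obtain ⟨t, ht⟩ := Int.eq_ofNat_of_zero_le hc.2
    exact hs ⟨(m, t), trivial, Prod.ext hm.symm ht.symm⟩

/-- A polynomial in the two variables of `K2`. -/
abbrev polyK (p : MvPolynomial (Fin 2) ℂ) : K2 := MvPolynomial.aeval ![xOuter, xInner] p

theorem kf_polyK_mul (p : MvPolynomial (Fin 2) ℂ) (x : K2) :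
    kf (polyK p * x) = act (ev x2 p) (kf x) := by
  rw [← pe_eq_ev]
  refine kf_aeval_mul _ _ (fun i x => ?_) p x
  fin_cases i
  · exact kf_xOuter_mul x
  · exact kf_xInner_mul x

theorem polyEmbed_eq (p : MvPolynomial (Fin 2) ℂ) : polyEmbed p = polyK p := by
  apply kf_injective
  rw [← k2_mul_one (polyK p), kf_polyK_mul, kf_one]
  funext g
  rw [act_aeval_apply]
  by_cases hg : g.1 < 0 ∨ g.2 < 0
  · rw [polyEmbed, kf_psEmbed_eq_zero _ hg]
    symm
    refine Finset.sum_eq_zero fun d _ => ?_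
    rw [if_neg, smul_zero]
    intro h
    rw [sub_eq_zero] at h
    rw [h] at hg
    simp [Fin.sum_univ_two] at hg
    omega
  · push Not at hg
    obtain ⟨m, hm⟩ := Int.eq_ofNat_of_zero_le hg.1
    obtain ⟨t, ht⟩ := Int.eq_ofNat_of_zero_le hg.2
    obtain rfl : g = ((m : ℤ), (t : ℤ)) := Prod.ext hm ht
    rw [polyEmbed, kf_psEmbed, polyCoeffFun]
    have h : ∀ d : Fin 2 →₀ ℕ, ((m : ℤ), (t : ℤ)) - ∑ i, d i • x2 i = 0 ↔
        d = Finsupp.single 0 m + Finsupp.single 1 t := by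
      intro d
      rw [sub_eq_zero, Fin.sum_univ_two]
      constructor
      · intro h
        simp at h
        ext i
        fin_cases i <;> simp <;> omega
      · rintro rfl
        simp
    simp_rw [h, smul_eq_mul, mul_ite, mul_one, mul_zero]
    rw [Finset.sum_ite_eq']
    split_ifs with h
    · rfl
    · exact MvPolynomial.notMem_support_iff.1 h

section

/-! ### Commutation relations with rational coefficients -/

variable {M : Submonoid (MvPolynomial (Fin 2) ℂ)} {S : Set (EW W)}

theorem Xf_false_nested (v u : EW W) (w : W) : Nested2 (Xf false v u w) := by
  constructor
  · obtain ⟨N, hN⟩ := mf_bdd v w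
    refine ⟨N, fun j hj t => ?_⟩
    change md u (-t - 1) (mf v w (-j - 1)) = 0
    rw [hN j hj, map_zero]
  · intro j
    exact mf_bdd u (mf v w (-j - 1))

theorem ev_ne_zero {p : MvPolynomial (Fin 2) ℂ} (hp : p ≠ 0) : ev x2 p ≠ 0 := by
  rw [← pe_eq_ev]
  exact pe_ne_zero hp

theorem loc_of_rational
    (h : ∀ a ∈ S, ∀ b ∈ S, ∃ (f : AddMonoidAlgebra ℂ (ℤ × ℤ)) (q P : MvPolynomial (Fin 2) ℂ)
      (r : ℕ) (x : Fin r → K2) (D R : Fin r → MvPolynomial (Fin 2) ℂ) (F : Fin r → ℕ → ℕ → ℂ)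
      (u v : Fin r → EW W), P ∈ M ∧ ev x2 q * f = ev x2 P ∧ (∀ i, D i ∈ M) ∧
        (∀ i, polyK (D i) * x i = polyK (R i) * psEmbed (F i)) ∧ (∀ i, u i ∈ S) ∧
        (∀ i, v i ∈ S) ∧
        ∀ w, act f (FabP a b w) = ∑ i, sf (kf (x i)) (Xf false (v i) (u i) w)) :
    Loc M true S S := by
  intro a ha b hb
  obtain ⟨f, q, P, r, x, D, R, F, u, v, hP, hf, hD, hx, hu, hv, hw⟩ := h a ha b hb
  refine ⟨P * ∏ i, D i, M.mul_mem hP (M.prod_mem fun i _ => hD i), ?_⟩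
  have key : (fun w => act (ev x2 (P * ∏ i, D i)) (Xf true a b w)) =
      ∑ i, fun w => act (ev x2 (q * (∏ j ∈ Finset.univ.erase i, D j) * R i))
        (ser x2 (psS (F i)) (Xf false (v i) (u i) w)) := by
    funext w
    rw [Finset.sum_apply]
    change act _ (FabP a b w) = _
    rw [map_mul, ← hf, mul_assoc, mul_comm f, ← mul_assoc, act_mul, hw, map_sum]
    refine Finset.sum_congr rfl fun i _ => ?_
    rw [← map_mul, ← Finset.mul_prod_erase Finset.univ D (Finset.mem_univ i),
      mul_comm (D i), ← mul_assoc, map_mul, map_mul _ _ (R i), act_mul, act_mul]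
    congr 1
    have hN := Xf_false_nested (v i) (u i) w
    rw [← sf_act _ (kf_nested _) hN, ← kf_polyK_mul, hx, kf_polyK_mul,
      sf_act _ (kf_nested _) hN, sf_psEmbed]
  rw [key]
  refine Submodule.sum_mem _ fun i _ => ?_
  exact SerSpan.act_mem GX_lowDeg (ser_mem (locFin_psS _) ⟨v i, hv i, u i, hu i, rfl⟩) _

theorem psEmbed_smul (c : ℂ) (F : ℕ → ℕ → ℂ) :
    kf (psEmbed fun m t => c * F m t) = c • kf (psEmbed F) := by
  funext g
  rw [Pi.smul_apply, smul_eq_mul]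
  by_cases hg : g.1 < 0 ∨ g.2 < 0
  · rw [kf_psEmbed_eq_zero _ hg, kf_psEmbed_eq_zero _ hg, mul_zero]
  · push Not at hg
    obtain ⟨m, hm⟩ := Int.eq_ofNat_of_zero_le hg.1
    obtain ⟨t, ht⟩ := Int.eq_ofNat_of_zero_le hg.2
    obtain rfl : g = ((m : ℤ), (t : ℤ)) := Prod.ext hm ht
    rw [kf_psEmbed, kf_psEmbed]

/-- The total coefficients of a locally finite family of polynomials. -/
def total (h : I → MvPolynomial (Fin 2) ℂ) (m t : ℕ) : ℂ :=
  ∑ᶠ i, MvPolynomial.coeff (Finsupp.single 0 m + Finsupp.single 1 t) (h i)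

theorem LocFin.finite_coeff {n : ℕ} {h : I → MvPolynomial (Fin n) ℂ} (hh : LocFin h)
    (d : Fin n →₀ ℕ) : (Function.support fun i => MvPolynomial.coeff d (h i)).Finite :=
  (hh d.degree).subset fun _ hi => ⟨d, MvPolynomial.mem_support_iff.2 hi, le_rfl⟩

theorem act_ev_eq_finsum {n : ℕ} (x : Fin n → G) (p : MvPolynomial (Fin n) ℂ) (E : G → V) (g : G) :
    act (ev x p) E g = ∑ᶠ d : Fin n →₀ ℕ, MvPolynomial.coeff d p • E (g - ∑ j, d j • x j) := by
  rw [act_aeval_apply]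
  symm
  refine finsum_eq_sum_of_support_subset _ fun d hd => ?_
  refine Finset.mem_coe.2 (MvPolynomial.mem_support_iff.2 fun h0 => hd ?_)
  dsimp only
  rw [h0, zero_smul]

/-- Exponents of polynomials in two variables. -/
def expEquiv : ℕ × ℕ ≃ (Fin 2 →₀ ℕ) where
  toFun n := Finsupp.single 0 n.1 + Finsupp.single 1 n.2
  invFun d := (d 0, d 1)
  left_inv n := by simp
  right_inv d := by
    ext i
    fin_cases i <;> simp

theorem ser_total {x : Fin 2 → G} {h : I → MvPolynomial (Fin 2) ℂ} (hh : LocFin h) {E : G → V}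
    (hE : LowDeg x E) : ser x h E = ser x (psS (total h)) E := by
  funext g
  change ∑ᶠ i, act (ev x (h i)) E g = ∑ᶠ n, act (ev x (psS (total h) n)) E g
  obtain ⟨N, hN⟩ := hE g
  have hfin : {d : Fin 2 →₀ ℕ | d.degree ≤ N}.Finite := Finsupp.finite_of_degree_le N
  have h1 : ∀ i, act (ev x (h i)) E g = ∑ d ∈ hfin.toFinset,
      MvPolynomial.coeff d (h i) • E (g - ∑ j, d j • x j) := by
    intro i
    rw [act_ev_eq_finsum]
    refine finsum_eq_sum_of_support_subset _ fun d hd => ?_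
    rw [Set.Finite.coe_toFinset]
    by_contra hc
    refine hd ?_
    dsimp only
    rw [hN d (not_le.1 hc), smul_zero]
  rw [finsum_congr h1, finsum_sum_comm]
  · have h2 : ∀ n, act (ev x (psS (total h) n)) E g =
        (fun d => (∑ᶠ i, MvPolynomial.coeff d (h i)) • E (g - ∑ j, d j • x j)) (expEquiv n) := by
      intro n
      rw [psS, act_monomial]
      rfl
    rw [(finsum_congr h2).trans (finsum_comp_equiv expEquiv (f := fun d : Fin 2 →₀ ℕ =>
        (∑ᶠ i, MvPolynomial.coeff d (h i)) • E (g - ∑ j, d j • x j))),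
      finsum_eq_sum_of_support_subset (s := hfin.toFinset)]
    · refine Finset.sum_congr rfl fun d _ => ?_
      rw [finsum_smul' (hh.finite_coeff d)]
    · intro d hd
      rw [Set.Finite.coe_toFinset]
      by_contra hc
      refine hd ?_
      dsimp only
      rw [hN d (not_le.1 hc), smul_zero]
  · intro d _
    refine (hh.finite_coeff d).subset fun i hi h0 => hi ?_
    dsimp only at h0 ⊢
    rw [h0, zero_smul]

theorem SerSpan.exists_sum {Φ : W → ℤ × ℤ → W} (hΦ : Φ ∈ SerSpan x2 (GX false S S)) :
    ∃ (r : ℕ) (F : Fin r → ℕ → ℕ → ℂ) (u v : Fin r → EW W), (∀ i, u i ∈ S) ∧ (∀ i, v i ∈ S) ∧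
      ∀ w, Φ w = ∑ i, sf (kf (psEmbed (F i))) (Xf false (v i) (u i) w) := by
  refine SerSpan.induction hΦ (p := fun Φ => ∃ (r : ℕ) (F : Fin r → ℕ → ℕ → ℂ)
    (u v : Fin r → EW W), (∀ i, u i ∈ S) ∧ (∀ i, v i ∈ S) ∧
      ∀ w, Φ w = ∑ i, sf (kf (psEmbed (F i))) (Xf false (v i) (u i) w)) ?_ ?_ ?_ ?_
  · rintro I h hh _ ⟨v, hv, u, hu, rfl⟩
    refine ⟨1, fun _ => total h, fun _ => u, fun _ => v, fun _ => hu, fun _ => hv, fun w => ?_⟩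
    rw [Fin.sum_univ_one, sf_psEmbed]
    exact ser_total hh (Xf_bd false v u w).lowDeg
  · exact ⟨0, Fin.elim0, Fin.elim0, Fin.elim0, fun i => i.elim0, fun i => i.elim0, fun w => by simp⟩
  · rintro Φ Ψ ⟨r, F, u, v, hu, hv, h⟩ ⟨r', F', u', v', hu', hv', h'⟩
    refine ⟨r + r', Fin.append F F', Fin.append u u', Fin.append v v', ?_, ?_, fun w => ?_⟩
    · intro i
      refine Fin.addCases (fun i => ?_) (fun i => ?_) i
      · rw [Fin.append_left]; exact hu i
      · rw [Fin.append_right]; exact hu' i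
    · intro i
      refine Fin.addCases (fun i => ?_) (fun i => ?_) i
      · rw [Fin.append_left]; exact hv i
      · rw [Fin.append_right]; exact hv' i
    · rw [Pi.add_apply, h, h', Fin.sum_univ_add]
      simp_rw [Fin.append_left, Fin.append_right]
  · rintro c Φ ⟨r, F, u, v, hu, hv, h⟩
    refine ⟨r, fun i m t => c * F i m t, u, v, hu, hv, fun w => ?_⟩
    rw [Pi.smul_apply, h, Finset.smul_sum]
    simp_rw [psEmbed_smul, sf_smul]

end

section

/-! ### Pseudo-locality -/

variable {M : Submonoid (MvPolynomial (Fin 2) ℂ)} {S : Set (EW W)}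

theorem smulFam_Fab (x : K2) (u v : EW W) (w : W) (m t : ℤ) :
    smulFam (k2Fun x) (fun m' t' => Fab u v w t' m') m t = sf (kf x) (Xf false v u w) (m, t) :=
  smulFam_eq _ _ _ _

theorem polyK_one_mul (x : K2) : polyK 1 * x = x := by
  apply kf_injective
  rw [kf_polyK_mul, map_one, act_one]

theorem polyK_mul_mul (p q : MvPolynomial (Fin 2) ℂ) (x : K2) :
    polyK (p * q) * x = polyK p * (polyK q * x) := by
  apply kf_injective
  rw [kf_polyK_mul, kf_polyK_mul, kf_polyK_mul, map_mul, act_mul]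

theorem eq_zero_of_tr_mul {f : AddMonoidAlgebra ℂ G} {d : G} (h : tr d * f = 0) : f = 0 := by
  have h1 : (1 : AddMonoidAlgebra ℂ G) = tr (-d) * tr d := by
    rw [tr_mul, neg_add_cancel]
    rfl
  rw [← one_mul f, h1, mul_assoc, h, mul_zero]

theorem polyK_ne_zero {p : MvPolynomial (Fin 2) ℂ} (hp : p ≠ 0) : polyK p ≠ 0 := by
  intro h
  have h1 := kf_polyK_mul p 1
  rw [h, k2_zero_mul, kf_zero, kf_one] at h1
  obtain ⟨d, hd⟩ := exists_act_ne (ev_ne_zero hp)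
  rw [coeff_eq_act] at hd
  replace h1 := congrFun h1 d
  rw [Pi.zero_apply] at h1
  exact hd (by convert h1.symm)

theorem polyK_mul_div {p : MvPolynomial (Fin 2) ℂ} (hp : p ≠ 0) (x : K2) :
    polyK p * (x * (polyK p)⁻¹) = x := by
  rw [k2_mul_comm, k2_mul_assoc, k2_mul_comm _ (polyK p), k2_mul_inv (polyK_ne_zero hp),
    k2_mul_one]

theorem ev_monomial (d : Fin 2 →₀ ℕ) (c : ℂ) :
    ev x2 (MvPolynomial.monomial d c) =
      AddMonoidAlgebra.single ((d 0 : ℤ), (d 1 : ℤ)) c := by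
  ext g
  rw [coeff_eq_act, coeff_eq_act, act_monomial, act_single]
  congr 3
  rw [Fin.sum_univ_two]
  exact Prod.ext (by simp) (by simp)

theorem exists_monomial_mul (f : AddMonoidAlgebra ℂ (ℤ × ℤ)) :
    ∃ (N : ℕ) (P : MvPolynomial (Fin 2) ℂ),
      ev x2 (MvPolynomial.monomial (Finsupp.single 0 N + Finsupp.single 1 N) 1) * f =
        ev x2 P := by
  have hs : f = ∑ d ∈ f.coeff.support, AddMonoidAlgebra.single d (f.coeff d) := by
    ext g
    rw [coeff_eq_act, act_apply, coeff_eq_act (∑ d ∈ _, _), map_sum, LinearMap.sum_apply,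
      Finset.sum_apply]
    exact Finset.sum_congr rfl fun d _ => by rw [act_single]
  obtain ⟨N, hN⟩ : ∃ N : ℕ, ∀ d ∈ f.coeff.support, -(N : ℤ) ≤ d.1 ∧ -(N : ℤ) ≤ d.2 := by
    refine ⟨∑ d ∈ f.coeff.support, (d.1.natAbs + d.2.natAbs), fun d hd => ?_⟩
    have := Finset.single_le_sum (f := fun d : ℤ × ℤ => d.1.natAbs + d.2.natAbs)
      (fun _ _ => Nat.zero_le _) hd
    omega
  refine ⟨N, ∑ d ∈ f.coeff.support, MvPolynomial.monomial
    (Finsupp.single 0 (d.1 + N).toNat + Finsupp.single 1 (d.2 + N).toNat) (f.coeff d), ?_⟩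
  conv_lhs => rw [hs]
  rw [map_sum, Finset.mul_sum]
  refine Finset.sum_congr rfl fun d hd => ?_
  rw [ev_monomial, ev_monomial, AddMonoidAlgebra.single_mul_single, one_mul]
  obtain ⟨h1, h2⟩ := hN d hd
  congr 1
  ext
  · simp; omega
  · simp; omega

theorem mulLPoly_eq (f : AddMonoidAlgebra ℂ (ℤ × ℤ)) (F : ℤ → ℤ → V) (m t : ℤ) :
    mulLPoly f.coeff F m t = act f (fun g => F g.1 g.2) (m, t) := by
  rw [act_apply]
  rfl

theorem PseudoLocal.loc (h : PseudoLocal S) :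
    Loc (nonZeroDivisors (MvPolynomial (Fin 2) ℂ)) true S S := by
  refine loc_of_rational fun a ha b hb => ?_
  obtain ⟨p, hp, r, F, g, u, v, hg, hu, hv, hw⟩ := h a ha b hb
  obtain ⟨f, rfl⟩ : ∃ f : AddMonoidAlgebra ℂ (ℤ × ℤ), f.coeff = p := ⟨⟨p⟩, rfl⟩
  obtain ⟨N, P, hP⟩ := exists_monomial_mul f
  refine ⟨f, _, P, r, fun i => psEmbed (F i) * (polyEmbed (g i))⁻¹, g, fun _ => 1, F, u, v, ?_, hP,
    fun i => mem_nonZeroDivisors_of_ne_zero (hg i), fun i => ?_, hu, hv, fun w => ?_⟩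
  · refine mem_nonZeroDivisors_of_ne_zero ?_
    rintro rfl
    apply hp
    rw [ev_monomial] at hP
    have h1 : f = 0 := eq_zero_of_tr_mul (hP.trans (map_zero _))
    rw [h1]
    rfl
  · dsimp only
    rw [polyEmbed_eq, polyK_mul_div (hg i), polyK_one_mul]
  · funext ⟨m, t⟩
    have h1 := hw w m t
    rw [mulLPoly_eq] at h1
    simp_rw [smulFam_Fab] at h1
    rw [Finset.sum_apply]
    exact h1

theorem Loc.pseudoLocal (hM : M ≤ nonZeroDivisors _) (h : Loc M true S S) : PseudoLocal S := by
  intro a ha b hb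
  obtain ⟨Q, hQ, hΦ⟩ := h a ha b hb
  obtain ⟨r, F, u, v, hu, hv, hw⟩ := SerSpan.exists_sum hΦ
  refine ⟨(ev x2 Q).coeff, ?_, r, F, fun _ => 1, u, v, fun _ => one_ne_zero, hu, hv,
    fun w m t => ?_⟩
  · intro h0
    refine ev_ne_zero (nonZeroDivisors.ne_zero (hM hQ)) ?_
    ext g
    rw [h0]
    rfl
  · rw [mulLPoly_eq]
    simp_rw [smulFam_Fab]
    have h1 : ∀ i, psEmbed (F i) * (polyEmbed 1)⁻¹ = psEmbed (F i) := by
      intro i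
      rw [polyEmbed_eq]
      have := polyK_mul_div one_ne_zero (psEmbed (F i))
      rwa [polyK_one_mul] at this
    simp_rw [h1]
    have h2 := congrFun (hw w) (m, t)
    rw [Finset.sum_apply] at h2
    exact h2

theorem swp_ne_zero {Q : MvPolynomial (Fin 2) ℂ} (hQ : Q ≠ 0) : swp Q ≠ 0 := by
  intro h
  refine hQ (MvPolynomial.rename_injective (![1, 0] : Fin 2 → Fin 2) (by decide) ?_)
  rw [map_zero]
  exact h

theorem PseudoLocal.gen (h : PseudoLocal S) {U : Submodule ℂ (EW W)} (hU : IsGenVA S U) :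
    PseudoLocal (U : Set (EW W)) :=
  Loc.pseudoLocal le_rfl <| Loc.gen_gen
    (fun _ hQ => mem_nonZeroDivisors_of_ne_zero (swp_ne_zero (nonZeroDivisors.ne_zero hQ)))
    hU h.loc

end

section

/-! ### Pseudo-locality with respect to a group -/

variable {S : Set (EW W)} {Γ : Subgroup ℂˣ}

/-- The product of the `x₁ - α x₂`. -/
def linProd (αs : List ℂˣ) : MvPolynomial (Fin 2) ℂ :=
  (αs.map fun α : ℂˣ => MvPolynomial.X 0 - MvPolynomial.C (α : ℂ) * MvPolynomial.X 1).prod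

theorem linProd_cons (α : ℂˣ) (αs : List ℂˣ) : linProd (α :: αs) =
    (MvPolynomial.X 0 - MvPolynomial.C (α : ℂ) * MvPolynomial.X 1) * linProd αs := by
  rw [linProd, List.map_cons, List.prod_cons, linProd]

theorem linProd_append (αs βs : List ℂˣ) : linProd (αs ++ βs) = linProd αs * linProd βs := by
  rw [linProd, List.map_append, List.prod_append, linProd, linProd]

theorem lin_ne_zero (α : ℂ) :
    (MvPolynomial.X 0 - MvPolynomial.C α * MvPolynomial.X 1 : MvPolynomial (Fin 2) ℂ) ≠ 0 := by
  intro h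
  have := congrArg (MvPolynomial.eval ![1, 0]) h
  simp at this

theorem linProd_ne_zero (αs : List ℂˣ) : linProd αs ≠ 0 := by
  induction αs with
  | nil => exact one_ne_zero
  | cons α αs ih =>
    rw [linProd_cons]
    exact mul_ne_zero (lin_ne_zero _) ih

theorem swp_linProd (αs : List ℂˣ) : ∃ c : ℂ, c ≠ 0 ∧
    swp (linProd αs) = MvPolynomial.C c * linProd (αs.map fun α => α⁻¹) := by
  induction αs with
  | nil => exact ⟨1, one_ne_zero, by simp [linProd]⟩
  | cons α αs ih =>
    obtain ⟨c, hc, h⟩ := ih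
    refine ⟨-α * c, mul_ne_zero (neg_ne_zero.2 α.ne_zero) hc, ?_⟩
    rw [List.map_cons, linProd_cons, linProd_cons, map_mul, h]
    have h1 : swp (MvPolynomial.X 0 - MvPolynomial.C (α : ℂ) * MvPolynomial.X 1) =
        MvPolynomial.C (-α : ℂ) *
          (MvPolynomial.X 0 - MvPolynomial.C ((α⁻¹ : ℂˣ) : ℂ) * MvPolynomial.X 1) := by
      have h2 : (MvPolynomial.C (α : ℂ) * MvPolynomial.C ((α⁻¹ : ℂˣ) : ℂ) :
          MvPolynomial (Fin 2) ℂ) = 1 := by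
        rw [← map_mul, Units.mul_inv, map_one]
      rw [swp, map_sub, map_mul, MvPolynomial.rename_X, MvPolynomial.rename_X,
        MvPolynomial.rename_C, map_neg]
      change (MvPolynomial.X 1 - MvPolynomial.C (α : ℂ) * MvPolynomial.X 0 : MvPolynomial _ _) = _
      linear_combination -MvPolynomial.X 1 * h2
    rw [h1, map_mul]
    ring

/-- The polynomials which are, up to a nonzero scalar, products of `x₁`, `x₂` and
`x₁ - α x₂` for `α ∈ Γ`. -/
def gammaM (Γ : Subgroup ℂˣ) : Submonoid (MvPolynomial (Fin 2) ℂ) where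
  carrier := {Q | ∃ (c : ℂ) (m t : ℕ) (αs : List ℂˣ), c ≠ 0 ∧ (∀ α ∈ αs, α ∈ Γ) ∧
    Q = MvPolynomial.C c * (MvPolynomial.X 0 ^ m * MvPolynomial.X 1 ^ t * linProd αs)}
  one_mem' := ⟨1, 0, 0, [], one_ne_zero, by simp, by simp [linProd]⟩
  mul_mem' := by
    rintro _ _ ⟨c, m, t, αs, hc, hα, rfl⟩ ⟨c', m', t', αs', hc', hα', rfl⟩
    refine ⟨c * c', m + m', t + t', αs ++ αs', mul_ne_zero hc hc', ?_, ?_⟩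
    · intro α h
      rcases List.mem_append.1 h with h | h
      · exact hα α h
      · exact hα' α h
    · rw [linProd_append, map_mul]
      ring

theorem mem_gammaM_of {m t : ℕ} {αs : List ℂˣ} (h : ∀ α ∈ αs, α ∈ Γ) :
    MvPolynomial.X 0 ^ m * MvPolynomial.X 1 ^ t * linProd αs ∈ gammaM Γ :=
  ⟨1, m, t, αs, one_ne_zero, h, by rw [map_one, one_mul]⟩

theorem swp_mem_gammaM {Q : MvPolynomial (Fin 2) ℂ} (hQ : Q ∈ gammaM Γ) : swp Q ∈ gammaM Γ := by
  obtain ⟨c, m, t, αs, hc, hα, rfl⟩ := hQ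
  obtain ⟨c', hc', h⟩ := swp_linProd αs
  refine ⟨c * c', t, m, αs.map fun α => α⁻¹, mul_ne_zero hc hc', ?_, ?_⟩
  · intro α h
    obtain ⟨β, hβ, rfl⟩ := List.mem_map.1 h
    exact Γ.inv_mem (hα β hβ)
  · rw [map_mul, map_mul, h, map_mul, map_pow, map_pow, swp, MvPolynomial.rename_X,
      MvPolynomial.rename_X, MvPolynomial.rename_C, map_mul]
    change MvPolynomial.C c * (MvPolynomial.X 1 ^ m * MvPolynomial.X 0 ^ t * _) = _
    ring

theorem kf_xInner_inv_mul (x : K2) : kf (xInner⁻¹ * x) = act (tr (0, -1)) (kf x) := by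
  have h0 : xInner ≠ 0 := by
    have h := polyK_ne_zero (MvPolynomial.X_ne_zero (R := ℂ) (1 : Fin 2))
    rwa [polyK, MvPolynomial.aeval_X] at h
  have h := kf_xInner_mul (xInner⁻¹ * x)
  rw [← k2_mul_assoc, k2_mul_inv h0, k2_one_mul] at h
  rw [h, ← act_mul, tr_mul]
  exact (act_one _).symm

theorem kf_ratio_mul (x : K2) :
    kf (xOuter * xInner⁻¹ * x) = act (tr (1, -1)) (kf x) := by
  rw [k2_mul_assoc, kf_xOuter_mul, kf_xInner_inv_mul, ← act_mul, tr_mul]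
  rfl

theorem kf_polynomial_aeval_mul (X : K2) (Y : AddMonoidAlgebra ℂ (ℤ × ℤ))
    (h : ∀ x, kf (X * x) = act Y (kf x)) (p : Polynomial ℂ) :
    ∀ x, kf (Polynomial.aeval X p * x) = act (Polynomial.aeval Y p) (kf x) := by
  have hC : ∀ (c : ℂ) x, kf (Polynomial.aeval X (Polynomial.C c) * x) =
      act (Polynomial.aeval Y (Polynomial.C c)) (kf x) := by
    intro c x
    have h1 := kf_aeval_C_mul ![X] c x
    rw [MvPolynomial.aeval_C] at h1
    rw [Polynomial.aeval_C, Polynomial.aeval_C, h1, AlgHom.commutes,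
      Module.algebraMap_end_apply]
  induction p using Polynomial.induction_on with
  | C a => exact hC a
  | add p q hp hq => intro x; rw [map_add, map_add, k2_add_mul, kf_add, hp, hq, act_add]
  | monomial n a hn =>
    intro x
    rw [pow_succ, ← mul_assoc, map_mul, map_mul _ _ Polynomial.X, Polynomial.aeval_X,
      Polynomial.aeval_X, k2_mul_assoc, hn, h, act_mul]

theorem kf_iotaRatPoly_mul (p : Polynomial ℂ) (x : K2) :
    kf (iotaRatPoly p * x) = act (Polynomial.aeval (tr (1, -1)) p) (kf x) :=
  kf_polynomial_aeval_mul _ _ kf_ratio_mul p x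

theorem mulRatPoly_eq (p : Polynomial ℂ) (F : ℤ → ℤ → V) (m t : ℤ) :
    mulRatPoly p F m t =
      act (Polynomial.aeval (tr (1, -1)) p) (fun g => F g.1 g.2) (m, t) := by
  rw [Polynomial.aeval_def, Polynomial.eval₂_eq_sum, Polynomial.sum_def, map_sum,
    LinearMap.sum_apply, Finset.sum_apply]
  refine Finset.sum_congr rfl fun d _ => ?_
  rw [act_mul, AlgHom.commutes, Module.algebraMap_end_apply, tr_pow, Pi.smul_apply, act_tr]
  simp

theorem ev_X (i : Fin 2) : ev x2 (MvPolynomial.X i) = tr (x2 i) := MvPolynomial.aeval_X _ _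

theorem ev_mul_gammaPoly (αs : List ℂˣ) :
    ev x2 (MvPolynomial.X 1 ^ αs.length) * Polynomial.aeval (tr (1, -1)) (gammaPoly αs) =
      ev x2 (linProd αs) := by
  induction αs with
  | nil => simp [gammaPoly, linProd]
  | cons α αs ih =>
    rw [linProd_cons, map_mul, ← ih]
    have h : gammaPoly (α :: αs) = (Polynomial.X - Polynomial.C (α : ℂ)) * gammaPoly αs := by
      simp [gammaPoly]
    have h1 : ev x2 (MvPolynomial.X 1) * (tr (1, -1) - algebraMap ℂ _ (α : ℂ)) =
        ev x2 (MvPolynomial.X 0 - MvPolynomial.C (α : ℂ) * MvPolynomial.X 1) := by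
      rw [map_sub, map_mul, ev_X, ev_X, MvPolynomial.aeval_C, mul_sub, tr_mul, mul_comm _ (tr _)]
      rfl
    rw [h, List.length_cons, pow_succ, map_mul, map_mul, map_sub, Polynomial.aeval_X,
      Polynomial.aeval_C, ← h1]
    ring

end

section

variable {S : Set (EW W)} {Γ : Subgroup ℂˣ}

theorem isUnit_tr (g : G) : IsUnit (tr g) := by
  refine IsUnit.of_mul_eq_one (tr (-g)) ?_
  rw [tr_mul, add_neg_cancel]
  rfl

theorem act_injective {f : AddMonoidAlgebra ℂ G} (hf : IsUnit f) {F F' : G → V}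
    (h : act f F = act f F') : F = F' := by
  obtain ⟨g, hg⟩ := hf.exists_left_inv
  rw [← act_one F, ← act_one F', ← hg, act_mul, act_mul, h]

/-- The denominator `x₁^m x₂^t ∏ (x₁ - γ x₂)`. -/
def gammaDen (m t : ℕ) (γs : List ℂˣ) : MvPolynomial (Fin 2) ℂ :=
  MvPolynomial.X 0 ^ m * MvPolynomial.X 1 ^ t * linProd γs

theorem gammaDen_ne_zero (m t : ℕ) (γs : List ℂˣ) : gammaDen m t γs ≠ 0 :=
  mul_ne_zero (mul_ne_zero (pow_ne_zero _ (MvPolynomial.X_ne_zero _))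
    (pow_ne_zero _ (MvPolynomial.X_ne_zero _))) (linProd_ne_zero _)

theorem kf_sub (x y : K2) : kf (x - y) = kf x - kf y := by
  funext g; simp [kf, k2Fun]

theorem polyK_lin (γ : ℂ) :
    polyK (MvPolynomial.X 0 - MvPolynomial.C γ * MvPolynomial.X 1) = xOuter - xInnerC γ := by
  apply kf_injective
  have h2 := kf_xOuter_mul 1
  have h3 := kf_inner_mul γ 1
  have h4 := kf_polyK_mul (MvPolynomial.X 0 - MvPolynomial.C γ * MvPolynomial.X 1) 1
  rw [k2_mul_one] at h2 h3 h4
  rw [h4, kf_sub, h2, h3, map_sub, map_mul, map_sub, LinearMap.sub_apply,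
    act_mul, ev_X, ev_X, MvPolynomial.aeval_C, AlgHom.commutes, Module.algebraMap_end_apply]
  rfl

theorem polyK_mul (p q : MvPolynomial (Fin 2) ℂ) : polyK (p * q) = polyK p * polyK q := by
  rw [← k2_mul_one (polyK (p * q)), polyK_mul_mul, k2_mul_one]

theorem polyK_one : polyK 1 = 1 := by rw [← k2_mul_one (polyK 1), polyK_one_mul]

theorem polyK_pow (p : MvPolynomial (Fin 2) ℂ) (n : ℕ) : polyK (p ^ n) = polyK p ^ n := by
  induction n with
  | zero => rw [pow_zero, polyK_one]; exact (pow_zero (polyK p)).symm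
  | succ n ih => rw [pow_succ, polyK_mul, ih]; exact (pow_succ (polyK p) n).symm

theorem polyK_linProd (γs : List ℂˣ) :
    polyK (linProd γs) = (γs.map fun γ : ℂˣ => xOuter - xInnerC (γ : ℂ)).prod := by
  induction γs with
  | nil => exact polyK_one
  | cons γ γs ih =>
    rw [linProd_cons, polyK_mul, polyK_lin, ih, List.map_cons, List.prod_cons]

theorem iotaGammaPsi_eq (F : ℕ → ℕ → ℂ) (m t : ℕ) (γs : List ℂˣ) :
    iotaGammaPsi F m t γs = psEmbed F * (polyK (gammaDen m t γs))⁻¹ := by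
  have h : polyK (gammaDen m t γs) = xOuter ^ m * xInner ^ t *
      (γs.map fun γ : ℂˣ => xOuter - xInnerC (γ : ℂ)).prod := by
    rw [gammaDen, polyK_mul, polyK_mul, polyK_pow, polyK_pow, polyK_linProd, polyK, polyK,
      MvPolynomial.aeval_X, MvPolynomial.aeval_X]
    rfl
  have h' : ∀ l : List ℂˣ, ((do let a ← l; pure (a : ℂ)) : List ℂ).map (fun γ => xOuter - xInnerC γ) =
      l.map fun γ : ℂˣ => xOuter - xInnerC (γ : ℂ) := by
    intro l
    induction l with
    | nil => rfl
    | cons γ l ih => exact congrArg (List.cons _) ih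
  rw [h, iotaGammaPsi, h']

theorem act_kf_iotaGammaPsi (F : ℕ → ℕ → ℂ) (m t : ℕ) (γs : List ℂˣ) :
    act (ev x2 (gammaDen m t γs)) (kf (iotaGammaPsi F m t γs)) = kf (psEmbed F) := by
  rw [← kf_polyK_mul, iotaGammaPsi_eq, polyK_mul_div (gammaDen_ne_zero _ _ _)]

theorem PseudoGammaLocal.loc (h : PseudoGammaLocal Γ S) : Loc (gammaM Γ) true S S := by
  refine loc_of_rational fun a ha b hb => ?_
  obtain ⟨αs, hα, r, F, e1, e2, γs, u, v, hγ, hu, hv, hw⟩ := h a ha b hb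
  refine ⟨_, _, _, r, fun i => iotaRatPoly (gammaPoly αs) * iotaGammaPsi (F i) (e1 i) (e2 i) (γs i),
    fun i => MvPolynomial.X 1 ^ αs.length * gammaDen (e1 i) (e2 i) (γs i), fun _ => linProd αs, F,
    u, v, ?_, ev_mul_gammaPoly αs, fun i => ?_, fun i => ?_, hu, hv, fun w => ?_⟩
  · have h1 := mem_gammaM_of (m := 0) (t := 0) hα
    rwa [pow_zero, pow_zero, one_mul, one_mul] at h1
  · have h1 := mem_gammaM_of (Γ := Γ) (m := 0) (t := αs.length) (αs := [])
      fun _ h => absurd h List.not_mem_nil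
    rw [pow_zero, one_mul, linProd, List.map_nil, List.prod_nil, mul_one] at h1
    exact (gammaM Γ).mul_mem h1 (mem_gammaM_of (hγ i))
  · apply kf_injective
    dsimp only
    rw [kf_polyK_mul, kf_polyK_mul, kf_iotaRatPoly_mul, ← act_mul, map_mul (ev x2), mul_right_comm,
      ev_mul_gammaPoly, act_mul, act_kf_iotaGammaPsi]
  · funext ⟨m, t⟩
    have h1 := hw w m t
    rw [mulRatPoly_eq] at h1
    simp_rw [smulFam_Fab] at h1
    rw [Finset.sum_apply]
    exact h1

theorem act_gammaDen (m t : ℕ) (αs : List ℂˣ) (f : ℤ × ℤ → V) :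
    act (ev x2 (MvPolynomial.X 0 ^ m * MvPolynomial.X 1 ^ t) *
      ev x2 (MvPolynomial.X 1 ^ αs.length))
        (act (Polynomial.aeval (tr (1, -1)) (gammaPoly αs)) f) =
      act (ev x2 (gammaDen m t αs)) f := by
  rw [← act_mul, mul_assoc, ev_mul_gammaPoly, ← map_mul]
  rfl

theorem Loc.pseudoGammaLocal (h : Loc (gammaM Γ) true S S) : PseudoGammaLocal Γ S := by
  intro a ha b hb
  obtain ⟨Q, ⟨c, m, t, αs, hc, hα, rfl⟩, hΦ⟩ := h a ha b hb
  obtain ⟨r, F, u, v, hu, hv, hw⟩ := SerSpan.exists_sum (Submodule.smul_mem _ c⁻¹ hΦ)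
  refine ⟨αs, hα, r, F, fun _ => m, fun _ => t, fun _ => αs, u, v, fun _ => hα, hu, hv,
    fun w m' t' => ?_⟩
  rw [mulRatPoly_eq]
  simp_rw [smulFam_Fab]
  rw [← Finset.sum_apply (m', t')]
  refine congrFun ?_ (m', t')
  have hg : IsUnit (ev x2 (MvPolynomial.X 0 ^ m * MvPolynomial.X 1 ^ t) *
      ev x2 (MvPolynomial.X 1 ^ αs.length)) := by
    rw [map_mul, map_pow, map_pow, map_pow, ev_X, ev_X]
    exact (((isUnit_tr _).pow _).mul ((isUnit_tr _).pow _)).mul ((isUnit_tr _).pow _)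
  refine act_injective hg ?_
  rw [act_gammaDen, map_sum]
  have h3 := hw w
  rw [Pi.smul_apply, map_mul, act_mul, MvPolynomial.aeval_C, AlgHom.commutes,
    Module.algebraMap_end_apply, inv_smul_smul₀ hc] at h3
  refine h3.trans (Finset.sum_congr rfl fun i _ => ?_)
  rw [← sf_act _ (kf_nested _) (Xf_false_nested _ _ _), kf_iotaRatPoly_mul, act_gammaDen,
    act_kf_iotaGammaPsi]

theorem PseudoGammaLocal.gen (h : PseudoGammaLocal Γ S) {U : Submodule ℂ (EW W)}
    (hU : IsGenVA S U) : PseudoGammaLocal Γ (U : Set (EW W)) :=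
  Loc.pseudoGammaLocal (Loc.gen_gen (fun _ => swp_mem_gammaM) hU h.loc)

end

end

/-- cf. Theorem 4.3 / `tpseudo-locality-key`.  If `S` is a
pseudo-local subset of `ℰ(W)` then `W` is a faithful pseudo-local quasi module for
the nonlocal vertex algebra `⟨S⟩`, with `Y_W(α(x), x₀) = α(x₀)`; and if `S` is
pseudo `Γ`-local for a subgroup `Γ ≤ ℂˣ`, then `W` is a pseudo `Γ`-local quasi
module. -/
theorem statement12 {W : Type*} [AddCommGroup W] [Module ℂ W]
    (S : Set (EW W)) (hS : PseudoLocal S)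
    (U : Submodule ℂ (EW W)) (hU : IsGenVA S U) :
    ∃ A : NLVA ↥U, (A.one : EW W) = oneE ∧
      (∀ (a b : ↥U) (n : ℤ), ((Yf A a b n : ↥U) : EW W) = YE (a : EW W) (b : EW W) n) ∧
      IsQuasiModule A U.subtype ∧ Function.Injective U.subtype ∧
      PseudoLocal (U : Set (EW W)) ∧
      (∀ Γ : Subgroup ℂˣ, PseudoGammaLocal Γ S → PseudoGammaLocal Γ (U : Set (EW W))) := by
  exact ⟨closedNLVA U hU.1 hU.2.1 hU.2.2.1, rfl, fun _ _ _ => rfl,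
    closedNLVA_isQuasiModule U hU.1 hU.2.1 hU.2.2.1, U.injective_subtype, hS.gen hU,
    fun _ h => h.gen hU⟩

end NVA
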